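/- (Local Hardy inequality for the Grushin gradient with fourth-order weight) Assume m > 2, Q > 6, and 0 < α ≤ 1. There exists a constant C = C(m, n, α) such that for all smooth u on a neighborhood of the closed gauge ball B_r: ∫_{B_r} |∇_X u|²/ρ⁴ ≤ C ( r^{−4}∫_{B_r}|∇_X u|² + ∫_{B_r}|∇_X(Δ_X u)|² + r^{−5}∫_{∂B_r} u²ψ/|∇ρ| + r^{−1}∫_{∂B_r} (Δ_X u)²ψ/|∇ρ| ). -/

import Mathlib

open MeasureTheory Real

noncomputable section

abbrev E (m n : ℕ) := EuclideanSpace ℝ (Fin m) × EuclideanSpace ℝ (Fin n)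

/-- The gauge norm `ρ(x,y) = (|x|^{2(α+1)} + (α+1)²|y|²)^{1/(2(α+1))}`. -/
def rho {m n : ℕ} (α : ℝ) (z : E m n) : ℝ :=
  (‖z.1‖ ^ (2*(α+1)) + (α+1)^2 * ‖z.2‖^2) ^ (1/(2*(α+1)))

/-- The angle function `ψ = |x|^{2α}/ρ^{2α}`. -/
def psi {m n : ℕ} (α : ℝ) (z : E m n) : ℝ :=
  ‖z.1‖ ^ (2*α) / (rho α z) ^ (2*α)

/-- The gauge ball of radius `r`. -/
def gball {m n : ℕ} (α r : ℝ) : Set (E m n) := {z | rho α z < r}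

/-- The gauge sphere of radius `r`. -/
def gsphere {m n : ℕ} (α r : ℝ) : Set (E m n) := {z | rho α z = r}

/-- Squared norm of the Baouendi-Grushin gradient `∇_X u = (∇_x u, |x|^α ∇_y u)`. -/
def gradXsq {m n : ℕ} (α : ℝ) (u : E m n → ℝ) (z : E m n) : ℝ :=
  (∑ i, (fderiv ℝ u z (EuclideanSpace.single i 1, 0))^2)
  + ‖z.1‖ ^ (2*α) * (∑ j, (fderiv ℝ u z (0, EuclideanSpace.single j 1))^2)

/-- The Baouendi-Grushin Laplacian `Δ_X u = Δ_x u + |x|^{2α} Δ_y u`. -/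
def lapX {m n : ℕ} (α : ℝ) (u : E m n → ℝ) (z : E m n) : ℝ :=
  (∑ i, fderiv ℝ (fun w => fderiv ℝ u w (EuclideanSpace.single i 1, 0)) z
      (EuclideanSpace.single i 1, 0))
  + ‖z.1‖ ^ (2*α) *
    (∑ j, fderiv ℝ (fun w => fderiv ℝ u w (0, EuclideanSpace.single j 1)) z
      (0, EuclideanSpace.single j 1))

/-- The generator of anisotropic dilations `Zu = x·∇_x u + (α+1) y·∇_y u`. -/
def Zop {m n : ℕ} (α : ℝ) (u : E m n → ℝ) (z : E m n) : ℝ :=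
  fderiv ℝ u z (z.1, (α+1) • z.2)

/-- Euclidean norm of the full gradient of `ρ`. -/
def normGradRho {m n : ℕ} (α : ℝ) (z : E m n) : ℝ :=
  Real.sqrt ((∑ i, (fderiv ℝ (rho α) z (EuclideanSpace.single i 1, 0))^2)
    + (∑ j, (fderiv ℝ (rho α) z (0, EuclideanSpace.single j 1))^2))

/-- The power `ρ^{2(α+1)}` of the gauge norm. -/
def gaugePow {m n : ℕ} (α : ℝ) (z : E m n) : ℝ :=
  ‖z.1‖ ^ (2*(α+1)) + (α+1)^2 * ‖z.2‖^2

/-- The Grushin weight `|x|^{2α}`. -/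
def wt {m n : ℕ} (α : ℝ) (z : E m n) : ℝ := ‖z.1‖ ^ (2*α)

/-- The coordinate vectors in the `x` directions. -/
abbrev ex {m n : ℕ} (i : Fin m) : E m n := (EuclideanSpace.single i 1, 0)

/-- The coordinate vectors in the `y` directions. -/
abbrev ey {m n : ℕ} (j : Fin n) : E m n := (0, EuclideanSpace.single j 1)

instance instIsAddHaarMeasureE {m n : ℕ} : (volume : Measure (E m n)).IsAddHaarMeasure :=
  Measure.prod.instIsAddHaarMeasure _ _

lemma integral_lineDeriv_eq_zero {m n : ℕ} {V V' : E m n → ℝ} {v : E m n}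
    (hV : Integrable V) (hV' : Integrable V')
    (h : ∀ z, HasLineDerivAt ℝ V (V' z) z v) : ∫ z, V' z = 0 := by
  have := integral_bilinear_hasLineDerivAt_right_eq_neg_left_of_integrable (μ := volume)
    (f := fun _ : E m n => (1:ℝ)) (f' := fun _ => (0:ℝ)) (g := V) (g' := V') (v := v)
    (B := ContinuousLinearMap.mul ℝ ℝ) (by simp) (by simpa using hV') (by simpa using hV)
    (fun x _ => by simpa [HasLineDerivAt] using hasDerivAt_const (0:ℝ) (1:ℝ)) (fun x _ => h x)
  simpa using this

lemma sum_coord_x {m n : ℕ} (z : E m n) : ∑ i, z.1 i ^ 2 = ‖z.1‖ ^ 2 := by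
  rw [EuclideanSpace.norm_sq_eq]; simp

lemma sum_coord_y {m n : ℕ} (z : E m n) : ∑ i, z.2 i ^ 2 = ‖z.2‖ ^ 2 := by
  rw [EuclideanSpace.norm_sq_eq]; simp

section basics

variable {m n : ℕ} {α : ℝ}

lemma gaugePow_nonneg (z : E m n) : 0 ≤ gaugePow α z := by
  unfold gaugePow; positivity

lemma wt_nonneg (z : E m n) : 0 ≤ wt α z := by
  unfold wt; positivity

lemma continuous_wt (hα : 0 < α) : Continuous (wt α : E m n → ℝ) := by
  unfold wt
  exact continuous_fst.norm.rpow_const (fun z => Or.inr (by linarith))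

lemma continuous_gaugePow (hα : 0 < α) : Continuous (gaugePow α : E m n → ℝ) := by
  unfold gaugePow
  exact (continuous_fst.norm.rpow_const (fun z => Or.inr (by linarith))).add (by fun_prop)

lemma norm_rpow_two_mul_add (hα : 0 < α) (z : E m n) :
    ‖z.1‖ ^ (2*(α+1)) = wt α z * ‖z.1‖ ^ 2 := by
  unfold wt
  rw [← Real.rpow_natCast, ← Real.rpow_add_of_nonneg (norm_nonneg _) (by linarith) (by simp)]
  congr 1; push_cast; ring

lemma gaugePow_eq (hα : 0 < α) (z : E m n) :
    gaugePow α z = wt α z * ‖z.1‖ ^ 2 + (α+1)^2 * ‖z.2‖^2 := by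
  rw [gaugePow, norm_rpow_two_mul_add hα]

lemma rho_eq (z : E m n) : rho α z = gaugePow α z ^ (1/(2*(α+1))) := rfl

lemma rho_lt_iff (hα : 0 < α) {r : ℝ} (hr : 0 < r) (z : E m n) :
    rho α z < r ↔ gaugePow α z < r ^ (2*(α+1)) := by
  rw [rho_eq, one_div, Real.rpow_inv_lt_iff_of_pos (gaugePow_nonneg z) hr.le (by linarith)]

lemma rho_eq_iff (hα : 0 < α) {r : ℝ} (hr : 0 < r) (z : E m n) :
    rho α z = r ↔ gaugePow α z = r ^ (2*(α+1)) := by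
  rw [rho_eq, one_div, Real.rpow_inv_eq (gaugePow_nonneg z) hr.le (by linarith)]

lemma rho_le_iff (hα : 0 < α) {r : ℝ} (hr : 0 < r) (z : E m n) :
    rho α z ≤ r ↔ gaugePow α z ≤ r ^ (2*(α+1)) := by
  rw [le_iff_lt_or_eq, le_iff_lt_or_eq, rho_lt_iff hα hr, rho_eq_iff hα hr]

/-- The differential of `gaugePow`. -/
def dGaugePow (α : ℝ) (z : E m n) : E m n →L[ℝ] ℝ :=
  ((2*(α+1)) * wt α z) • (innerSL ℝ z.1).comp (ContinuousLinearMap.fst ℝ _ _)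
    + (2*(α+1)^2) • (innerSL ℝ z.2).comp (ContinuousLinearMap.snd ℝ _ _)

lemma hasFDerivAt_gaugePow (hα : 0 < α) (z : E m n) :
    HasFDerivAt (gaugePow α) (dGaugePow α z) z := by
  have h1 := (hasFDerivAt_norm_rpow z.1 (p := 2*(α+1)) (by linarith)).comp z
    (hasFDerivAt_fst (𝕜 := ℝ) (p := z))
  have h2 := ((hasStrictFDerivAt_norm_sq z.2).hasFDerivAt.comp z
    (hasFDerivAt_snd (𝕜 := ℝ) (p := z))).const_mul ((α+1)^2)
  refine (h1.add h2).congr_fderiv ?_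
  have e : 2*(α+1) - 2 = 2*α := by ring
  ext v <;> simp [dGaugePow, wt, e]
  ring

@[simp] lemma dGaugePow_ex (z : E m n) (i : Fin m) :
    dGaugePow α z (ex i) = 2*(α+1) * wt α z * z.1 i := by
  simp [dGaugePow, ex, EuclideanSpace.inner_single_right]

@[simp] lemma dGaugePow_ey (z : E m n) (j : Fin n) :
    dGaugePow α z (ey j) = 2*(α+1)^2 * z.2 j := by
  simp [dGaugePow, ey, EuclideanSpace.inner_single_right]

lemma hasLineDerivAt_wt_mul (hα : 0 < α) (z : E m n) (i : Fin m) :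
    HasLineDerivAt ℝ (fun z : E m n => wt α z * z.1 i)
      (wt α z + 2*α * (‖z.1‖ ^ (2*α-2) * z.1 i ^ 2)) z (ex i) := by
  by_cases hx : z.1 = 0
  · have h0 : wt α z + 2*α * (‖z.1‖ ^ (2*α-2) * z.1 i ^ 2) = 0 := by
      simp [wt, hx, Real.zero_rpow (by linarith : 2*α ≠ 0)]
    rw [h0, HasLineDerivAt, hasDerivAt_iff_tendsto_slope_zero]
    have h1 : Filter.Tendsto (fun t : ℝ => |t| ^ (2*α)) (nhdsWithin 0 {0}ᶜ) (nhds 0) := by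
      have : ContinuousAt (fun t : ℝ => |t| ^ (2*α)) 0 :=
        (continuous_abs.rpow_const (fun z => Or.inr (by linarith))).continuousAt
      have h := this.tendsto
      simp only [abs_zero, Real.zero_rpow (by linarith : 2*α ≠ 0)] at h
      exact h.mono_left nhdsWithin_le_nhds
    refine h1.congr' ?_
    filter_upwards [self_mem_nhdsWithin] with t ht
    have ht : t ≠ 0 := ht
    simp [wt, hx, norm_smul]
    field_simp
  · have hpos : 0 < ‖z.1‖ ^ 2 := by positivity
    have hl : HasDerivAt (fun t : ℝ => z.1 + t • (EuclideanSpace.single i (1:ℝ)))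
        (EuclideanSpace.single i (1:ℝ)) 0 := by
      simpa using ((hasDerivAt_id (0:ℝ)).smul_const
        (EuclideanSpace.single i (1:ℝ))).const_add z.1
    have hn : HasDerivAt (fun t : ℝ => ‖z.1 + t • (EuclideanSpace.single i (1:ℝ))‖ ^ 2)
        (2 * z.1 i) 0 := by
      have := hl.norm_sq
      simpa [EuclideanSpace.inner_single_right] using this
    have hp := hn.rpow_const (p := α) (Or.inl (by simpa using hpos.ne'))
    have hc : HasDerivAt (fun t : ℝ => z.1 i + t) 1 0 := by
      simpa using (hasDerivAt_id (0:ℝ)).const_add (z.1 i)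
    have hm := hp.mul hc
    have e1 : ∀ t : ℝ, 0 ≤ t → (t ^ 2) ^ α = t ^ (2 * α) := fun t ht => by
      rw [Real.rpow_mul ht]; norm_cast
    have e2 : ∀ t : ℝ, 0 ≤ t → (t ^ 2) ^ (α - 1) = t ^ (2 * α - 2) := fun t ht => by
      rw [show 2 * α - 2 = 2 * (α - 1) by ring, Real.rpow_mul ht]; norm_cast
    refine HasDerivAt.congr_deriv (f := fun t : ℝ => wt α (z + t • ex i) * (z + t • ex i).1 i)
      (hm.congr_of_eventuallyEq (Filter.Eventually.of_forall fun t => ?_)) ?_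
    · simp [wt, ex, e1 _ (norm_nonneg _)]
    · simp [wt, e1 _ (norm_nonneg _), e2 _ (norm_nonneg _)]
      ring

lemma wt_add_smul_ey (z : E m n) (j : Fin n) (t : ℝ) : wt α (z + t • ey j) = wt α z := by
  simp [wt, ey]

lemma abs_coord_le (z : E m n) (i : Fin m) : |z.1 i| ≤ ‖z.1‖ := by
  simpa using PiLp.norm_apply_le z.1 i

lemma norm_rpow_mul_sq_le (hα : 0 < α) (z : E m n) : ‖z.1‖ ^ (2*α-2) * ‖z.1‖ ^ 2 = wt α z := by
  by_cases hx : z.1 = 0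
  · simp [wt, hx, Real.zero_rpow (by linarith : 2*α ≠ 0)]
  · rw [wt, ← Real.rpow_natCast, ← Real.rpow_add (by positivity)]
    congr 1; push_cast; ring

lemma continuous_kappa (hα : 0 < α) (i : Fin m) :
    Continuous (fun z : E m n => ‖z.1‖ ^ (2*α-2) * z.1 i ^ 2) := by
  rw [continuous_iff_continuousAt]
  intro z
  by_cases hx : z.1 = 0
  · have h0 : ‖z.1‖ ^ (2*α-2) * z.1 i ^ 2 = 0 := by simp [hx]
    rw [ContinuousAt, h0]
    have hw : Filter.Tendsto (wt α : E m n → ℝ) (nhds z) (nhds 0) := by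
      have := (continuous_wt hα).tendsto z
      simpa [wt, hx, Real.zero_rpow (by linarith : 2*α ≠ 0)] using this
    refine squeeze_zero (fun z => by positivity) (fun z => ?_) hw
    rw [← norm_rpow_mul_sq_le hα]
    have := abs_coord_le z i
    have h2 : z.1 i ^ 2 ≤ ‖z.1‖ ^ 2 := by rw [← sq_abs]; gcongr
    gcongr
  · refine ContinuousAt.mul (ContinuousAt.rpow_const (by fun_prop) (Or.inl (by simpa))) ?_
    fun_prop

lemma isCompact_sublevel (hα : 0 < α) (R : ℝ) : IsCompact {z : E m n | gaugePow α z ≤ R} := by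
  refine Metric.isCompact_of_isClosed_isBounded
    (isClosed_le (continuous_gaugePow hα) continuous_const) ?_
  refine (Metric.isBounded_closedBall (x := (0 : E m n)) (r := max 1 R)).subset fun z hz => ?_
  have hz : gaugePow α z ≤ R := hz
  rw [gaugePow] at hz
  have h1 : 0 ≤ ‖z.1‖ ^ (2*(α+1)) := by positivity
  have h2 : ‖z.2‖ ^ 2 ≤ (α+1)^2 * ‖z.2‖^2 :=
    le_mul_of_one_le_left (sq_nonneg _) (by nlinarith)
  rw [mem_closedBall_zero_iff, Prod.norm_def, max_le_iff]
  constructor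
  · by_contra! h
    have h3 := lt_of_le_of_lt (le_max_left 1 R) h
    have h4 := lt_of_le_of_lt (le_max_right 1 R) h
    have h5 := Real.rpow_le_rpow_of_exponent_le h3.le (show 1 ≤ 2*(α+1) by linarith)
    rw [Real.rpow_one] at h5
    nlinarith [sq_nonneg ‖z.2‖]
  · by_contra! h
    have h3 := lt_of_le_of_lt (le_max_left 1 R) h
    have h4 := lt_of_le_of_lt (le_max_right 1 R) h
    nlinarith

lemma ae_x_ne_zero (hm : 0 < m) : ∀ᵐ z : E m n, z.1 ≠ 0 := by
  have : Nonempty (Fin m) := ⟨⟨0, hm⟩⟩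
  rw [ae_iff]
  have : {z : E m n | ¬ z.1 ≠ 0} = ({0} : Set (EuclideanSpace ℝ (Fin m))) ×ˢ Set.univ := by
    ext z; simp
  rw [this, Measure.volume_eq_prod, Measure.prod_prod]
  simp

end basics

lemma hasDerivAt_max_zero_pow (k : ℕ) (s : ℝ) :
    HasDerivAt (fun s : ℝ => max 0 s ^ (k+2)) ((k+2) * max 0 s ^ (k+1)) s := by
  rcases lt_trichotomy s 0 with h | h | h
  · rw [max_eq_left h.le]
    have : HasDerivAt (fun _ : ℝ => (0:ℝ)) (((k:ℝ)+2) * 0 ^ (k+1)) s := by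
      simpa using hasDerivAt_const s (0:ℝ)
    refine this.congr_of_eventuallyEq ?_
    filter_upwards [gt_mem_nhds h] with t ht
    simp [max_eq_left (le_of_lt ht)]
  · subst h
    rw [hasDerivAt_iff_tendsto_slope_zero]
    have hc : Filter.Tendsto (fun t : ℝ => |t| ^ (k+1)) (nhdsWithin 0 {0}ᶜ) (nhds 0) := by
      have : Continuous (fun t : ℝ => |t| ^ (k+1)) := by fun_prop
      simpa using (this.tendsto 0).mono_left nhdsWithin_le_nhds
    simp only [max_self, zero_add]
    rw [show ((k:ℝ)+2) * 0 ^ (k+1) = 0 by simp]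
    refine squeeze_zero_norm (fun t => ?_) hc
    have h1 : max 0 t ≤ |t| := max_le (abs_nonneg _) (le_abs_self _)
    have h0 : 0 ≤ max 0 t := le_max_left _ _
    by_cases ht : t = 0
    · simp [ht]
    · have : max 0 t ^ (k+2) ≤ |t| ^ (k+2) := by gcongr
      simp only [smul_eq_mul, norm_mul, norm_inv, Real.norm_eq_abs, ne_eq, Nat.add_eq_zero_iff,
        OfNat.ofNat_ne_zero, and_false, not_false_eq_true, zero_pow, sub_zero, abs_pow]
      rw [abs_of_nonneg h0, inv_mul_le_iff₀ (by positivity), ← pow_succ']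
      exact this
  · have := hasDerivAt_pow (k+2) s
    rw [max_eq_right h.le]
    refine (this.congr_of_eventuallyEq ?_).congr_deriv (by push_cast; rfl)
    filter_upwards [lt_mem_nhds h] with t ht
    simp [max_eq_right (le_of_lt ht)]

section identities

variable {m n : ℕ} {α : ℝ}

lemma hasLineDerivAt_gaugePow_comp (hα : 0 < α) {g g1 : ℝ → ℝ}
    (hg : ∀ p, 0 ≤ p → HasDerivAt g (g1 p) p) (z v : E m n) :
    HasLineDerivAt ℝ (fun z => g (gaugePow α z)) (g1 (gaugePow α z) * dGaugePow α z v) z v := by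
  have := (hg _ (gaugePow_nonneg (α := α) z)).comp_hasFDerivAt z (hasFDerivAt_gaugePow hα z)
  exact this.hasLineDerivAt v

lemma gradXsq_eq (u : E m n → ℝ) (z : E m n) : gradXsq α u z =
    (∑ i, (fderiv ℝ u z (ex i))^2) + wt α z * (∑ j, (fderiv ℝ u z (ey j))^2) := rfl

lemma lapX_eq (u : E m n → ℝ) (z : E m n) : lapX α u z =
    (∑ i, fderiv ℝ (fun w => fderiv ℝ u w (ex i)) z (ex i))
      + wt α z * (∑ j, fderiv ℝ (fun w => fderiv ℝ u w (ey j)) z (ey j)) := rfl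

lemma integrable_of_continuous_sublevel (hα : 0 < α) {R : ℝ} {F : E m n → ℝ} (hF : Continuous F)
    (h0 : ∀ z, R < gaugePow α z → F z = 0) : Integrable F :=
  hF.integrable_of_hasCompactSupport
    (HasCompactSupport.intro (isCompact_sublevel hα R) fun z hz => h0 z (not_le.1 hz))

lemma continuous_fderiv_apply {u : E m n → ℝ} (hu : ContDiff ℝ 1 u) (v : E m n) :
    Continuous (fun z => fderiv ℝ u z v) :=
  (hu.continuous_fderiv one_ne_zero).clm_apply continuous_const

lemma contDiff_fderiv_apply {u : E m n → ℝ} (hu : ContDiff ℝ 2 u) (v : E m n) :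
    ContDiff ℝ 1 (fun z => fderiv ℝ u z v) :=
  (hu.fderiv_right (m := 1) (by norm_num)).clm_apply contDiff_const

lemma continuous_divergence_x {G G1 G2 W X K U D DD : E m n → ℝ} (c : ℝ) (hG : Continuous G)
    (hG1 : Continuous G1) (hG2 : Continuous G2) (hW : Continuous W) (hX : Continuous X)
    (hK : Continuous K) (hU : Continuous U) (hD : Continuous D) (hDD : Continuous DD) :
    Continuous (fun z => G z * (D z ^ 2 + U z * DD z) - 1/2 * U z ^ 2 *
      (G2 z * (2*(c+1) * (W z * X z)) ^ 2 + G1 z * (2*(c+1) * (W z + 2*c * K z)))) := by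
  fun_prop

lemma continuous_divergence_y {G G1 G2 W X U D DD : E m n → ℝ} (c : ℝ) (hG : Continuous G)
    (hG1 : Continuous G1) (hG2 : Continuous G2) (hW : Continuous W) (hX : Continuous X)
    (hU : Continuous U) (hD : Continuous D) (hDD : Continuous DD) :
    Continuous (fun z => W z * (G z * (D z ^ 2 + U z * DD z) - 1/2 * U z ^ 2 *
      (G2 z * (c * X z) ^ 2 + G1 z * c))) := by
  fun_prop

lemma continuous_flux {G G1 X U D : E m n → ℝ} (c : ℝ) (hG : Continuous G)
    (hG1 : Continuous G1) (hX : Continuous X) (hU : Continuous U) (hD : Continuous D) :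
    Continuous (fun z => G z * (U z * D z) - 1/2 * (U z * U z) * (G1 z * (c * X z))) := by
  fun_prop

theorem rellich_identity (hα : 0 < α) {u : E m n → ℝ} (hu : ContDiff ℝ 2 u) {g g1 g2 : ℝ → ℝ}
    (hg : ∀ p, 0 ≤ p → HasDerivAt g (g1 p) p) (hg1 : ∀ p, 0 ≤ p → HasDerivAt g1 (g2 p) p)
    (hg2 : ContinuousOn g2 (Set.Ici 0)) {R : ℝ}
    (h0 : ∀ p, R < p → g p = 0) (h1 : ∀ p, R < p → g1 p = 0) (h2 : ∀ p, R < p → g2 p = 0) :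
    Integrable (fun z : E m n => g (gaugePow α z) * gradXsq α u z
      + g (gaugePow α z) * (u z * lapX α u z)
      - 1/2 * u z ^ 2 * (wt α z * ((2*(α+1))^2 * gaugePow α z * g2 (gaugePow α z)
        + 2*(α+1) * (m + (α+1)*n + 2*α) * g1 (gaugePow α z)))) ∧
    ∫ z : E m n, (g (gaugePow α z) * gradXsq α u z
      + g (gaugePow α z) * (u z * lapX α u z)
      - 1/2 * u z ^ 2 * (wt α z * ((2*(α+1))^2 * gaugePow α z * g2 (gaugePow α z)
        + 2*(α+1) * (m + (α+1)*n + 2*α) * g1 (gaugePow α z)))) = 0 := by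
  have hP := continuous_gaugePow (m := m) (n := n) hα
  have hw := continuous_wt (m := m) (n := n) hα
  have cg : Continuous (fun z : E m n => g (gaugePow α z)) :=
    ContinuousOn.comp_continuous (s := Set.Ici 0)
      (fun p hp => (hg p hp).continuousAt.continuousWithinAt) hP gaugePow_nonneg
  have cg1 : Continuous (fun z : E m n => g1 (gaugePow α z)) :=
    ContinuousOn.comp_continuous (s := Set.Ici 0)
      (fun p hp => (hg1 p hp).continuousAt.continuousWithinAt) hP gaugePow_nonneg
  have cg2 : Continuous (fun z : E m n => g2 (gaugePow α z)) :=
    hg2.comp_continuous hP gaugePow_nonneg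
  have cu := hu.continuous
  have hu1 : ContDiff ℝ 1 u := hu.of_le (by norm_num)
  have cD : ∀ v, Continuous (fun z => fderiv ℝ u z v) := fun v => continuous_fderiv_apply hu1 v
  have cDD : ∀ v, Continuous (fun z => fderiv ℝ (fun w => fderiv ℝ u w v) z v) :=
    fun v => continuous_fderiv_apply (contDiff_fderiv_apply hu v) v
  have lu : ∀ z v, HasLineDerivAt ℝ u (fderiv ℝ u z v) z v := fun z v =>
    ((hu1.differentiable one_ne_zero) z).hasFDerivAt.hasLineDerivAt v
  have lD : ∀ z v, HasLineDerivAt ℝ (fun w => fderiv ℝ u w v)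
      (fderiv ℝ (fun w => fderiv ℝ u w v) z v) z v := fun z v =>
    (((contDiff_fderiv_apply hu v).differentiable one_ne_zero) z).hasFDerivAt.hasLineDerivAt v
  have hx : ∀ i : Fin m, Integrable (fun z : E m n =>
      g (gaugePow α z) * (fderiv ℝ u z (ex i) ^ 2
        + u z * fderiv ℝ (fun w => fderiv ℝ u w (ex i)) z (ex i))
      - 1/2 * u z ^ 2 * (g2 (gaugePow α z) * (2*(α+1) * (wt α z * z.1 i)) ^ 2
        + g1 (gaugePow α z) * (2*(α+1) * (wt α z + 2*α * (‖z.1‖ ^ (2*α-2) * z.1 i ^ 2))))) ∧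
      ∫ z : E m n, (g (gaugePow α z) * (fderiv ℝ u z (ex i) ^ 2
        + u z * fderiv ℝ (fun w => fderiv ℝ u w (ex i)) z (ex i))
      - 1/2 * u z ^ 2 * (g2 (gaugePow α z) * (2*(α+1) * (wt α z * z.1 i)) ^ 2
        + g1 (gaugePow α z) * (2*(α+1) * (wt α z + 2*α * (‖z.1‖ ^ (2*α-2) * z.1 i ^ 2))))) = 0 := by
    intro i
    have ck := continuous_kappa (m := m) (n := n) hα i
    have cDi := cD (ex i)
    have cDDi := cDD (ex i)
    have hI : Integrable (fun z : E m n =>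
        g (gaugePow α z) * (fderiv ℝ u z (ex i) ^ 2
          + u z * fderiv ℝ (fun w => fderiv ℝ u w (ex i)) z (ex i))
        - 1/2 * u z ^ 2 * (g2 (gaugePow α z) * (2*(α+1) * (wt α z * z.1 i)) ^ 2
          + g1 (gaugePow α z) * (2*(α+1) * (wt α z + 2*α * (‖z.1‖ ^ (2*α-2) * z.1 i ^ 2))))) := by
      refine integrable_of_continuous_sublevel hα (R := R)
        (continuous_divergence_x α cg cg1 cg2 hw (by fun_prop) ck cu cDi cDDi) fun z hz => ?_
      rw [h0 _ hz, h1 _ hz, h2 _ hz]; ring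
    refine ⟨hI, ?_⟩
    refine integral_lineDeriv_eq_zero (v := ex i)
      (V := fun z => g (gaugePow α z) * (u z * fderiv ℝ u z (ex i))
        - 1/2 * (u z * u z) * (g1 (gaugePow α z) * (2*(α+1) * (wt α z * z.1 i)))) ?_ hI ?_
    · refine integrable_of_continuous_sublevel hα (R := R)
        (continuous_flux _ cg cg1 (hw.mul (by fun_prop)) cu cDi) fun z hz => ?_
      rw [h0 _ hz, h1 _ hz]; ring
    · intro z
      have a1 := hasLineDerivAt_gaugePow_comp hα hg z (ex i)
      have a2 := hasLineDerivAt_gaugePow_comp hα hg1 z (ex i)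
      have a3 := lu z (ex i)
      have a4 := lD z (ex i)
      have a5 := hasLineDerivAt_wt_mul hα z i
      unfold HasLineDerivAt at *
      have := (a1.mul (a3.mul a4)).sub (((a3.mul a3).const_mul (1/2)).mul
        (a2.mul (a5.const_mul (2*(α+1)))))
      refine this.congr_deriv ?_
      simp only [zero_smul, add_zero, dGaugePow_ex, Pi.mul_apply]
      ring
  have hy : ∀ j : Fin n, Integrable (fun z : E m n => wt α z * (
      g (gaugePow α z) * (fderiv ℝ u z (ey j) ^ 2
        + u z * fderiv ℝ (fun w => fderiv ℝ u w (ey j)) z (ey j))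
      - 1/2 * u z ^ 2 * (g2 (gaugePow α z) * (2*(α+1)^2 * z.2 j) ^ 2
        + g1 (gaugePow α z) * (2*(α+1)^2)))) ∧
      ∫ z : E m n, wt α z * (g (gaugePow α z) * (fderiv ℝ u z (ey j) ^ 2
        + u z * fderiv ℝ (fun w => fderiv ℝ u w (ey j)) z (ey j))
      - 1/2 * u z ^ 2 * (g2 (gaugePow α z) * (2*(α+1)^2 * z.2 j) ^ 2
        + g1 (gaugePow α z) * (2*(α+1)^2))) = 0 := by
    intro j
    have cDi := cD (ey j)
    have cDDi := cDD (ey j)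
    have hI : Integrable (fun z : E m n => wt α z * (
      g (gaugePow α z) * (fderiv ℝ u z (ey j) ^ 2
        + u z * fderiv ℝ (fun w => fderiv ℝ u w (ey j)) z (ey j))
      - 1/2 * u z ^ 2 * (g2 (gaugePow α z) * (2*(α+1)^2 * z.2 j) ^ 2
        + g1 (gaugePow α z) * (2*(α+1)^2)))) := by
      refine integrable_of_continuous_sublevel hα (R := R)
        (continuous_divergence_y _ cg cg1 cg2 hw (by fun_prop) cu cDi cDDi) fun z hz => ?_
      rw [h0 _ hz, h1 _ hz, h2 _ hz]; ring
    refine ⟨hI, ?_⟩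
    refine integral_lineDeriv_eq_zero (v := ey j)
      (V := fun z => wt α z * (g (gaugePow α z) * (u z * fderiv ℝ u z (ey j))
        - 1/2 * (u z * u z) * (g1 (gaugePow α z) * (2*(α+1)^2 * z.2 j)))) ?_ hI ?_
    · refine integrable_of_continuous_sublevel hα (R := R)
        (hw.mul (continuous_flux _ cg cg1 (by fun_prop) cu cDi)) fun z hz => ?_
      rw [h0 _ hz, h1 _ hz]; ring
    · intro z
      have a1 := hasLineDerivAt_gaugePow_comp hα hg z (ey j)
      have a2 := hasLineDerivAt_gaugePow_comp hα hg1 z (ey j)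
      have a3 := lu z (ey j)
      have a4 := lD z (ey j)
      have a5 : HasDerivAt (fun t : ℝ => (z + t • (ey j : E m n)).2 j) 1 0 := by
        simpa [ey] using (hasDerivAt_id (0:ℝ)).const_add (z.2 j)
      unfold HasLineDerivAt at *
      have := ((a1.mul (a3.mul a4)).sub (((a3.mul a3).const_mul (1/2)).mul
        (a2.mul (a5.const_mul (2*(α+1)^2))))).const_mul (wt α z)
      simp only [wt_add_smul_ey]
      refine this.congr_deriv ?_
      simp only [zero_smul, add_zero, dGaugePow_ey, Pi.mul_apply]
      ring
  have key : ∀ z : E m n, g (gaugePow α z) * gradXsq α u z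
      + g (gaugePow α z) * (u z * lapX α u z)
      - 1/2 * u z ^ 2 * (wt α z * ((2*(α+1))^2 * gaugePow α z * g2 (gaugePow α z)
        + 2*(α+1) * (m + (α+1)*n + 2*α) * g1 (gaugePow α z))) =
      (∑ i : Fin m, (g (gaugePow α z) * (fderiv ℝ u z (ex i) ^ 2
        + u z * fderiv ℝ (fun w => fderiv ℝ u w (ex i)) z (ex i))
      - 1/2 * u z ^ 2 * (g2 (gaugePow α z) * (2*(α+1) * (wt α z * z.1 i)) ^ 2
        + g1 (gaugePow α z) * (2*(α+1) * (wt α z + 2*α * (‖z.1‖ ^ (2*α-2) * z.1 i ^ 2))))))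
      + ∑ j : Fin n, wt α z * (g (gaugePow α z) * (fderiv ℝ u z (ey j) ^ 2
        + u z * fderiv ℝ (fun w => fderiv ℝ u w (ey j)) z (ey j))
      - 1/2 * u z ^ 2 * (g2 (gaugePow α z) * (2*(α+1)^2 * z.2 j) ^ 2
        + g1 (gaugePow α z) * (2*(α+1)^2))) := by
    intro z
    simp only [mul_pow, ← mul_assoc]
    simp only [mul_add, mul_sub, Finset.sum_add_distrib, Finset.sum_sub_distrib, ← Finset.mul_sum,
      sum_coord_x, sum_coord_y, Finset.sum_const, Finset.card_univ, Fintype.card_fin,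
      nsmul_eq_mul, ← mul_assoc]
    rw [gradXsq_eq, lapX_eq]
    have hk := norm_rpow_mul_sq_le hα z
    have hp := gaugePow_eq hα z
    generalize g (gaugePow α z) = G
    generalize g1 (gaugePow α z) = G1
    generalize g2 (gaugePow α z) = G2
    rw [hp]
    linear_combination ((1/2 * u z ^ 2 * G1 * 2 * α + 1/2 * u z ^ 2 * G1 * 2) * 2 * α) * hk
  simp only [key]
  refine ⟨(integrable_finsetSum _ fun i _ => (hx i).1).add
    (integrable_finsetSum _ fun j _ => (hy j).1), ?_⟩
  rw [integral_add (integrable_finsetSum _ fun i _ => (hx i).1)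
    (integrable_finsetSum _ fun j _ => (hy j).1),
    integral_finsetSum _ fun i _ => (hx i).1, integral_finsetSum _ fun j _ => (hy j).1]
  rw [Finset.sum_eq_zero fun i _ => (hx i).2, Finset.sum_eq_zero fun j _ => (hy j).2, add_zero]

end identities

/-- A Fatou-type passage to the limit for nonnegative functions with bounded integrals. -/
lemma integrable_and_integral_le_of_tendsto {X : Type*} [MeasurableSpace X] {μ : Measure X}
    {F : ℕ → X → ℝ} {G : X → ℝ} {K : ℝ} (h0 : ∀ k x, 0 ≤ F k x) (hF : ∀ k, Integrable (F k) μ)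
    (hK : ∀ k, ∫ x, F k x ∂μ ≤ K)
    (hlim : ∀ᵐ x ∂μ, Filter.Tendsto (fun k => F k x) Filter.atTop (nhds (G x))) :
    Integrable G μ ∧ ∫ x, G x ∂μ ≤ K := by
  have hG0 : ∀ᵐ x ∂μ, 0 ≤ G x := by
    filter_upwards [hlim] with x hx
    exact ge_of_tendsto' hx fun k => h0 k x
  have hm : AEStronglyMeasurable G μ :=
    aestronglyMeasurable_of_tendsto_ae _ (fun k => (hF k).aestronglyMeasurable) hlim
  have hK0 : 0 ≤ K := (integral_nonneg (h0 0)).trans (hK 0)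
  have hb : ∫⁻ x, ENNReal.ofReal (G x) ∂μ ≤ ENNReal.ofReal K := by
    have e : ∀ᵐ x ∂μ, ENNReal.ofReal (G x) =
        Filter.liminf (fun k => ENNReal.ofReal (F k x)) Filter.atTop := by
      filter_upwards [hlim] with x hx
      exact ((ENNReal.continuous_ofReal.tendsto _).comp hx).liminf_eq.symm
    rw [lintegral_congr_ae e]
    refine (lintegral_liminf_le' fun k => (hF k).aestronglyMeasurable.aemeasurable.ennreal_ofReal).trans ?_
    refine Filter.liminf_le_of_le (by isBoundedDefault) fun b hb => ?_
    obtain ⟨k, hk⟩ := hb.exists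
    refine hk.trans ?_
    rw [← ofReal_integral_eq_lintegral_ofReal (hF k) (Filter.Eventually.of_forall (h0 k))]
    exact ENNReal.ofReal_le_ofReal (hK k)
  have hi : Integrable G μ := by
    refine ⟨hm, ?_⟩
    rw [hasFiniteIntegral_iff_ofReal hG0]
    exact hb.trans_lt ENNReal.ofReal_lt_top
  refine ⟨hi, ?_⟩
  rw [← ENNReal.ofReal_le_ofReal_iff hK0, ofReal_integral_eq_lintegral_ofReal hi hG0]
  exact hb

/-- Continuous functions that are differentiable off `{x = 0}`, with the blow-up of the
differential at `{x = 0}` that `|x|^{2α}` may exhibit. -/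
structure IsAdmissible {m n : ℕ} (f : E m n → ℝ) : Prop where
  continuous : Continuous f
  differentiableAt : ∀ z, z.1 ≠ 0 → DifferentiableAt ℝ f z
  bound : ∀ K : Set (E m n), IsCompact K →
    ∃ M, ∀ z ∈ K, ∀ v, ‖z.1‖ * |fderiv ℝ f z v| ≤ M * (‖v.1‖ + ‖z.1‖ * ‖v.2‖)

section hardy

variable {m n : ℕ} {α : ℝ}

lemma isAdmissible_add_wt_mul (hα : 0 < α) {a b : E m n → ℝ} (ha : ContDiff ℝ 1 a)
    (hb : ContDiff ℝ 1 b) : IsAdmissible (fun z => a z + wt α z * b z) := by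
  have hw : ∀ z : E m n, z.1 ≠ 0 → HasFDerivAt (wt α)
      ((2*α * ‖z.1‖ ^ (2*α-2)) • (innerSL ℝ z.1).comp (ContinuousLinearMap.fst ℝ _ _)) z := by
    intro z hz
    have h1 : HasFDerivAt (fun z : E m n => (‖z.1‖^2) ^ α)
        ((α * (‖z.1‖^2) ^ (α-1)) • (2 • (innerSL ℝ z.1).comp (ContinuousLinearMap.fst ℝ _ _))) z := by
      have h2 := ((hasStrictFDerivAt_norm_sq z.1).hasFDerivAt.comp z
        (hasFDerivAt_fst (𝕜 := ℝ) (p := z)))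
      exact (h2.rpow_const (p := α) (Or.inl (by simpa using hz))).congr_fderiv (by ext <;> simp)
    have e1 : ∀ t : ℝ, 0 ≤ t → (t ^ 2) ^ α = t ^ (2 * α) := fun t ht => by
      rw [Real.rpow_mul ht]; norm_cast
    have e2 : ∀ t : ℝ, 0 ≤ t → (t ^ 2) ^ (α - 1) = t ^ (2 * α - 2) := fun t ht => by
      rw [show 2 * α - 2 = 2 * (α - 1) by ring, Real.rpow_mul ht]; norm_cast
    have e3 : (wt α : E m n → ℝ) = fun z => (‖z.1‖^2) ^ α := by
      ext z; rw [e1 _ (norm_nonneg _)]; rfl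
    rw [e3]
    refine h1.congr_fderiv ?_
    rw [e2 _ (norm_nonneg _)]
    ext v <;> simp; ring
  have hd : ∀ z : E m n, z.1 ≠ 0 → HasFDerivAt (fun z => a z + wt α z * b z)
      (fderiv ℝ a z + (wt α z • fderiv ℝ b z + b z •
      ((2*α * ‖z.1‖ ^ (2*α-2)) • (innerSL ℝ z.1).comp (ContinuousLinearMap.fst ℝ _ _)))) z :=
    fun z hz => (ha.differentiable one_ne_zero z).hasFDerivAt.add
      ((hw z hz).mul (hb.differentiable one_ne_zero z).hasFDerivAt)
  refine ⟨ha.continuous.add ((continuous_wt hα).mul hb.continuous),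
    fun z hz => (hd z hz).differentiableAt, fun K hK => ?_⟩
  have hcont : Continuous (fun z : E m n => (‖fderiv ℝ a z‖ + wt α z * ‖fderiv ℝ b z‖) * (1 + ‖z.1‖)
      + |b z| * (2*α * wt α z)) := by
    have := continuous_wt (m := m) (n := n) hα
    have := ha.continuous_fderiv one_ne_zero
    have := hb.continuous_fderiv one_ne_zero
    have := hb.continuous
    fun_prop
  obtain ⟨M, hM⟩ := hK.exists_bound_of_continuousOn hcont.continuousOn
  refine ⟨M, fun z hz v => ?_⟩
  have hw0 := wt_nonneg (α := α) z
  have hMz := (le_abs_self _).trans (hM z hz)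
  have hv : ‖z.1‖ * ‖v‖ ≤ (1 + ‖z.1‖) * (‖v.1‖ + ‖z.1‖ * ‖v.2‖) := by
    have : ‖v‖ ≤ ‖v.1‖ + ‖v.2‖ := by
      rw [Prod.norm_def]; exact max_le (by simp) (by simp)
    nlinarith [mul_le_mul_of_nonneg_left this (norm_nonneg z.1), norm_nonneg v.1, norm_nonneg v.2,
      norm_nonneg z.1, mul_nonneg (mul_nonneg (norm_nonneg z.1) (norm_nonneg z.1)) (norm_nonneg v.2)]
  have hnn : 0 ≤ ‖v.1‖ + ‖z.1‖ * ‖v.2‖ := by positivity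
  refine le_trans ?_ (mul_le_mul_of_nonneg_right hMz hnn)
  by_cases hx : z.1 = 0
  · rw [hx]; simp only [norm_zero, zero_mul, add_zero]
    positivity
  rw [(hd z hx).fderiv]
  have h1 : |fderiv ℝ a z v| ≤ ‖fderiv ℝ a z‖ * ‖v‖ := (fderiv ℝ a z).le_opNorm v
  have h2 : |fderiv ℝ b z v| ≤ ‖fderiv ℝ b z‖ * ‖v‖ := (fderiv ℝ b z).le_opNorm v
  have h3 : |inner ℝ z.1 v.1| ≤ ‖z.1‖ * ‖v.1‖ := abs_real_inner_le_norm _ _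
  have hk := norm_rpow_mul_sq_le hα z
  simp only [add_apply, smul_apply, smul_eq_mul,
    ContinuousLinearMap.comp_apply, innerSL_apply_apply, ContinuousLinearMap.coe_fst']
  have h4 : |fderiv ℝ a z v + (wt α z * fderiv ℝ b z v + b z * (2*α*‖z.1‖^(2*α-2) * inner ℝ z.1 v.1))|
      ≤ (‖fderiv ℝ a z‖ + wt α z * ‖fderiv ℝ b z‖) * ‖v‖
        + |b z| * (2*α * (‖z.1‖^(2*α-2) * (‖z.1‖ * ‖v.1‖))) := by
    refine (abs_add_le _ _).trans ?_
    refine (add_le_add_right (abs_add_le _ _) _).trans ?_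
    rw [abs_mul, abs_mul, abs_mul, abs_mul, abs_of_nonneg hw0,
      abs_of_nonneg (by positivity : 0 ≤ 2*α), abs_of_nonneg (by positivity : 0 ≤ ‖z.1‖^(2*α-2))]
    have := mul_le_mul_of_nonneg_left h2 hw0
    have h5 : |b z| * (2*α*‖z.1‖^(2*α-2) * |inner ℝ z.1 v.1|) ≤
      |b z| * (2*α * (‖z.1‖^(2*α-2) * (‖z.1‖ * ‖v.1‖))) := by
      rw [mul_assoc (2*α)]; gcongr
    linarith
  calc _ ≤ ‖z.1‖ * _ := mul_le_mul_of_nonneg_left h4 (norm_nonneg _)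
    _ = (‖fderiv ℝ a z‖ + wt α z * ‖fderiv ℝ b z‖) * (‖z.1‖ * ‖v‖)
        + |b z| * (2*α * (‖z.1‖^(2*α-2) * ‖z.1‖^2)) * ‖v.1‖ := by ring
    _ ≤ (‖fderiv ℝ a z‖ + wt α z * ‖fderiv ℝ b z‖) * ((1 + ‖z.1‖) * (‖v.1‖ + ‖z.1‖ * ‖v.2‖))
        + |b z| * (2*α * wt α z) * (‖v.1‖ + ‖z.1‖ * ‖v.2‖) := by
      rw [hk]; gcongr
      have : 0 ≤ ‖z.1‖ * ‖v.2‖ := by positivity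
      linarith
    _ = _ := by ring

lemma ContDiff.isAdmissible {u : E m n → ℝ} (hu : ContDiff ℝ 1 u) : IsAdmissible u := by
  simpa using isAdmissible_add_wt_mul one_pos hu (contDiff_const (c := (0:ℝ)))

lemma hasDerivAt_mul_of_eq_zero {c X : ℝ → ℝ} {X' t : ℝ} (hc : ContinuousAt c t)
    (hX : HasDerivAt X X' t) (h0 : X t = 0) : HasDerivAt (fun s => c s * X s) (c t * X') t := by
  rw [hasDerivAt_iff_tendsto_slope] at hX ⊢
  refine ((hc.tendsto.mono_left nhdsWithin_le_nhds).mul hX).congr fun s => ?_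
  simp [slope_def_field, h0]; ring

lemma IsAdmissible.hasLineDerivAt {f : E m n → ℝ} (hf : IsAdmissible f) {k X : E m n → ℝ}
    {k' X' : ℝ} {z v : E m n} (hk : HasLineDerivAt ℝ k k' z v) (hX : HasLineDerivAt ℝ X X' z v)
    (h0 : z.1 = 0 → X z = 0) :
    HasLineDerivAt ℝ (fun z => k z * f z ^ 2 * X z)
      (k' * f z ^ 2 * X z + 2 * k z * f z * (X z * fderiv ℝ f z v) + k z * f z ^ 2 * X') z v := by
  unfold HasLineDerivAt at *
  by_cases hx : z.1 = 0
  · have hc : ContinuousAt (fun t : ℝ => k (z + t • v) * f (z + t • v) ^ 2) 0 := by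
      have := hf.continuous
      exact hk.continuousAt.mul (by fun_prop)
    refine (hasDerivAt_mul_of_eq_zero hc hX (by simpa using h0 hx)).congr_deriv ?_
    simp [h0 hx]
  · have hl := ((hf.differentiableAt z hx).hasFDerivAt.hasLineDerivAt v)
    unfold HasLineDerivAt at hl
    refine ((hk.mul (hl.pow 2)).mul hX).congr_deriv ?_
    simp; ring

lemma integrable_of_bounded_sublevel (hα : 0 < α) {R M : ℝ} {F : E m n → ℝ} (hF : Measurable F)
    (hM : ∀ z, gaugePow α z ≤ R → |F z| ≤ M) (h0 : ∀ z, R < gaugePow α z → F z = 0) :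
    Integrable F := by
  have hs : Function.support F ⊆ {z | gaugePow α z ≤ R} := fun z hz => by
    by_contra h; exact hz (h0 z (not_le.1 h))
  have hK := isCompact_sublevel (m := m) (n := n) hα R
  rw [← integrableOn_iff_integrable_of_support_subset hs]
  refine Measure.integrableOn_of_bounded (M := M) hK.measure_lt_top.ne hF.aestronglyMeasurable ?_
  filter_upwards [ae_restrict_mem hK.measurableSet] with z hz using hM z hz

lemma integrable_continuous_mul_bounded (hα : 0 < α) {R M : ℝ} {c F : E m n → ℝ} (hc : Continuous c)
    (h0 : ∀ z, R < gaugePow α z → c z = 0) (hF : Measurable F)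
    (hM : ∀ z, gaugePow α z ≤ R → |F z| ≤ M) : Integrable (fun z => c z * F z) := by
  obtain ⟨N, hN⟩ := (isCompact_sublevel (m := m) (n := n) hα R).exists_bound_of_continuousOn
    hc.continuousOn
  refine integrable_of_bounded_sublevel hα (M := N * M) (R := R) (hc.measurable.mul hF)
    (fun z hz => ?_) fun z hz => by rw [h0 z hz, zero_mul]
  rw [abs_mul]
  have := hN z hz
  exact mul_le_mul this (hM z hz) (abs_nonneg _) ((norm_nonneg _).trans this)

/-- The truncated factor `(1 - ρ^{2(α+1)}/R)₊`. -/
def qcut {m n : ℕ} (α R : ℝ) (z : E m n) : ℝ := max 0 (1 - gaugePow α z / R)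

lemma qcut_nonneg (R : ℝ) (z : E m n) : 0 ≤ qcut α R z := le_max_left _ _

lemma qcut_le_one {R : ℝ} (hR : 0 < R) (z : E m n) : qcut α R z ≤ 1 :=
  max_le zero_le_one (by have := div_nonneg (gaugePow_nonneg (α := α) z) hR.le; linarith)

lemma qcut_eq_zero {R : ℝ} (hR : 0 < R) {z : E m n} (h : R ≤ gaugePow α z) : qcut α R z = 0 :=
  max_eq_left (by rw [sub_nonpos, le_div_iff₀ hR]; linarith)

lemma continuous_qcut (hα : 0 < α) (R : ℝ) : Continuous (qcut α R : E m n → ℝ) :=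
  continuous_const.max (continuous_const.sub ((continuous_gaugePow hα).div_const _))

lemma hasDerivAt_cut_pow (k : ℕ) (R p : ℝ) :
    HasDerivAt (fun p => max 0 (1 - p / R) ^ (k+2)) (-((k+2)/R * max 0 (1 - p / R) ^ (k+1))) p := by
  have h : HasDerivAt (fun p : ℝ => 1 - p / R) (-(1/R)) p :=
    ((hasDerivAt_id p).div_const R).const_sub 1
  refine ((hasDerivAt_max_zero_pow k (1 - p/R)).comp p h).congr_deriv ?_
  ring

lemma abs_mul_fderiv_ex_le {f : E m n → ℝ} {M : ℝ} {z : E m n}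
    (h : ∀ v, ‖z.1‖ * |fderiv ℝ f z v| ≤ M * (‖v.1‖ + ‖z.1‖ * ‖v.2‖)) (i : Fin m) :
    |z.1 i * fderiv ℝ f z (ex i)| ≤ M := by
  have := h (ex i)
  simp only [ex, PiLp.norm_single, norm_one, norm_zero, mul_zero, add_zero, mul_one] at this
  rw [abs_mul]
  exact (mul_le_mul_of_nonneg_right (abs_coord_le z i) (abs_nonneg _)).trans this

/-- Hardy inequality in the `x` variables with the singular weight regularized by `ε`. -/
theorem hardy_regularized (hα : 0 < α) (hm : 2 < m) {f : E m n → ℝ} (hf : IsAdmissible f) {R ε : ℝ}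
    (hR : 0 < R) (hε : 0 < ε) (hG : IntegrableOn (gradXsq α f) {z | gaugePow α z < R}) :
    Integrable (fun z : E m n => qcut α R z ^ 3 * f z ^ 2 / (‖z.1‖^2 + ε)) ∧
    ∫ z : E m n, qcut α R z ^ 3 * f z ^ 2 / (‖z.1‖^2 + ε) ≤
      4 * (∫ z in {z | gaugePow α z < R}, gradXsq α f z)
        + 12*(α+1)/R * ∫ z in {z | gaugePow α z < R}, f z ^ 2 * wt α z := by
  have cq := continuous_qcut (m := m) (n := n) hα R
  have cw := continuous_wt (m := m) (n := n) hα
  have cf := hf.continuous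
  have hmB : MeasurableSet {z : E m n | gaugePow α z < R} :=
    (isOpen_lt (continuous_gaugePow hα) continuous_const).measurableSet
  have hpos : ∀ z : E m n, 0 < ‖z.1‖^2 + ε := fun z => by positivity
  have hne : ∀ z : E m n, ‖z.1‖^2 + ε ≠ 0 := fun z => (hpos z).ne'
  have q0 : ∀ z : E m n, R < gaugePow α z → qcut α R z = 0 := fun z hz => qcut_eq_zero hR hz.le
  obtain ⟨M, hM⟩ := hf.bound _ (isCompact_sublevel (m := m) (n := n) hα R)
  set k : E m n → ℝ := fun z => qcut α R z ^ 3 * (‖z.1‖^2 + ε)⁻¹ with hk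
  have ck : Continuous k := by
    rw [hk]; exact (cq.pow 3).mul (Continuous.inv₀ (by fun_prop) hne)
  have k0 : ∀ z, R < gaugePow α z → k z = 0 := fun z hz => by rw [hk]; simp [q0 z hz]
  set k' : Fin m → E m n → ℝ := fun i z =>
    -(3/R * qcut α R z ^ 2 * (2*(α+1) * wt α z * z.1 i)) * (‖z.1‖^2 + ε)⁻¹
      + qcut α R z ^ 3 * (-(2 * z.1 i) / (‖z.1‖^2 + ε)^2) with hk'
  have ck' : ∀ i, Continuous (k' i) := fun i => by
    rw [hk']
    refine Continuous.add (Continuous.mul (by fun_prop) (Continuous.inv₀ (by fun_prop) hne))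
      (Continuous.mul (by fun_prop) (Continuous.div (by fun_prop) (by fun_prop)
        fun z => pow_ne_zero _ (hne z)))
  have k'0 : ∀ i z, R < gaugePow α z → k' i z = 0 := fun i z hz => by rw [hk']; simp [q0 z hz]
  have hkd : ∀ i z, HasLineDerivAt ℝ k (k' i z) z (ex i) := by
    intro i z
    have h1 := hasLineDerivAt_gaugePow_comp hα (fun p _ => hasDerivAt_cut_pow 1 R p) z (ex i)
    have hl : HasDerivAt (fun t : ℝ => z.1 + t • (EuclideanSpace.single i (1:ℝ)))
        (EuclideanSpace.single i (1:ℝ)) 0 := by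
      simpa using ((hasDerivAt_id (0:ℝ)).smul_const
        (EuclideanSpace.single i (1:ℝ))).const_add z.1
    have hn : HasDerivAt (fun t : ℝ => ‖(z + t • (ex i : E m n)).1‖ ^ 2 + ε)
        (2 * z.1 i) 0 := by
      have := hl.norm_sq.add_const ε
      simpa [ex, EuclideanSpace.inner_single_right] using this
    unfold HasLineDerivAt at *
    refine (h1.mul (hn.inv (by simpa using hne z))).congr_deriv ?_
    simp only [hk', qcut, zero_smul, add_zero, dGaugePow_ex, Pi.inv_apply]
    push_cast; ring
  have hX : ∀ (i : Fin m) (z : E m n), HasLineDerivAt ℝ (fun z : E m n => z.1 i) 1 z (ex i) := by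
    intro i z
    have : HasDerivAt (fun t : ℝ => (z + t • (ex i : E m n)).1 i) 1 0 := by
      simpa [ex] using (hasDerivAt_id (0:ℝ)).const_add (z.1 i)
    exact this
  have hV : ∀ i : Fin m, Integrable (fun z : E m n => k' i z * f z ^ 2 * z.1 i
      + 2 * k z * f z * (z.1 i * fderiv ℝ f z (ex i)) + k z * f z ^ 2 * 1) ∧
      ∫ z : E m n, (k' i z * f z ^ 2 * z.1 i
      + 2 * k z * f z * (z.1 i * fderiv ℝ f z (ex i)) + k z * f z ^ 2 * 1) = 0 := by
    intro i
    have cki := ck' i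
    have hI : Integrable (fun z : E m n => k' i z * f z ^ 2 * z.1 i
      + 2 * k z * f z * (z.1 i * fderiv ℝ f z (ex i)) + k z * f z ^ 2 * 1) := by
      refine ((integrable_of_continuous_sublevel hα (R := R) (by fun_prop) fun z hz => ?_).add
        (integrable_continuous_mul_bounded hα (R := R) (M := M) (by fun_prop) (fun z hz => ?_)
          (Measurable.mul (by fun_prop) (measurable_fderiv_apply_const ℝ f _)) fun z hz =>
            abs_mul_fderiv_ex_le (hM z hz) i)).add
        (integrable_of_continuous_sublevel hα (R := R) (by fun_prop) fun z hz => ?_)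
      · rw [k'0 i z hz]; ring
      · rw [k0 z hz]; ring
      · rw [k0 z hz]; ring
    refine ⟨hI, integral_lineDeriv_eq_zero (V := fun z => k z * f z ^ 2 * z.1 i) ?_ hI fun z =>
      hf.hasLineDerivAt (hkd i z) (hX i z) (fun hx => by simp [hx])⟩
    refine integrable_of_continuous_sublevel hα (R := R) (by fun_prop) fun z hz => ?_
    rw [k0 z hz]; ring
  have hsum0 : ∫ z : E m n, ∑ i, (k' i z * f z ^ 2 * z.1 i
      + 2 * k z * f z * (z.1 i * fderiv ℝ f z (ex i)) + k z * f z ^ 2 * 1) = 0 := by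
    rw [integral_finsetSum _ fun i _ => (hV i).1, Finset.sum_eq_zero fun i _ => (hV i).2]
  have hsumI := integrable_finsetSum (μ := (volume : Measure (E m n))) Finset.univ
    fun i _ => (hV i).1
  have hF : Integrable (fun z : E m n => qcut α R z ^ 3 * f z ^ 2 / (‖z.1‖^2 + ε)) := by
    refine integrable_of_continuous_sublevel hα (R := R)
      (Continuous.div (by fun_prop) (by fun_prop) hne) fun z hz => ?_
    rw [q0 z hz]; ring
  have hW : IntegrableOn (fun z : E m n => f z ^ 2 * wt α z) {z | gaugePow α z < R} :=
    (ContinuousOn.integrableOn_compact (isCompact_sublevel hα R)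
      (by fun_prop)).mono_set fun z (hz : gaugePow α z < R) => hz.le
  refine ⟨hF, ?_⟩
  have hpt : ∀ z : E m n, qcut α R z ^ 3 * f z ^ 2 / (‖z.1‖^2 + ε) ≤
      2 * (∑ i, (k' i z * f z ^ 2 * z.1 i
      + 2 * k z * f z * (z.1 i * fderiv ℝ f z (ex i)) + k z * f z ^ 2 * 1))
      + ({z | gaugePow α z < R}.indicator (fun z => 4 * gradXsq α f z
        + 12*(α+1)/R * (f z ^ 2 * wt α z)) z) := by
    intro z
    by_cases hz : gaugePow α z < R
    swap
    · have : qcut α R z = 0 := qcut_eq_zero hR (not_lt.1 hz)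
      simp [hk, hk', this, hz]
    rw [Set.indicator_of_mem (by exact hz)]
    have e1 : ∑ i, (k' i z * f z ^ 2 * z.1 i
      + 2 * k z * f z * (z.1 i * fderiv ℝ f z (ex i)) + k z * f z ^ 2 * 1) =
      -(6*(α+1)/R * qcut α R z ^ 2 * wt α z * f z ^ 2 * (‖z.1‖^2 / (‖z.1‖^2 + ε)))
      - 2 * qcut α R z ^ 3 * f z ^ 2 * ‖z.1‖^2 / (‖z.1‖^2 + ε)^2
      + 2 * k z * f z * (∑ i, z.1 i * fderiv ℝ f z (ex i)) + m * (k z * f z ^ 2) := by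
      rw [Finset.sum_add_distrib, Finset.sum_add_distrib, ← Finset.mul_sum]
      simp only [Finset.sum_const, Finset.card_univ, Fintype.card_fin, nsmul_eq_mul, mul_one]
      congr 2
      rw [← sum_coord_x]
      simp only [Finset.sum_div, Finset.mul_sum]
      rw [← Finset.sum_neg_distrib, ← Finset.sum_sub_distrib]
      refine Finset.sum_congr rfl fun i _ => ?_
      rw [sum_coord_x]
      simp only [hk', div_eq_mul_inv]
      ring
    rw [e1]
    set S := ∑ i, z.1 i * fderiv ℝ f z (ex i) with hS
    have hCS : S ^ 2 ≤ ‖z.1‖^2 * gradXsq α f z := by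
      have := Finset.sum_mul_sq_le_sq_mul_sq Finset.univ (fun i => z.1 i)
        (fun i => fderiv ℝ f z (ex i))
      rw [sum_coord_x] at this
      refine this.trans (mul_le_mul_of_nonneg_left ?_ (sq_nonneg _))
      rw [gradXsq_eq]
      have : 0 ≤ wt α z * (∑ j, (fderiv ℝ f z (ey j))^2) :=
        mul_nonneg (wt_nonneg z) (Finset.sum_nonneg fun _ _ => sq_nonneg _)
      linarith
    have hg0 : 0 ≤ gradXsq α f z := by
      rw [gradXsq_eq]
      exact add_nonneg (Finset.sum_nonneg fun _ _ => sq_nonneg _)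
        (mul_nonneg (wt_nonneg z) (Finset.sum_nonneg fun _ _ => sq_nonneg _))
    have hq0 := qcut_nonneg (α := α) R z
    have hq1 := qcut_le_one (α := α) hR z
    have hw0 := wt_nonneg (α := α) z
    have hp := hpos z
    set s := ‖z.1‖^2 with hs
    have hs0 : 0 ≤ s := sq_nonneg _
    set q := qcut α R z
    have hm3 : (3:ℝ) ≤ m := by exact_mod_cast hm
    set d := (s + ε)⁻¹ with hd
    have hd0 : 0 < d := by positivity
    have hsd : s * d ≤ 1 := by rw [hd, ← div_eq_mul_inv, div_le_one hp]; linarith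
    have hkz : k z = q^3 * d := rfl
    have hq3 : 0 ≤ q^3 := by positivity
    have hq31 : q^3 ≤ 1 := pow_le_one₀ hq0 hq1
    have hq21 : q^2 ≤ 1 := pow_le_one₀ hq0 hq1
    rw [hkz]
    simp only [div_eq_mul_inv, ← inv_pow, ← hd]
    have i1 : 0 ≤ q^3 * d * (f z + 2 * S)^2 := by positivity
    have i2 : q^3 * (d * S^2) ≤ gradXsq α f z := by
      have a1 : d * S^2 ≤ gradXsq α f z := by nlinarith
      have : 0 ≤ d * S^2 := by positivity
      nlinarith
    have i3 : q^2 * wt α z * f z ^ 2 * (s * d) ≤ f z ^ 2 * wt α z := by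
      have a0 : 0 ≤ f z ^2 * wt α z := by positivity
      have : q^2 * (s*d) ≤ 1 := mul_le_one₀ hq21 (by positivity) hsd
      nlinarith
    have i4 : q^3 * f z ^2 * d * (s * d) ≤ q^3 * f z ^2 * d :=
      mul_le_of_le_one_right (by positivity) hsd
    have i5 : 3 * (q^3 * d * f z ^2) ≤ m * (q^3 * d * f z ^2) :=
      mul_le_mul_of_nonneg_right hm3 (by positivity)
    have hc : 0 ≤ 12 * (α+1) * R⁻¹ := by positivity
    have i6 := mul_le_mul_of_nonneg_left i3 hc
    linarith
  have hind : Integrable ({z : E m n | gaugePow α z < R}.indicator (fun z => 4 * gradXsq α f z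
        + 12*(α+1)/R * (f z ^ 2 * wt α z))) := by
    rw [integrable_indicator_iff hmB]
    exact (hG.const_mul 4).add (hW.const_mul _)
  refine (integral_mono hF ((hsumI.const_mul 2).add hind) hpt).trans (le_of_eq ?_)
  simp only [Pi.add_apply]
  rw [integral_add (hsumI.const_mul 2) hind, integral_const_mul, hsum0, integral_indicator hmB,
    integral_add (hG.const_mul 4) (hW.const_mul _), integral_const_mul, integral_const_mul]
  ring

/-- Hardy inequality in the `x` variables, localized by the cutoff `qcut`. -/
theorem hardy_inequality (hα : 0 < α) (hm : 2 < m) {f : E m n → ℝ} (hf : IsAdmissible f) {R : ℝ}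
    (hR : 0 < R) (hG : IntegrableOn (gradXsq α f) {z | gaugePow α z < R}) :
    Integrable (fun z : E m n => qcut α R z ^ 3 * f z ^ 2 / ‖z.1‖^2) ∧
    ∫ z : E m n, qcut α R z ^ 3 * f z ^ 2 / ‖z.1‖^2 ≤
      4 * (∫ z in {z | gaugePow α z < R}, gradXsq α f z)
        + 12*(α+1)/R * ∫ z in {z | gaugePow α z < R}, f z ^ 2 * wt α z := by
  have h := fun k : ℕ => hardy_regularized hα hm hf hR (Nat.one_div_pos_of_nat (α := ℝ) (n := k)) hG
  refine integrable_and_integral_le_of_tendsto (fun k z => ?_) (fun k => (h k).1)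
    (fun k => (h k).2) ?_
  · have := qcut_nonneg (α := α) R z
    positivity
  · filter_upwards [ae_x_ne_zero (n := n) (show 0 < m by omega)] with z hz
    have : Filter.Tendsto (fun k : ℕ => ‖z.1‖^2 + 1 / ((k:ℝ) + 1)) Filter.atTop
        (nhds (‖z.1‖^2 + 0)) := tendsto_one_div_add_atTop_nhds_zero_nat.const_add _
    rw [add_zero] at this
    exact tendsto_const_nhds.div this (by simpa using hz)

lemma integrableOn_inv_norm_sq (hα : 0 < α) (hm : 2 < m) {R : ℝ} (hR : 0 < R) :
    IntegrableOn (fun z : E m n => (‖z.1‖^2)⁻¹) {z | gaugePow α z < R} := by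
  have hmB : MeasurableSet {z : E m n | gaugePow α z < R} :=
    (isOpen_lt (continuous_gaugePow hα) continuous_const).measurableSet
  have hg : gradXsq α (fun _ : E m n => (1:ℝ)) = fun _ => 0 := by
    ext z; simp [gradXsq]
  have h := (hardy_inequality (n := n) hα hm (contDiff_const (c := (1:ℝ))).isAdmissible
    (R := 2*R) (by positivity) (by rw [hg]; exact integrableOn_zero)).1
  refine Integrable.mono' ((h.const_mul 8).integrableOn) (by measurability) ?_
  filter_upwards [ae_restrict_mem hmB] with z hz
  have hz : gaugePow α z < R := hz
  have hq : 1/2 ≤ qcut α (2*R) z := by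
    refine le_max_of_le_right ?_
    have : gaugePow α z / (2*R) ≤ 1/2 := by rw [div_le_iff₀ (by positivity)]; linarith
    linarith
  have hq3 : (1/2)^3 ≤ qcut α (2*R) z ^ 3 := by gcongr
  rw [Real.norm_of_nonneg (by positivity), ← one_div, ← mul_div_assoc]
  gcongr
  linarith

lemma gradXsq_nonneg (f : E m n → ℝ) (z : E m n) : 0 ≤ gradXsq α f z := by
  rw [gradXsq_eq]
  exact add_nonneg (Finset.sum_nonneg fun _ _ => sq_nonneg _)
    (mul_nonneg (wt_nonneg z) (Finset.sum_nonneg fun _ _ => sq_nonneg _))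

lemma measurable_gradXsq (hα : 0 < α) (f : E m n → ℝ) : Measurable (gradXsq α f) := by
  have e : gradXsq α f = fun z =>
    (∑ i, (fderiv ℝ f z (ex i))^2) + wt α z * (∑ j, (fderiv ℝ f z (ey j))^2) := rfl
  have := fun v => measurable_fderiv_apply_const ℝ f v
  have := (continuous_wt (m := m) (n := n) hα).measurable
  rw [e]
  fun_prop

lemma IsAdmissible.integrableOn_gradXsq (hα : 0 < α) (hm : 2 < m) {f : E m n → ℝ}
    (hf : IsAdmissible f) {R : ℝ} (hR : 0 < R) :
    IntegrableOn (gradXsq α f) {z | gaugePow α z < R} := by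
  have hmB : MeasurableSet {z : E m n | gaugePow α z < R} :=
    (isOpen_lt (continuous_gaugePow hα) continuous_const).measurableSet
  have hK := isCompact_sublevel (m := m) (n := n) hα R
  obtain ⟨M, hM⟩ := hf.bound _ hK
  have cw := continuous_wt (m := m) (n := n) hα
  obtain ⟨N, hN⟩ := hK.exists_bound_of_continuousOn
    (f := fun z => m * M^2 + wt α z * (n * (M * ‖z.1‖)^2)) (by fun_prop)
  refine Integrable.mono' ((integrableOn_inv_norm_sq hα hm hR).const_mul N)
    (measurable_gradXsq hα f).aestronglyMeasurable ?_
  filter_upwards [ae_restrict_mem hmB, ae_restrict_of_ae (ae_x_ne_zero (n := n)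
    (show 0 < m by omega))] with z hz hx
  have hz : gaugePow α z ≤ R := le_of_lt hz
  rw [Real.norm_of_nonneg (gradXsq_nonneg f z), ← div_eq_mul_inv, le_div_iff₀ (by positivity)]
  refine le_trans ?_ ((le_abs_self _).trans (hN z hz))
  have h1 : ∀ i, (fderiv ℝ f z (ex i))^2 * ‖z.1‖^2 ≤ M^2 := fun i => by
    have := hM z hz (ex i)
    simp only [ex, PiLp.norm_single, norm_one, norm_zero, mul_zero, add_zero, mul_one] at this
    rw [← mul_pow, ← sq_abs, abs_mul, abs_norm, mul_comm]
    gcongr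
  have h2 : ∀ j, (fderiv ℝ f z (ey j))^2 * ‖z.1‖^2 ≤ (M * ‖z.1‖)^2 := fun j => by
    have := hM z hz (ey j)
    simp only [ey, PiLp.norm_single, norm_one, norm_zero, zero_add, mul_one] at this
    rw [← mul_pow, ← sq_abs, abs_mul, abs_norm, mul_comm]
    gcongr
  rw [gradXsq_eq, add_mul, mul_assoc, Finset.sum_mul, Finset.sum_mul]
  have s1 := Finset.sum_le_sum fun i (_ : i ∈ Finset.univ) => h1 i
  have s2 := Finset.sum_le_sum fun i (_ : i ∈ Finset.univ) => h2 i
  simp only [Finset.sum_const, Finset.card_univ, Fintype.card_fin, nsmul_eq_mul] at s1 s2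
  exact add_le_add s1 (mul_le_mul_of_nonneg_left s2 (wt_nonneg z))

end hardy

lemma hasDerivAt_add_rpow_neg {ε : ℝ} (hε : 0 < ε) (s : ℝ) {p : ℝ} (hp : 0 ≤ p) :
    HasDerivAt (fun p => (p+ε)^(-s)) (-s * (p+ε)^(-s-1)) p := by
  have h : HasDerivAt (fun p => p + ε) 1 p := (hasDerivAt_id p).add_const ε
  refine (h.rpow_const (p := -s) (Or.inl (by positivity))).congr_deriv ?_
  ring

/-- Sign of the zeroth order coefficient in the weighted Rellich identity. -/
lemma rellich_weight_bound {k β c A ℓ p ε R : ℝ} (hk : 0 < k) (hβ : 0 < β) (hβk : β * k = 4)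
    (hc : 0 < c) (hA : A = 6*k*β^2 + 6*β^2) (hℓ : ℓ = c + β + 4) (hp : 0 ≤ p) (hε : 0 < ε)
    (hpR : p < R) :
    β^2 * p * (k*(k+1)*(p+ε)^(-k-2) * (max 0 (1-p/R))^3
        + 6*k/R * (p+ε)^(-k-1) * (max 0 (1-p/R))^2 + 6/R^2 * (p+ε)^(-k) * max 0 (1-p/R))
      + β * ℓ * (-(k * (p+ε)^(-k-1) * (max 0 (1-p/R))^3)
        - 3/R * (p+ε)^(-k) * (max 0 (1-p/R))^2)
      ≤ -(2*c*((p+ε)^(-k-1) * (max 0 (1-p/R))^3)) + A * (min (c/(2*A)) (1/2))^(-k) * R^(-k-1) := by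
  have hR : 0 < R := hp.trans_lt hpR
  have hθ : 0 < p + ε := by linarith
  have hApos : 0 < A := by rw [hA]; positivity
  have hr1 : p / R < 1 := (div_lt_one hR).2 hpR
  have hr0 : 0 ≤ p / R := by positivity
  have hq : max 0 (1-p/R) = 1 - p/R := max_eq_right (by linarith)
  rw [hq]
  have hq0 : 0 ≤ 1 - p/R := by linarith
  have hq1 : 1 - p/R ≤ 1 := by linarith
  set q := 1 - p/R with hqd
  have e1 : (p+ε)^(-k-1) = (p+ε)^(-k) / (p+ε) := Real.rpow_sub_one hθ.ne' _
  have e2 : (p+ε)^(-k-2) = (p+ε)^(-k) / (p+ε)^2 := by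
    rw [Real.rpow_sub hθ]; norm_cast
  have e3 : R^(-k-1) = R^(-k) / R := Real.rpow_sub_one hR.ne' _
  have hT : 0 < (p+ε)^(-k) := Real.rpow_pos_of_pos hθ _
  set δ := min (c/(2*A)) (1/2) with hδ
  have hδ0 : 0 < δ := lt_min (by positivity) (by norm_num)
  have hS : 0 < R^(-k) := Real.rpow_pos_of_pos hR _
  have hD : 0 < δ^(-k) := Real.rpow_pos_of_pos hδ0 _
  rw [e1, e2, e3]
  have hTθ : δ * R ≤ p+ε → (p+ε)^(-k) ≤ δ^(-k) * R^(-k) := fun h => by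
    rw [← Real.mul_rpow hδ0.le hR.le]
    exact Real.rpow_le_rpow_of_nonpos (by positivity) h (by linarith)
  set T := (p+ε)^(-k) with hTd
  set θ := p+ε with hθd
  have hpθ : p / θ ≤ 1 := by rw [div_le_one hθ]; linarith
  have main : A * T * q / R ≤ 2*c*(T/θ*q^3) + A * δ^(-k) * (R^(-k)/R) := by
    by_cases h : θ * A ≤ 2*c*R*q^2
    · have : A * T * q / R ≤ 2*c*(T/θ*q^3) := by
        rw [div_le_iff₀ hR]
        have : 2*c*(T/θ*q^3)*R = (2*c*R*q^2) * (T/θ*q) := by ring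
        rw [this]
        calc A*T*q = (θ*A)*(T/θ*q) := by field_simp
          _ ≤ _ := by gcongr
      have : 0 ≤ A * δ^(-k) * (R^(-k)/R) := by positivity
      linarith
    · have hδR : δ * R ≤ θ := by
        by_cases hq2 : 1/2 ≤ q
        · have h1 : (1/2)^2 ≤ q^2 := by gcongr
          have h2 : δ ≤ c/(2*A) := min_le_left _ _
          have h3 : c/(2*A)*R ≤ θ := by
            rw [div_mul_eq_mul_div, div_le_iff₀ (by positivity)]
            have : 2*c*R*(1/2)^2 ≤ 2*c*R*q^2 := by gcongr
            nlinarith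
          exact (mul_le_mul_of_nonneg_right h2 hR.le).trans h3
        · have h2 : δ ≤ 1/2 := min_le_right _ _
          have h4 : 1/2 ≤ p/R := by linarith
          rw [le_div_iff₀ hR] at h4
          nlinarith
      have h5 := hTθ hδR
      have : A * T * q / R ≤ A * δ^(-k) * (R^(-k)/R) := by
        calc A*T*q/R ≤ A*(δ^(-k) * R^(-k))*1/R := by gcongr
          _ = _ := by ring
      have : 0 ≤ 2*c*(T/θ*q^3) := by positivity
      linarith
  have t1 : β^2*(k*(k+1))*(T/θ*q^3) * (p/θ) ≤ β^2*(k*(k+1))*(T/θ*q^3) :=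
    mul_le_of_le_one_right (by positivity) hpθ
  have t2 : β^2*(6*k)*(T*q/R) * (p/θ*q) ≤ β^2*(6*k)*(T*q/R) :=
    mul_le_of_le_one_right (by positivity) (mul_le_one₀ hpθ hq0 hq1)
  have t3 : β^2*6*(T*q/R)*(p/R) ≤ β^2*6*(T*q/R) :=
    mul_le_of_le_one_right (by positivity) hr1.le
  have t4 : 0 ≤ β*ℓ*(3/R*T*q^2) := by rw [hℓ]; positivity
  have e4 : β^2*(k*(k+1)) - β*ℓ*k = -(4*c) := by
    rw [hℓ]; linear_combination (β*k + β + 4 - c - β - 4) * hβk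
  have e5 : β^2*(k*(k+1))*(T/θ*q^3) = -(4*c)*(T/θ*q^3) + β*ℓ*k*(T/θ*q^3) := by
    linear_combination (T/θ*q^3) * e4
  have e6 : A*T*q/R = β^2*(6*k)*(T*q/R) + β^2*6*(T*q/R) := by rw [hA]; ring
  have e7 : β^2 * p * (k*(k+1)*(T/θ^2) * q^3 + 6*k/R * (T/θ) * q^2 + 6/R^2 * T * q)
      + β * ℓ * (-(k * (T/θ) * q^3) - 3/R * T * q^2) =
      β^2*(k*(k+1))*(T/θ*q^3) * (p/θ) + β^2*(6*k)*(T*q/R) * (p/θ*q) + β^2*6*(T*q/R)*(p/R)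
      - β*ℓ*k*(T/θ*q^3) - β*ℓ*(3/R*T*q^2) := by ring_nf
  rw [e7]
  linarith

section rellich

variable {m n : ℕ} {α : ℝ}

lemma norm_sq_le_wt_mul (hα : 0 < α) (hα1 : α ≤ 1) (z : E m n) {ε : ℝ} (hε : 0 < ε) :
    ‖z.1‖^2 ≤ wt α z * (gaugePow α z + ε)^(2/(α+1) - 1) := by
  have h1 : ‖z.1‖ ^ (2*(α+1)) ≤ gaugePow α z + ε := by
    unfold gaugePow
    have : 0 ≤ (α+1)^2 * ‖z.2‖^2 := by positivity
    linarith
  have hk : 0 ≤ 2/(α+1) - 1 := by rw [sub_nonneg, le_div_iff₀ (by linarith)]; linarith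
  have h2 := Real.rpow_le_rpow (by positivity) h1 hk
  rw [← Real.rpow_mul (norm_nonneg _)] at h2
  refine le_trans (le_of_eq ?_) (mul_le_mul_of_nonneg_left h2 (wt_nonneg z))
  rw [wt, ← Real.rpow_add_of_nonneg (norm_nonneg _) (by positivity) (by positivity)]
  rw [show 2*α + 2*(α+1)*(2/(α+1) - 1) = (2:ℕ) by field_simp; push_cast; ring]
  exact (Real.rpow_natCast _ _).symm

theorem rellich_regularized (hα : 0 < α) (hα1 : α ≤ 1) (hm : 0 < m)
    (hQ : 6 < (m : ℝ) + (α+1) * n) :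
    ∃ K, 0 < K ∧ ∀ (R ε : ℝ) (u : E m n → ℝ), 0 < R → 0 < ε → ContDiff ℝ 2 u →
      Integrable (fun z : E m n => qcut α R z ^ 3 * lapX α u z ^ 2 / ‖z.1‖^2) →
      Integrable (fun z : E m n =>
        (gaugePow α z + ε)^(-(2/(α+1))) * qcut α R z ^ 3 * gradXsq α u z) ∧
      ∫ z : E m n, (gaugePow α z + ε)^(-(2/(α+1))) * qcut α R z ^ 3 * gradXsq α u z ≤
        K * ((∫ z : E m n, qcut α R z ^ 3 * lapX α u z ^ 2 / ‖z.1‖^2)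
          + R^(-(2/(α+1))-1) * ∫ z in {z | gaugePow α z < R}, u z ^ 2 * wt α z) := by
  set k := 2/(α+1) with hk
  set c := (m : ℝ) + (α+1) * n - 6 with hc
  have hcpos : 0 < c := by linarith
  have hkpos : 0 < k := by positivity
  set β := 2*(α+1) with hβ
  have hβpos : 0 < β := by positivity
  have hβk : β * k = 4 := by rw [hβ, hk]; field_simp; norm_num
  set A := 6*k*β^2 + 6*β^2 with hA
  have hApos : 0 < A := by positivity
  have hδ : 0 < min (c/(2*A)) (1/2) := lt_min (by positivity) (by norm_num)
  set C1 := A * (min (c/(2*A)) (1/2))^(-k) with hC1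
  have hC1pos : 0 < C1 := mul_pos hApos (Real.rpow_pos_of_pos hδ _)
  refine ⟨max (1/(4*c)) (C1/2), lt_max_of_lt_left (by positivity), ?_⟩
  intro R ε u hR hε hu hI
  have hmB : MeasurableSet {z : E m n | gaugePow α z < R} :=
    (isOpen_lt (continuous_gaugePow hα) continuous_const).measurableSet
  have cP := continuous_gaugePow (m := m) (n := n) hα
  have cq := continuous_qcut (m := m) (n := n) hα R
  have cw := continuous_wt (m := m) (n := n) hα
  have cu := hu.continuous
  have hu1 : ContDiff ℝ 1 u := hu.of_le (by norm_num)
  have cG : Continuous (gradXsq α u) := by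
    have e : gradXsq α u = fun z =>
      (∑ i, (fderiv ℝ u z (ex i))^2) + wt α z * (∑ j, (fderiv ℝ u z (ey j))^2) := rfl
    have := fun v => continuous_fderiv_apply hu1 v
    rw [e]; fun_prop
  have hθ : ∀ z : E m n, 0 < gaugePow α z + ε := fun z => by
    have := gaugePow_nonneg (α := α) z; linarith
  have cT : Continuous fun z : E m n => (gaugePow α z + ε)^(-k) :=
    (cP.add continuous_const).rpow_const fun z => Or.inl (hθ z).ne'
  set g : ℝ → ℝ := fun p => (p+ε)^(-k) * max 0 (1-p/R)^3 with hg
  set g1 : ℝ → ℝ := fun p => -(k * (p+ε)^(-k-1) * (max 0 (1-p/R))^3)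
        - 3/R * (p+ε)^(-k) * (max 0 (1-p/R))^2 with hg1
  set g2 : ℝ → ℝ := fun p => k*(k+1)*(p+ε)^(-k-2) * (max 0 (1-p/R))^3
        + 6*k/R * (p+ε)^(-k-1) * (max 0 (1-p/R))^2 + 6/R^2 * (p+ε)^(-k) * max 0 (1-p/R) with hg2
  have q0 : ∀ p, R < p → max 0 (1-p/R) = 0 := fun p hp =>
    max_eq_left (by rw [sub_nonpos, le_div_iff₀ hR]; linarith)
  obtain ⟨hint, hzero⟩ := rellich_identity (R := R) hα hu (g := g) (g1 := g1) (g2 := g2)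
    (fun p hp => by
      refine ((hasDerivAt_add_rpow_neg hε k hp).mul (hasDerivAt_cut_pow 1 R p)).congr_deriv ?_
      simp only [hg1]; push_cast; ring)
    (fun p hp => by
      have a1 := (hasDerivAt_add_rpow_neg hε (k+1) hp).mul (hasDerivAt_cut_pow 1 R p)
      have a2 := (hasDerivAt_add_rpow_neg hε k hp).mul (hasDerivAt_cut_pow 0 R p)
      have e1 : ∀ x : ℝ, x^(-(k+1)) = x^(-k-1) := fun x => by rw [neg_add']
      have e2 : ∀ x : ℝ, x^(-(k+1)-1) = x^(-k-2) := fun x => by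
        rw [show -(k+1)-1 = -k-2 by ring]
      refine (((a1.const_mul k).neg.sub (a2.const_mul (3/R))).congr_of_eventuallyEq
        (Filter.Eventually.of_forall fun x => ?_)).congr_deriv ?_
      · simp only [hg1, Pi.mul_apply, e1, Pi.sub_apply, Pi.neg_apply]; ring
      · simp only [hg2, e1, e2]; push_cast; ring)
    (by
      have h : ∀ s : ℝ, ContinuousOn (fun p : ℝ => (p+ε)^s) (Set.Ici 0) := fun s =>
        ContinuousOn.rpow_const (by fun_prop) fun p hp => Or.inl (by
          have : 0 ≤ p := hp
          positivity)
      have a1 := h (-k-2)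
      have a2 := h (-k-1)
      have a3 := h (-k)
      have a4 : ContinuousOn (fun p : ℝ => max 0 (1-p/R)) (Set.Ici 0) := by fun_prop
      simp only [hg2]
      fun_prop)
    (fun p hp => by simp [hg, q0 p hp]) (fun p hp => by simp [hg1, q0 p hp])
    (fun p hp => by simp [hg2, q0 p hp])
  have hL : Integrable (fun z : E m n =>
      (gaugePow α z + ε)^(-k) * qcut α R z ^ 3 * gradXsq α u z) := by
    refine integrable_of_continuous_sublevel hα (R := R) (by fun_prop) fun z hz => ?_
    rw [qcut_eq_zero hR hz.le]; ring
  have hW : IntegrableOn (fun z : E m n => u z ^ 2 * wt α z) {z | gaugePow α z < R} :=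
    (ContinuousOn.integrableOn_compact (isCompact_sublevel hα R)
      (by fun_prop)).mono_set fun z (hz : gaugePow α z < R) => hz.le
  have hind : Integrable ({z : E m n | gaugePow α z < R}.indicator
      (fun z => C1 / 2 * R^(-k-1) * (u z ^ 2 * wt α z))) := by
    rw [integrable_indicator_iff hmB]
    exact hW.const_mul _
  refine ⟨hL, ?_⟩
  have hpt : ∀ᵐ z : E m n, (gaugePow α z + ε)^(-k) * qcut α R z ^ 3 * gradXsq α u z ≤
      (g (gaugePow α z) * gradXsq α u z + g (gaugePow α z) * (u z * lapX α u z)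
      - 1/2 * u z ^ 2 * (wt α z * ((2*(α+1))^2 * gaugePow α z * g2 (gaugePow α z)
        + 2*(α+1) * (m + (α+1)*n + 2*α) * g1 (gaugePow α z))))
      + 1/(4*c) * (qcut α R z ^ 3 * lapX α u z ^ 2 / ‖z.1‖^2)
      + {z : E m n | gaugePow α z < R}.indicator
          (fun z => C1 / 2 * R^(-k-1) * (u z ^ 2 * wt α z)) z := by
    filter_upwards [ae_x_ne_zero (n := n) hm] with z hx
    have hgz : g (gaugePow α z) = (gaugePow α z + ε)^(-k) * qcut α R z ^ 3 := rfl
    rw [hgz]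
    by_cases hz : gaugePow α z < R
    swap
    · have hq : max 0 (1 - gaugePow α z / R) = 0 := qcut_eq_zero hR (not_lt.1 hz)
      simp [hg1, hg2, hq, hz, qcut]
    rw [Set.indicator_of_mem (by exact hz)]
    have hb := rellich_weight_bound hkpos hβpos hβk hcpos hA
      (ℓ := m + (α+1)*n + 2*α) (by rw [hc, hβ]; ring) (gaugePow_nonneg (α := α) z) hε hz
    have hb' : (2*(α+1))^2 * gaugePow α z * g2 (gaugePow α z)
        + 2*(α+1) * (m + (α+1)*n + 2*α) * g1 (gaugePow α z) ≤
        -(2*c*((gaugePow α z+ε)^(-k-1) * qcut α R z^3)) + C1 * R^(-k-1) := hb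
    generalize (2*(α+1))^2 * gaugePow α z * g2 (gaugePow α z)
        + 2*(α+1) * (m + (α+1)*n + 2*α) * g1 (gaugePow α z) = L at hb'
    have hn := norm_sq_le_wt_mul hα hα1 z hε
    rw [← hk] at hn
    have hxp : 0 < ‖z.1‖^2 := by positivity
    have hwp : 0 < wt α z := by unfold wt; positivity
    have hq0 := qcut_nonneg (α := α) R z
    have hθz := hθ z
    rw [Real.rpow_sub_one hθz.ne'] at hb' hn
    have hT : 0 < (gaugePow α z + ε)^(-k) := Real.rpow_pos_of_pos hθz _
    have hTi : (gaugePow α z + ε)^(-k) = ((gaugePow α z + ε)^k)⁻¹ := Real.rpow_neg hθz.le _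
    have hT' : 0 < (gaugePow α z + ε)^k := Real.rpow_pos_of_pos hθz _
    rw [hTi] at hb' ⊢
    set t := (gaugePow α z + ε)^k
    set θ := gaugePow α z + ε
    set q := qcut α R z
    set w := wt α z
    set U := u z
    set W := lapX α u z
    have hn' : θ / (t * w) ≤ 1 / ‖z.1‖^2 := by
      rw [div_le_div_iff₀ (by positivity) hxp]
      calc θ * ‖z.1‖^2 ≤ θ * (w * (t/θ)) := by gcongr
        _ = 1 * (t*w) := by field_simp
    have hq3 : 0 ≤ q^3 := by positivity
    have y1 : -(t⁻¹ * q^3 * (U*W)) ≤ c * (w * (t⁻¹/θ*q^3) * U^2)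
        + 1/(4*c) * (q^3 * W^2 * (θ/(t*w))) := by
      have : 0 ≤ q^3 * t⁻¹ / (4*c*w*θ) * (2*c*w*U + θ*W)^2 := by positivity
      have e : q^3 * t⁻¹ / (4*c*w*θ) * (2*c*w*U + θ*W)^2 = c * (w * (t⁻¹/θ*q^3) * U^2)
        + 1/(4*c) * (q^3 * W^2 * (θ/(t*w))) + t⁻¹ * q^3 * (U*W) := by
        field_simp; ring
      linarith
    have y2 : 1/(4*c) * (q^3 * W^2 * (θ/(t*w))) ≤ 1/(4*c) * (q^3 * W^2 / ‖z.1‖^2) := by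
      rw [div_eq_mul_one_div _ (‖z.1‖^2)]; gcongr
    have y3 : 1/2 * U^2 * (w * L) ≤ 1/2 * U^2 * (w * (-(2*c*(t⁻¹/θ*q^3)) + C1 * R^(-k-1))) := by
      gcongr
    linarith
  refine (integral_mono_ae hL ((hint.add (hI.const_mul (1/(4*c)))).add hind) hpt).trans ?_
  refine (le_of_eq ((integral_add (hint.add (hI.const_mul (1/(4*c)))) hind).trans
    (congrArg (· + _) (integral_add hint (hI.const_mul (1/(4*c))))))).trans ?_
  beta_reduce
  rw [hzero, integral_indicator hmB, integral_const_mul, integral_const_mul]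
  have j1 : 0 ≤ ∫ z : E m n, qcut α R z ^ 3 * lapX α u z ^ 2 / ‖z.1‖^2 :=
    integral_nonneg fun z => by have := qcut_nonneg (α := α) R z; positivity
  have j2 : 0 ≤ ∫ z in {z : E m n | gaugePow α z < R}, u z ^ 2 * wt α z :=
    integral_nonneg fun z => mul_nonneg (sq_nonneg _) (wt_nonneg z)
  have j3 : 0 < R^(-k-1) := Real.rpow_pos_of_pos hR _
  have j4 := mul_le_mul_of_nonneg_right (le_max_left (1/(4*c)) (C1/2)) j1
  have j5 := mul_le_mul_of_nonneg_right (le_max_right (1/(4*c)) (C1/2)) (mul_nonneg j3.le j2)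
  linarith

/-- Weighted Rellich inequality for the gradient, localized by the cutoff `qcut`. -/
theorem rellich_inequality (hα : 0 < α) (hα1 : α ≤ 1) (hm : 0 < m)
    (hQ : 6 < (m : ℝ) + (α+1) * n) :
    ∃ K, 0 < K ∧ ∀ (R : ℝ) (u : E m n → ℝ), 0 < R → ContDiff ℝ 2 u →
      Integrable (fun z : E m n => qcut α R z ^ 3 * lapX α u z ^ 2 / ‖z.1‖^2) →
      Integrable (fun z : E m n =>
        gaugePow α z ^(-(2/(α+1))) * qcut α R z ^ 3 * gradXsq α u z) ∧
      ∫ z : E m n, gaugePow α z ^(-(2/(α+1))) * qcut α R z ^ 3 * gradXsq α u z ≤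
        K * ((∫ z : E m n, qcut α R z ^ 3 * lapX α u z ^ 2 / ‖z.1‖^2)
          + R^(-(2/(α+1))-1) * ∫ z in {z | gaugePow α z < R}, u z ^ 2 * wt α z) := by
  obtain ⟨K, hK, h⟩ := rellich_regularized hα hα1 hm hQ
  refine ⟨K, hK, fun R u hR hu hI => ?_⟩
  have h := fun j : ℕ => h R _ u hR (Nat.one_div_pos_of_nat (α := ℝ) (n := j)) hu hI
  refine integrable_and_integral_le_of_tendsto (fun j z => ?_) (fun j => (h j).1)
    (fun j => (h j).2) ?_
  · have h1 := qcut_nonneg (α := α) R z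
    have h2 := gaugePow_nonneg (α := α) z
    have h3 := gradXsq_nonneg (α := α) u z
    positivity
  · filter_upwards [ae_x_ne_zero (n := n) hm] with z hz
    have hP : 0 < gaugePow α z := by
      have : 0 < ‖z.1‖ := norm_pos_iff.2 hz
      unfold gaugePow; positivity
    have ht : Filter.Tendsto (fun j : ℕ => gaugePow α z + 1 / ((j:ℝ) + 1)) Filter.atTop
        (nhds (gaugePow α z + 0)) := tendsto_one_div_add_atTop_nhds_zero_nat.const_add _
    rw [add_zero] at ht
    exact ((ht.rpow_const (Or.inl hP.ne')).mul_const _).mul_const _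

end rellich

section coarea

variable {X : Type*} [MetricSpace X] [CompleteSpace X] [SecondCountableTopology X]
  [MeasurableSpace X] [BorelSpace X] [Nonempty X] {ι : Type*} [Fintype ι]

open scoped ENNReal

/-- Coarea-type inequality on the part of the space where `P` is strictly monotone in the
coordinate `(e z).2`. -/
lemma lintegral_abs_deriv_le_lintegral_hausdorffMeasure {μ : Measure X} (e : X ≃ᵐ (ι → ℝ) × ℝ)
    (he : MeasurePreserving e μ volume) (hec : Continuous e)
    (hlip : LipschitzWith 1 (fun z => (e z).1)) {P D : X → ℝ} (hP : Continuous P)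
    (hD : Measurable D)
    (hd : ∀ w t, 0 < t → HasDerivAt (fun t => P (e.symm (w, t))) (D (e.symm (w, t))) t)
    (hinj : ∀ w, Set.InjOn (fun t => P (e.symm (w, t))) (Set.Ioi 0))
    {G : X → ℝ≥0∞} (hG : Measurable G) :
    ∫⁻ z in {z | 0 < (e z).2}, G z * ENNReal.ofReal |D z| ∂μ ≤
      ∫⁻ τ, ∫⁻ z in {z | P z = τ}, G z ∂μH[Fintype.card ι] := by
  set H : Set X := {z | 0 < (e z).2} with hHdef
  have hH : MeasurableSet H := measurableSet_lt measurable_const e.measurable.snd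
  set Θ : X → (ι → ℝ) × ℝ := fun z => ((e z).1, P z) with hΘ
  have hΘc : Continuous Θ := (continuous_fst.comp hec).prodMk hP
  have hΘi : Set.InjOn Θ H := by
    intro z hz z' hz' h
    obtain ⟨h1, h2⟩ := Prod.ext_iff.1 h
    simp only [hΘ] at h1 h2
    have h3 := hinj (e z).1 hz hz' (by
      beta_reduce
      rw [show e.symm ((e z).1, (e z).2) = z from e.symm_apply_apply z, h1,
        show e.symm ((e z').1, (e z').2) = z' from e.symm_apply_apply z', h2])
    exact e.injective (Prod.ext h1 h3)
  have hemb := hΘc.continuousOn.measurableEmbedding hH hΘi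
  obtain ⟨s, hs, hs'⟩ := hemb.exists_measurable_extend
    (measurable_subtype_coe : Measurable (Subtype.val : H → X)) fun _ => inferInstance
  have hsΘ : ∀ z ∈ H, s (Θ z) = z := fun z hz => congrFun hs' ⟨z, hz⟩
  have him : MeasurableSet (Θ '' H) := hH.image_of_continuousOn_injOn hΘc.continuousOn hΘi
  have hline : ∀ w, ∫⁻ t in Set.Ioi 0, G (e.symm (w, t)) * ENNReal.ofReal |D (e.symm (w, t))| =
      ∫⁻ τ, (Θ '' H).indicator (fun y => G (s y)) (w, τ) := by
    intro w
    have hset : (fun t => P (e.symm (w, t))) '' Set.Ioi 0 = {τ | (w, τ) ∈ Θ '' H} := by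
      ext τ
      constructor
      · rintro ⟨t, ht, rfl⟩
        exact ⟨e.symm (w, t), by simpa [hHdef] using ht, by simp [hΘ]⟩
      · rintro ⟨z, hz, h⟩
        have h1 : (e z).1 = w := congrArg Prod.fst h
        have h2 : P z = τ := congrArg Prod.snd h
        refine ⟨(e z).2, hz, ?_⟩
        beta_reduce
        rw [← h1, show e.symm ((e z).1, (e z).2) = z from e.symm_apply_apply z, h2]
    have h := lintegral_image_eq_lintegral_abs_deriv_mul measurableSet_Ioi
      (fun t ht => (hd w t ht).hasDerivWithinAt) (hinj w) (fun τ => G (s (w, τ)))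
    rw [hset] at h
    have hm : MeasurableSet {τ | (w, τ) ∈ Θ '' H} := him.preimage measurable_prodMk_left
    have e1 : (fun τ => (Θ '' H).indicator (fun y => G (s y)) (w, τ)) =
        {τ | (w, τ) ∈ Θ '' H}.indicator fun τ => G (s (w, τ)) := rfl
    rw [e1, lintegral_indicator hm, h]
    refine setLIntegral_congr_fun measurableSet_Ioi fun t ht => ?_
    have := hsΘ (e.symm (w, t)) (by simpa [hHdef] using ht)
    simp only [hΘ, e.apply_symm_apply] at this
    simp only [this]
    rw [mul_comm]
  have hm1 : Measurable fun y : (ι → ℝ) × ℝ => (Θ '' H).indicator (fun y => G (s y)) y :=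
    (hG.comp hs).indicator him
  have h1 : ∫⁻ z in H, G z * ENNReal.ofReal |D z| ∂μ =
      ∫⁻ w : ι → ℝ, ∫⁻ t in Set.Ioi 0, G (e.symm (w, t)) * ENNReal.ofReal |D (e.symm (w, t))| := by
    have hm2 : Measurable fun z => G z * ENNReal.ofReal |D z| := by fun_prop
    have hm3 : Measurable fun y => H.indicator (fun z => G z * ENNReal.ofReal |D z|) (e.symm y) :=
      (hm2.indicator hH).comp e.symm.measurable
    rw [← lintegral_indicator hH]
    have := he.symm.lintegral_comp_emb e.symm.measurableEmbedding
      (H.indicator (fun z => G z * ENNReal.ofReal |D z|))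
    rw [← this, Measure.volume_eq_prod, lintegral_prod _ hm3.aemeasurable]
    refine lintegral_congr fun w => ?_
    rw [← lintegral_indicator measurableSet_Ioi]
    refine lintegral_congr fun t => ?_
    simp [Set.indicator, hHdef]
  rw [h1]
  simp only [hline]
  rw [lintegral_lintegral_swap hm1.aemeasurable]
  refine lintegral_mono fun τ => ?_
  have hA : MeasurableSet {w | (w, τ) ∈ Θ '' H} := him.preimage measurable_prodMk_right
  have hσ : Measurable fun w => s (w, τ) := hs.comp measurable_prodMk_right
  have e1 : (fun w => (Θ '' H).indicator (fun y => G (s y)) (w, τ)) =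
      {w | (w, τ) ∈ Θ '' H}.indicator fun w => G (s (w, τ)) := rfl
  beta_reduce
  rw [e1, lintegral_indicator hA, ← lintegral_map hG hσ]
  refine lintegral_mono' (Measure.le_iff.2 fun B hB => ?_) le_rfl
  rw [Measure.map_apply hσ hB, Measure.restrict_apply (hB.preimage hσ), Measure.restrict_apply hB,
    ← hausdorffMeasure_pi_real]
  have hsub : (fun w => s (w, τ)) ⁻¹' B ∩ {w | (w, τ) ∈ Θ '' H} ⊆
      (fun z => (e z).1) '' (B ∩ {z | P z = τ}) := by
    rintro w ⟨hw, z, hz, h⟩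
    have h1 : (e z).1 = w := congrArg Prod.fst h
    have h2 : P z = τ := congrArg Prod.snd h
    have h3 : s (w, τ) = z := by rw [← h]; exact hsΘ z hz
    have hw : s (w, τ) ∈ B := hw
    rw [h3] at hw
    exact ⟨z, ⟨hw, h2⟩, h1⟩
  refine (measure_mono hsub).trans ?_
  have := hlip.hausdorffMeasure_image_le (d := (Fintype.card ι : ℝ)) (by positivity)
    (B ∩ {z | P z = τ})
  simpa using this

end coarea

section slicing

open scoped ENNReal

variable {m n : ℕ} {α : ℝ}

/-- The coordinate of index `a`. -/
def coord (a : Fin m ⊕ Fin n) (z : E m n) : ℝ := Sum.elim (fun i => z.1 i) (fun j => z.2 j) a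

/-- The coordinate vector of index `a`. -/
def coordVec (a : Fin m ⊕ Fin n) : E m n := Sum.elim ex ey a

/-- All coordinates at once, as a measurable equivalence. -/
def coordEquiv (m n : ℕ) : E m n ≃ᵐ (Fin m ⊕ Fin n → ℝ) :=
  (MeasurableEquiv.prodCongr (MeasurableEquiv.toLp 2 _).symm (MeasurableEquiv.toLp 2 _).symm).trans
    (MeasurableEquiv.sumPiEquivProdPi (fun _ => ℝ)).symm

lemma coordEquiv_apply (z : E m n) (a) : coordEquiv m n z a = coord a z := by
  rcases a with i | j <;> rfl

lemma measurePreserving_coordEquiv : MeasurePreserving (coordEquiv m n) := by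
  have h1 : MeasurePreserving (MeasurableEquiv.prodCongr (MeasurableEquiv.toLp 2 (Fin m → ℝ)).symm
      (MeasurableEquiv.toLp 2 (Fin n → ℝ)).symm) volume volume :=
    MeasurePreserving.prod (EuclideanSpace.volume_preserving_symm_measurableEquiv_toLp _)
      (EuclideanSpace.volume_preserving_symm_measurableEquiv_toLp _)
  exact h1.trans (volume_measurePreserving_sumPiEquivProdPi_symm (fun _ => ℝ))

instance uniqueNotNe {β : Type*} (a : β) : Unique {b // ¬ b ≠ a} :=
  ⟨⟨⟨a, by simp⟩⟩, fun b => Subtype.ext (not_not.1 b.2)⟩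

/-- Separate the coordinate of index `a` from the other ones. -/
def splitEquiv (a : Fin m ⊕ Fin n) (e : ℝ ≃ᵐ ℝ) : E m n ≃ᵐ ({b // b ≠ a} → ℝ) × ℝ :=
  (coordEquiv m n).trans ((MeasurableEquiv.piEquivPiSubtypeProd (fun _ => ℝ) (· ≠ a)).trans
    (MeasurableEquiv.prodCongr (MeasurableEquiv.refl _)
      ((MeasurableEquiv.funUnique {b // ¬ b ≠ a} ℝ).trans e)))

lemma splitEquiv_fst (a : Fin m ⊕ Fin n) (e : ℝ ≃ᵐ ℝ) (z : E m n) (b) :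
    (splitEquiv a e z).1 b = coord (b : Fin m ⊕ Fin n) z :=
  coordEquiv_apply z b

lemma splitEquiv_snd (a : Fin m ⊕ Fin n) (e : ℝ ≃ᵐ ℝ) (z : E m n) :
    (splitEquiv a e z).2 = e (coord a z) :=
  congrArg e (coordEquiv_apply z a)

lemma measurePreserving_splitEquiv (a : Fin m ⊕ Fin n) {e : ℝ ≃ᵐ ℝ} (he : MeasurePreserving e) :
    MeasurePreserving (splitEquiv a e) :=
  measurePreserving_coordEquiv.trans
    ((volume_preserving_piEquivPiSubtypeProd (fun _ => ℝ) (· ≠ a)).trans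
      ((MeasurePreserving.id _).prod (by
        have h := (volume_preserving_funUnique {b // ¬ b ≠ a} ℝ).trans he
        rw [Subsingleton.elim (Unique.fintype : Fintype {b // ¬ b ≠ a}) (Subtype.fintype _)] at h
        exact h)))

lemma coord_ext {z z' : E m n} (h : ∀ a, coord a z = coord a z') : z = z' := by
  refine Prod.ext ?_ ?_
  · ext i; exact h (Sum.inl i)
  · ext j; exact h (Sum.inr j)

lemma coord_add_smul (z z' : E m n) (t : ℝ) (a) :
    coord a (z + t • z') = coord a z + t * coord a z' := by
  rcases a with i | j <;> simp [coord]

lemma coord_coordVec (a b : Fin m ⊕ Fin n) : coord b (coordVec a) = if b = a then 1 else 0 := by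
  rcases a with i | j <;> rcases b with k | l <;> simp [coord, coordVec]

lemma continuous_coord (a : Fin m ⊕ Fin n) : Continuous (coord a) := by
  rcases a with i | j
  · exact (by fun_prop : Continuous fun z : E m n => z.1 i)
  · exact (by fun_prop : Continuous fun z : E m n => z.2 j)

lemma abs_coord_sub_le (z z' : E m n) (a : Fin m ⊕ Fin n) : |coord a z - coord a z'| ≤ dist z z' := by
  rw [dist_eq_norm]
  rcases a with i | j
  · refine le_trans ?_ (norm_fst_le (z - z'))
    simpa [coord] using PiLp.norm_apply_le (z.1 - z'.1) i
  · refine le_trans ?_ (norm_snd_le (z - z'))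
    simpa [coord] using PiLp.norm_apply_le (z.2 - z'.2) j

lemma dGaugePow_coordVec (z : E m n) (a : Fin m ⊕ Fin n) :
    dGaugePow α z (coordVec a) =
      Sum.elim (fun _ => 2*(α+1)*wt α z) (fun _ => 2*(α+1)^2) a * coord a z := by
  rcases a with i | j <;> simp [coord, coordVec]

lemma continuous_dGaugePow_coordVec (hα : 0 < α) (a : Fin m ⊕ Fin n) :
    Continuous fun z : E m n => dGaugePow α z (coordVec a) := by
  have := continuous_wt (m := m) (n := n) hα
  have h2 := continuous_coord a
  simp only [dGaugePow_coordVec]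
  rcases a with i | j <;> simp only [Sum.elim_inl, Sum.elim_inr] <;> fun_prop

/-- The squared Euclidean length of the gradient of `gaugePow`. -/
def gradGaugePowSq (α : ℝ) (z : E m n) : ℝ := ∑ a, dGaugePow α z (coordVec a) ^ 2

lemma continuous_gradGaugePowSq (hα : 0 < α) : Continuous (gradGaugePowSq α : E m n → ℝ) :=
  continuous_finsetSum _ fun a _ => (continuous_dGaugePow_coordVec hα a).pow 2

lemma gradGaugePowSq_nonneg (z : E m n) : 0 ≤ gradGaugePowSq α z :=
  Finset.sum_nonneg fun _ _ => sq_nonneg _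

lemma lintegral_half_space_le (hα : 0 < α) (a : Fin m ⊕ Fin n) {σ : ℝ} (hσ : σ * σ = 1)
    {e : ℝ ≃ᵐ ℝ} (he : ∀ t, e t = σ * t) (hmp : MeasurePreserving e)
    {G : E m n → ℝ≥0∞} (hG : Measurable G) :
    ∫⁻ z in {z | 0 < σ * coord a z}, G z * ENNReal.ofReal |dGaugePow α z (coordVec a)| ≤
      ∫⁻ τ, ∫⁻ z in {z | gaugePow α z = τ}, G z ∂μH[(m + n - 1 : ℝ)] := by
  have hcard : (Fintype.card {b // b ≠ a} : ℝ) = m + n - 1 := by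
    have h : 0 < Fintype.card (Fin m ⊕ Fin n) := Fintype.card_pos_iff.2 ⟨a⟩
    rw [Fintype.card_subtype_compl, Fintype.card_subtype_eq, Nat.cast_sub h]
    simp
  have hes : ∀ t, e.symm t = σ * t := fun t => by
    rw [MeasurableEquiv.symm_apply_eq, he, ← mul_assoc, hσ, one_mul]
  have hsa : ∀ w t, coord a ((splitEquiv a e).symm (w, t)) = σ * t := fun w t => by
    rw [← hes, eq_comm, MeasurableEquiv.symm_apply_eq, ← splitEquiv_snd]
    simp
  have hsb : ∀ w t (b : {b // b ≠ a}), coord b.1 ((splitEquiv a e).symm (w, t)) = w b :=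
    fun w t b => by rw [← splitEquiv_fst a e]; simp
  have hadd : ∀ w t s, (splitEquiv a e).symm (w, s) =
      (splitEquiv a e).symm (w, t) + (s - t) • (σ • coordVec a) := by
    intro w t s
    refine coord_ext fun b => ?_
    rw [smul_smul, coord_add_smul, coord_coordVec]
    by_cases hb : b = a
    · subst hb; simp [hsa]; ring
    · simp [hb, hsb _ _ ⟨b, hb⟩]
  have hd : ∀ w t, HasDerivAt (fun t => gaugePow α ((splitEquiv a e).symm (w, t)))
      (dGaugePow α ((splitEquiv a e).symm (w, t)) (σ • coordVec a)) t := by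
    intro w t
    have h1 : HasDerivAt (fun s : ℝ => (splitEquiv a e).symm (w, t) + (s - t) • (σ • coordVec a))
        (σ • coordVec a) t := by
      have := (((hasDerivAt_id t).sub_const t).smul_const (σ • coordVec (m := m) (n := n) a)).const_add
        ((splitEquiv a e).symm (w, t))
      rwa [one_smul] at this
    have h3 : (fun s => gaugePow α ((splitEquiv a e).symm (w, s))) = fun s =>
        gaugePow α ((splitEquiv a e).symm (w, t) + (s - t) • (σ • coordVec a)) :=
      funext fun s => by rw [← hadd]
    rw [h3]
    have h2 := (hasFDerivAt_gaugePow hα ((splitEquiv a e).symm (w, t)))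
    exact HasFDerivAt.comp_hasDerivAt_of_eq t h2 h1 (by simp)
  have hpos : ∀ w t, 0 < t →
      0 < dGaugePow α ((splitEquiv a e).symm (w, t)) (σ • coordVec a) := by
    intro w t ht
    have h := hsa w t
    rw [map_smul, smul_eq_mul, dGaugePow_coordVec, h]
    set z := (splitEquiv a e).symm (w, t)
    rw [show ∀ c : ℝ, σ * (c * (σ * t)) = (σ * σ) * (c * t) by intros; ring, hσ, one_mul]
    refine mul_pos ?_ ht
    rcases a with i | j
    · have hz : z.1 ≠ 0 := by
        intro h0
        have : z.1 i = σ * t := h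
        rw [h0] at this
        have h1 : σ ≠ 0 := fun h => by simp [h] at hσ
        simp [h1, ht.ne'] at this
      have : 0 < wt α z := Real.rpow_pos_of_pos (norm_pos_iff.2 hz) _
      simp only [Sum.elim_inl]
      positivity
    · simp only [Sum.elim_inr]
      positivity
  have key := lintegral_abs_deriv_le_lintegral_hausdorffMeasure (μ := volume) (splitEquiv a e)
    (measurePreserving_splitEquiv a hmp) ?_ ?_ (continuous_gaugePow hα)
    (D := fun z => dGaugePow α z (σ • coordVec a)) ?_ (fun w t _ => hd w t) ?_ hG
  · rw [hcard] at key
    refine le_trans (le_of_eq ?_) key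
    have hs : {z : E m n | 0 < (splitEquiv a e z).2} = {z | 0 < σ * coord a z} := by
      ext z; simp [splitEquiv_snd, he]
    rw [hs]
    refine lintegral_congr fun z => ?_
    rw [map_smul, smul_eq_mul, abs_mul, (pow_eq_one_iff_of_nonneg (abs_nonneg σ) two_ne_zero).1 (by rw [sq_abs, sq, hσ]), one_mul]
  · refine Continuous.prodMk (continuous_pi fun b => ?_) ?_
    · exact (continuous_coord b.1).congr fun z => (splitEquiv_fst a e z b).symm
    · refine Continuous.congr ?_ fun z => ((splitEquiv_snd a e z).trans (he _)).symm
      exact continuous_const.mul (continuous_coord a)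
  · refine LipschitzWith.of_dist_le_mul fun z z' => ?_
    rw [NNReal.coe_one, one_mul, dist_pi_le_iff dist_nonneg]
    intro b
    rw [splitEquiv_fst, splitEquiv_fst, Real.dist_eq]
    exact abs_coord_sub_le z z' _
  · simp only [map_smul, smul_eq_mul]
    exact (continuous_const.mul (continuous_dGaugePow_coordVec hα a)).measurable
  · intro w
    refine (strictMonoOn_of_deriv_pos (convex_Ioi 0)
      (fun t _ => (hd w t).continuousAt.continuousWithinAt) fun t ht => ?_).injOn
    rw [interior_Ioi] at ht
    rw [(hd w t).deriv]
    exact hpos w t ht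

end slicing

section slicing

open scoped ENNReal

variable {m n : ℕ} {α : ℝ}

lemma gradGaugePowSq_pos (hα : 0 < α) {z : E m n} (hz : z ≠ 0) : 0 < gradGaugePowSq α z := by
  suffices ∃ a, dGaugePow α z (coordVec a) ≠ 0 by
    obtain ⟨a, ha⟩ := this
    exact Finset.sum_pos' (fun _ _ => sq_nonneg _) ⟨a, Finset.mem_univ _, by positivity⟩
  by_cases hx : z.1 = 0
  · obtain ⟨j, hj⟩ : ∃ j, z.2 j ≠ 0 := by
      by_contra! h
      exact hz (Prod.ext hx (by ext j; exact h j))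
    refine ⟨Sum.inr j, ?_⟩
    have : coord (Sum.inr j : Fin m ⊕ Fin n) z ≠ 0 := hj
    rw [dGaugePow_coordVec]
    simp only [Sum.elim_inr]
    positivity
  · obtain ⟨i, hi⟩ : ∃ i, z.1 i ≠ 0 := by
      by_contra! h
      exact hx (by ext i; exact h i)
    refine ⟨Sum.inl i, ?_⟩
    have : 0 < wt α z := Real.rpow_pos_of_pos (norm_pos_iff.2 hx) _
    have : coord (Sum.inl i : Fin m ⊕ Fin n) z ≠ 0 := hi
    rw [dGaugePow_coordVec]
    simp only [Sum.elim_inl]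
    positivity

lemma lintegral_mul_abs_coordVec_le (hα : 0 < α) (a : Fin m ⊕ Fin n)
    {G : E m n → ℝ≥0∞} (hG : Measurable G) :
    ∫⁻ z, G z * ENNReal.ofReal |dGaugePow α z (coordVec a)| ≤
      2 * ∫⁻ τ, ∫⁻ z in {z | gaugePow α z = τ}, G z ∂μH[(m + n - 1 : ℝ)] := by
  have h1 := lintegral_half_space_le hα a (σ := 1) (by norm_num) (e := MeasurableEquiv.refl ℝ)
    (by simp) (MeasurePreserving.id _) hG
  have h2 := lintegral_half_space_le hα a (σ := -1) (by norm_num) (e := MeasurableEquiv.neg ℝ)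
    (by simp) (Measure.measurePreserving_neg _) hG
  have hc := (continuous_coord (m := m) (n := n) a).measurable
  have hs : ∫⁻ z, G z * ENNReal.ofReal |dGaugePow α z (coordVec a)| =
      ∫⁻ z in {z | 0 < 1 * coord a z} ∪ {z | 0 < -1 * coord a z},
        G z * ENNReal.ofReal |dGaugePow α z (coordVec a)| := by
    rw [← lintegral_indicator ((measurableSet_lt measurable_const (hc.const_mul _)).union
      (measurableSet_lt measurable_const (hc.const_mul _)))]
    refine lintegral_congr fun z => Eq.symm ?_
    refine Set.indicator_apply_eq_self.2 fun hz => ?_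
    have h0 : coord a z = 0 := by
      simp only [one_mul, neg_mul, Left.neg_pos_iff, Set.mem_union, Set.mem_ofPred_eq, not_or,
        not_lt] at hz
      exact le_antisymm hz.1 hz.2
    rw [dGaugePow_coordVec, h0]
    simp
  rw [hs, two_mul]
  exact (lintegral_union_le _ _ _).trans (add_le_add h1 h2)

/-- Coarea-type inequality for the level sets of `gaugePow`. -/
lemma lintegral_le_lintegral_level (hα : 0 < α) (hm : 0 < m)
    {G : E m n → ℝ≥0∞} (hG : Measurable G) :
    ∫⁻ z, G z ≤ 2 * (m + n) * ∫⁻ τ, ∫⁻ z in {z | gaugePow α z = τ},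
      G z / ENNReal.ofReal √(gradGaugePowSq α z) ∂μH[(m + n - 1 : ℝ)] := by
  have hN := (continuous_gradGaugePowSq (m := m) (n := n) hα).measurable
  have hle : ∀ a, ∫⁻ z : E m n, G z / ENNReal.ofReal (gradGaugePowSq α z) *
      ENNReal.ofReal (dGaugePow α z (coordVec a) ^ 2) ≤ 2 * ∫⁻ τ, ∫⁻ z in {z | gaugePow α z = τ},
      G z / ENNReal.ofReal √(gradGaugePowSq α z) ∂μH[(m + n - 1 : ℝ)] := by
    intro a
    have hD := (continuous_dGaugePow_coordVec (m := m) (n := n) hα a).measurable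
    have h1 := lintegral_mul_abs_coordVec_le hα a (G := fun z =>
      G z / ENNReal.ofReal (gradGaugePowSq α z) * ENNReal.ofReal |dGaugePow α z (coordVec a)|)
      (by fun_prop)
    have e1 : ∀ z : E m n, G z / ENNReal.ofReal (gradGaugePowSq α z) *
        ENNReal.ofReal (dGaugePow α z (coordVec a) ^ 2) =
        G z / ENNReal.ofReal (gradGaugePowSq α z) * ENNReal.ofReal |dGaugePow α z (coordVec a)| *
          ENNReal.ofReal |dGaugePow α z (coordVec a)| := fun z => by
      rw [mul_assoc, ← ENNReal.ofReal_mul (abs_nonneg _), abs_mul_abs_self, sq]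
    simp only [e1]
    refine h1.trans (mul_le_mul_right (lintegral_mono fun τ => lintegral_mono fun z => ?_) _)
    have h2 : |dGaugePow α z (coordVec a)| ≤ √(gradGaugePowSq α z) := by
      refine Real.abs_le_sqrt ?_
      exact Finset.single_le_sum (f := fun a => dGaugePow α z (coordVec a) ^ 2)
        (fun _ _ => sq_nonneg _) (Finset.mem_univ a)
    refine (mul_le_mul_right (ENNReal.ofReal_le_ofReal h2) _).trans ?_
    by_cases h0 : gradGaugePowSq α z = 0
    · simp [h0]
    have hp := lt_of_le_of_ne (gradGaugePowSq_nonneg z) (Ne.symm h0)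
    have hq := Real.sqrt_pos.2 hp
    nth_rw 1 [← Real.mul_self_sqrt hp.le]
    rw [ENNReal.ofReal_mul hq.le, ENNReal.div_eq_inv_mul, ENNReal.div_eq_inv_mul,
      ENNReal.mul_inv (Or.inr ENNReal.ofReal_ne_top) (Or.inl ENNReal.ofReal_ne_top),
      mul_comm, mul_assoc, ← mul_assoc, ENNReal.mul_inv_cancel (by simpa using hq)
      ENNReal.ofReal_ne_top, one_mul]
  have h3 : ∫⁻ z, G z = ∑ a, ∫⁻ z : E m n, G z / ENNReal.ofReal (gradGaugePowSq α z) *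
      ENNReal.ofReal (dGaugePow α z (coordVec a) ^ 2) := by
    rw [← lintegral_finsetSum _ fun a _ => by
      have hD := (continuous_dGaugePow_coordVec (m := m) (n := n) hα a).measurable
      fun_prop]
    refine lintegral_congr_ae ?_
    filter_upwards [ae_x_ne_zero hm] with z hz
    rw [← Finset.mul_sum, ← ENNReal.ofReal_sum_of_nonneg fun _ _ => sq_nonneg _]
    refine (ENNReal.div_mul_cancel ?_ ENNReal.ofReal_ne_top).symm
    simpa using gradGaugePowSq_pos hα (fun h => hz (by rw [h]; rfl))
  rw [h3]
  refine (Finset.sum_le_sum fun a _ => hle a).trans (le_of_eq ?_)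
  rw [Finset.sum_const, Finset.card_univ, Fintype.card_sum, Fintype.card_fin, Fintype.card_fin,
    nsmul_eq_mul, ← mul_assoc, mul_comm _ (2 : ℝ≥0∞)]
  push_cast
  rfl

end slicing

section spheres

open scoped ENNReal

variable {m n : ℕ} {α : ℝ}

/-- The anisotropic dilation. -/
def dil (α s : ℝ) (z : E m n) : E m n := (s • z.1, s ^ (α+1) • z.2)

lemma gaugePow_dil {s : ℝ} (hs : 0 ≤ s) (z : E m n) :
    gaugePow α (dil α s z) = s ^ (2*(α+1)) * gaugePow α z := by
  have : (s ^ (α+1)) ^ 2 = s ^ (2*(α+1)) := by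
    rw [← Real.rpow_natCast, ← Real.rpow_mul hs]; congr 1; push_cast; ring
  simp only [gaugePow, dil, norm_smul, Real.norm_eq_abs, abs_of_nonneg hs, mul_pow, sq_abs,
    Real.mul_rpow hs (norm_nonneg _), this]
  ring

lemma dil_dil {s t : ℝ} (hs : 0 ≤ s) (ht : 0 ≤ t) (z : E m n) :
    dil α s (dil α t z) = dil α (s * t) z := by
  simp [dil, smul_smul, Real.mul_rpow hs ht]

lemma dil_one (z : E m n) : dil α 1 z = z := by simp [dil]

lemma continuous_dil (hα : 0 < α) : Continuous fun q : ℝ × E m n => dil α q.1 q.2 := by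
  have : Continuous fun q : ℝ × E m n => q.1 ^ (α+1) :=
    continuous_fst.rpow_const fun _ => Or.inr (by linarith)
  unfold dil
  fun_prop

lemma lipschitzWith_dil (hα : 0 < α) {s : ℝ} (hs : 0 ≤ s) (hs1 : s ≤ 1) :
    LipschitzWith 1 (dil α s : E m n → E m n) := by
  refine LipschitzWith.of_dist_le_mul fun z z' => ?_
  rw [NNReal.coe_one, one_mul, Prod.dist_eq, Prod.dist_eq]
  simp only [dil, dist_smul₀, Real.norm_eq_abs, abs_of_nonneg hs,
    abs_of_nonneg (Real.rpow_nonneg hs _)]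
  have h1 : s ^ (α+1) ≤ 1 := Real.rpow_le_one hs hs1 (by linarith)
  exact max_le_max (mul_le_of_le_one_left dist_nonneg hs1) (mul_le_of_le_one_left dist_nonneg h1)

lemma gaugePow_pos {z : E m n} (hα : 0 < α) (hz : z ≠ 0) : 0 < gaugePow α z := by
  by_contra! h
  have h1 : 0 ≤ ‖z.1‖ ^ (2*(α+1)) := by positivity
  have h2 : 0 ≤ (α+1)^2 * ‖z.2‖^2 := by positivity
  unfold gaugePow at h
  have h3 : ‖z.1‖ ^ (2*(α+1)) = 0 := by linarith
  have h4 : (α+1)^2 * ‖z.2‖^2 = 0 := by linarith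
  rw [Real.rpow_eq_zero (norm_nonneg _) (by linarith), norm_eq_zero] at h3
  have h5 : z.2 = 0 := by
    have : (α+1)^2 ≠ 0 := by positivity
    simpa [this] using h4
  exact hz (Prod.ext h3 h5)

lemma lintegral_level_le (hα : 0 < α) {s : ℝ} (hs : 0 < s) (hs1 : s ≤ 1) (R : ℝ) {d : ℝ}
    (hd : 0 ≤ d) {G : E m n → ℝ≥0∞} (hG : Measurable G) :
    ∫⁻ z in {z | gaugePow α z = s ^ (2*(α+1)) * R}, G z ∂μH[d] ≤
      ∫⁻ z in {z | gaugePow α z = R}, G (dil α s z) ∂μH[d] := by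
  have hc : Continuous (dil α s : E m n → E m n) :=
    (continuous_dil hα).comp (continuous_const.prodMk continuous_id)
  rw [← lintegral_map hG hc.measurable]
  refine lintegral_mono' (Measure.le_iff.2 fun B hB => ?_) le_rfl
  rw [Measure.map_apply hc.measurable hB, Measure.restrict_apply (hc.measurable hB),
    Measure.restrict_apply hB]
  have hsub : B ∩ {z | gaugePow α z = s ^ (2*(α+1)) * R} ⊆
      dil α s '' (dil α s ⁻¹' B ∩ {z | gaugePow α z = R}) := by
    rintro z ⟨hz, hz'⟩
    have h1 : dil α s (dil α s⁻¹ z) = z := by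
      rw [dil_dil hs.le (inv_nonneg.2 hs.le), mul_inv_cancel₀ hs.ne', dil_one]
    refine ⟨dil α s⁻¹ z, ⟨by rwa [Set.mem_preimage, h1], ?_⟩, h1⟩
    have hz' : gaugePow α z = s ^ (2*(α+1)) * R := hz'
    have : 0 < s ^ (2*(α+1)) := by positivity
    change gaugePow α (dil α s⁻¹ z) = R
    rw [gaugePow_dil (inv_nonneg.2 hs.le), hz', Real.inv_rpow hs.le]
    field_simp
  refine (measure_mono hsub).trans ?_
  simpa using (lipschitzWith_dil hα hs.le hs1).hausdorffMeasure_image_le hd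
    (dil α s ⁻¹' B ∩ {z | gaugePow α z = R})

lemma norm_le_of_abs_coord_le {z : E m n} {M : ℝ} (hM : 0 ≤ M) (h : ∀ a, |coord a z| ≤ M) :
    ‖z‖ ≤ (m + n) * M := by
  have h1 : ‖z.1‖ ≤ m * M := by
    rw [← (EuclideanSpace.basisFun (Fin m) ℝ).sum_repr z.1]
    refine (norm_sum_le _ _).trans ?_
    refine (Finset.sum_le_card_nsmul _ _ M fun i _ => ?_).trans (by simp)
    simpa [norm_smul, coord] using h (Sum.inl i)
  have h2 : ‖z.2‖ ≤ n * M := by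
    rw [← (EuclideanSpace.basisFun (Fin n) ℝ).sum_repr z.2]
    refine (norm_sum_le _ _).trans ?_
    refine (Finset.sum_le_card_nsmul _ _ M fun i _ => ?_).trans (by simp)
    simpa [norm_smul, coord] using h (Sum.inr i)
  rw [Prod.norm_def]
  have h3 : 0 ≤ m * M := by positivity
  have h4 : 0 ≤ n * M := by positivity
  exact max_le (by linarith) (by linarith)

/-- A face of the unit cube. -/
def cubeFace (a : Fin m ⊕ Fin n) (σ : ℝ) : Set (E m n) :=
  {z | coord a z = σ} ∩ ⋂ b, {z | |coord b z| ≤ 1}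

lemma isCompact_cubeFace (a : Fin m ⊕ Fin n) (σ : ℝ) : IsCompact (cubeFace a σ) := by
  refine Metric.isCompact_of_isClosed_isBounded ?_ ?_
  · refine (isClosed_eq (continuous_coord a) continuous_const).inter ?_
    exact isClosed_iInter fun b => isClosed_le (continuous_coord b).abs continuous_const
  · refine (Metric.isBounded_closedBall (x := (0 : E m n)) (r := (m+n)*1)).subset fun z hz => ?_
    rw [mem_closedBall_zero_iff]
    exact norm_le_of_abs_coord_le zero_le_one fun b => Set.mem_iInter.1 hz.2 b

lemma coord_sub (z z' : E m n) (a) : coord a (z - z') = coord a z - coord a z' := by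
  rcases a with i | j <;> simp [coord]

lemma hausdorffMeasure_cubeFace_lt_top (a : Fin m ⊕ Fin n) (σ : ℝ) :
    μH[(m + n - 1 : ℝ)] (cubeFace a σ) < ∞ := by
  have hcard : (Fintype.card {b // b ≠ a} : ℝ) = m + n - 1 := by
    have h : 0 < Fintype.card (Fin m ⊕ Fin n) := Fintype.card_pos_iff.2 ⟨a⟩
    rw [Fintype.card_subtype_compl, Fintype.card_subtype_eq, Nat.cast_sub h]
    simp
  set F : ({b // b ≠ a} → ℝ) → E m n := fun w =>
    (splitEquiv a (MeasurableEquiv.refl ℝ)).symm (w, σ) with hF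
  have hFb : ∀ w (b : {b // b ≠ a}), coord b.1 (F w) = w b := fun w b => by
    rw [← splitEquiv_fst a (MeasurableEquiv.refl ℝ)]; simp [hF]
  have hFa : ∀ w, coord a (F w) = σ := fun w => by
    have := splitEquiv_snd a (MeasurableEquiv.refl ℝ) (F w)
    simpa [hF] using this.symm
  have hL : LipschitzWith (m + n) F := by
    refine LipschitzWith.of_dist_le_mul fun w w' => ?_
    rw [dist_eq_norm]
    push_cast
    refine norm_le_of_abs_coord_le dist_nonneg fun b => ?_
    rw [coord_sub]
    by_cases hb : b = a
    · subst hb; rw [hFa, hFa]; simp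
    · rw [hFb _ ⟨b, hb⟩, hFb _ ⟨b, hb⟩, ← Real.dist_eq]
      exact dist_le_pi_dist _ _ _
  have hsub : cubeFace a σ ⊆ F '' Metric.closedBall 0 1 := by
    rintro z ⟨hz, hz'⟩
    refine ⟨fun b => coord b.1 z, ?_, coord_ext fun b => ?_⟩
    · rw [mem_closedBall_zero_iff, pi_norm_le_iff_of_nonneg zero_le_one]
      exact fun b => Set.mem_iInter.1 hz' b
    · by_cases hb : b = a
      · subst hb; rw [hFa, hz]
      · rw [hFb _ ⟨b, hb⟩]
  refine (measure_mono hsub).trans_lt ?_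
  rw [← hcard]
  refine (hL.hausdorffMeasure_image_le (by positivity) _).trans_lt ?_
  rw [hausdorffMeasure_pi_real]
  refine ENNReal.mul_lt_top ?_ (isCompact_closedBall _ _).measure_lt_top
  exact ENNReal.rpow_lt_top_of_nonneg (by positivity) ENNReal.coe_ne_top

/-- Radial projection onto the level set `{gaugePow = R}` along the dilations. -/
def sphereProj (α R : ℝ) (z : E m n) : E m n := dil α ((R / gaugePow α z) ^ (1/(2*(α+1)))) z

lemma contDiff_gaugePow (hα : 0 < α) : ContDiff ℝ 1 (gaugePow α : E m n → ℝ) := by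
  unfold gaugePow
  exact ((contDiff_norm_rpow (by linarith)).comp contDiff_fst).add
    (contDiff_const.mul (contDiff_snd.norm_sq ℝ))

lemma contDiffAt_sphereProj (hα : 0 < α) {R : ℝ} (hR : 0 < R) {z : E m n} (hz : z ≠ 0) :
    ContDiffAt ℝ 1 (sphereProj α R) z := by
  have hp := gaugePow_pos hα hz
  have h1 : ContDiffAt ℝ 1 (fun z : E m n => (R / gaugePow α z) ^ (1/(2*(α+1)))) z :=
    (contDiffAt_const.div (contDiff_gaugePow hα).contDiffAt hp.ne').rpow_const_of_ne
      (div_pos hR hp).ne'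
  have h2 : ContDiffAt ℝ 1 (fun z : E m n => ((R / gaugePow α z) ^ (1/(2*(α+1)))) ^ (α+1)) z :=
    h1.rpow_const_of_ne (Real.rpow_pos_of_pos (div_pos hR hp) _).ne'
  exact (h1.smul contDiffAt_fst).prodMk (h2.smul contDiffAt_snd)

lemma hausdorffMeasure_sphereProj_image_lt_top (hα : 0 < α) {R : ℝ} (hR : 0 < R) (hm : 0 < m)
    (a : Fin m ⊕ Fin n) {σ : ℝ} (hσ : σ ≠ 0) :
    μH[(m + n - 1 : ℝ)] (sphereProj α R '' cubeFace a σ) < ∞ := by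
  have hd : (0:ℝ) ≤ m + n - 1 := by
    have : (1:ℝ) ≤ m := by exact_mod_cast hm
    have : (0:ℝ) ≤ n := by positivity
    linarith
  have hL : LocallyLipschitzOn (cubeFace a σ) (sphereProj α R) := by
    intro z hz
    have h0 : z ≠ 0 := by
      rintro rfl
      refine hσ (hz.1.symm.trans ?_)
      rcases a with i | j <;> simp [coord]
    obtain ⟨K, t, ht, hK⟩ := (contDiffAt_sphereProj hα hR h0).exists_lipschitzOnWith
    exact ⟨K, t, mem_nhdsWithin_of_mem_nhds ht, hK⟩
  obtain ⟨K, hK⟩ := hL.exists_lipschitzOnWith_of_compact (isCompact_cubeFace a σ)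
  refine (hK.hausdorffMeasure_image_le hd).trans_lt ?_
  refine ENNReal.mul_lt_top ?_ (hausdorffMeasure_cubeFace_lt_top a σ)
  exact ENNReal.rpow_lt_top_of_nonneg hd ENNReal.coe_ne_top

lemma hausdorffMeasure_level_lt_top (hα : 0 < α) {R : ℝ} (hR : 0 < R) (hm : 0 < m) :
    μH[(m + n - 1 : ℝ)] {z : E m n | gaugePow α z = R} < ∞ := by
  have hsub : {z : E m n | gaugePow α z = R} ⊆
      ⋃ a : Fin m ⊕ Fin n, ((sphereProj α R '' cubeFace a 1) ∪ (sphereProj α R '' cubeFace a (-1))) := by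
    intro z hz
    have hz : gaugePow α z = R := hz
    set ω : Fin m ⊕ Fin n → ℝ := Sum.elim (fun _ => 1) (fun _ => α+1) with hω
    have hωpos : ∀ a, 0 < ω a := by rintro (i | j) <;> simp [hω]; linarith
    obtain ⟨a, -, ha⟩ := Finset.exists_max_image Finset.univ
      (fun a : Fin m ⊕ Fin n => |coord a z| ^ (1 / ω a)) ⟨Sum.inl ⟨0, hm⟩, Finset.mem_univ _⟩
    set s := |coord a z| ^ (1 / ω a) with hs
    have hle : ∀ b, |coord b z| ≤ s ^ ω b := fun b => by
      have h := ha b (Finset.mem_univ b)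
      have h2 := Real.rpow_le_rpow (by positivity) h (hωpos b).le
      rwa [← Real.rpow_mul (abs_nonneg _), one_div_mul_cancel (hωpos b).ne', Real.rpow_one] at h2
    have hs0 : 0 ≤ s := by positivity
    have hspos : 0 < s := by
      refine lt_of_le_of_ne hs0 fun h0 => hR.ne ?_
      have : z = 0 := coord_ext fun b => by
        have h := hle b
        rw [← h0, Real.zero_rpow (hωpos b).ne'] at h
        have h2 := abs_nonpos_iff.1 h
        rw [h2]
        rcases b with i | j <;> simp [coord]
      rw [← hz, this, gaugePow]
      simp [Real.zero_rpow (by linarith : 2*(α+1) ≠ 0)]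
    have hcd : ∀ b, coord b (dil α s⁻¹ z) = (s ^ ω b)⁻¹ * coord b z := by
      rintro (i | j) <;> simp [coord, dil, hω, Real.inv_rpow hs0]
    have hsa : |coord a z| = s ^ ω a := by
      rw [hs, ← Real.rpow_mul (abs_nonneg _), one_div_mul_cancel (hωpos a).ne', Real.rpow_one]
    have hall : dil α s⁻¹ z ∈ ⋂ b : Fin m ⊕ Fin n, {z : E m n | |coord b z| ≤ 1} := by
      refine Set.mem_iInter.2 fun b => ?_
      have hp : 0 < s ^ ω b := by positivity
      change |coord b (dil α s⁻¹ z)| ≤ 1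
      rw [hcd, abs_mul, abs_inv, abs_of_pos hp]
      exact (inv_mul_le_one₀ hp).2 (hle b)
    have habs : |coord a (dil α s⁻¹ z)| = 1 := by
      have hp : 0 < s ^ ω a := by positivity
      rw [hcd, abs_mul, abs_inv, abs_of_pos hp, hsa, inv_mul_cancel₀ hp.ne']
    have hproj : sphereProj α R (dil α s⁻¹ z) = z := by
      have e1 : R / gaugePow α (dil α s⁻¹ z) = s ^ (2*(α+1)) := by
        rw [gaugePow_dil (by positivity), hz, Real.inv_rpow hs0]
        have : 0 < s ^ (2*(α+1)) := by positivity
        field_simp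
      rw [sphereProj, e1, ← Real.rpow_mul hs0, mul_one_div_cancel (by positivity), Real.rpow_one,
        dil_dil hs0 (by positivity), mul_inv_cancel₀ hspos.ne', dil_one]
    refine Set.mem_iUnion.2 ⟨a, ?_⟩
    rcases (abs_eq zero_le_one).1 habs with h | h
    · exact Or.inl ⟨_, ⟨h, hall⟩, hproj⟩
    · exact Or.inr ⟨_, ⟨h, hall⟩, hproj⟩
  refine (measure_mono hsub).trans_lt ((measure_iUnion_fintype_le _ _).trans_lt ?_)
  refine ENNReal.sum_lt_top.2 fun a _ => (measure_union_le _ _).trans_lt (ENNReal.add_lt_top.2 ⟨?_, ?_⟩)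
  · exact hausdorffMeasure_sphereProj_image_lt_top hα hR hm a one_ne_zero
  · exact hausdorffMeasure_sphereProj_image_lt_top hα hR hm a (by norm_num)

end spheres

section trace

open scoped ENNReal

variable {m n : ℕ} {α : ℝ}

/-- Weighted Cauchy–Schwarz inequality for the generator of the dilations. -/
lemma wt_mul_dilation_derivative_sq_le (hα : 0 < α) (f : E m n → ℝ) {z : E m n} (hz : z.1 ≠ 0) :
    wt α z * (∑ i, z.1 i * fderiv ℝ f z (ex i) + (α+1) * ∑ j, z.2 j * fderiv ℝ f z (ey j)) ^ 2 ≤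
      gaugePow α z * gradXsq α f z := by
  have hw : 0 < wt α z := Real.rpow_pos_of_pos (norm_pos_iff.2 hz) _
  have h1 := Finset.sum_mul_sq_le_sq_mul_sq Finset.univ (fun i => z.1 i) fun i => fderiv ℝ f z (ex i)
  have h2 := Finset.sum_mul_sq_le_sq_mul_sq Finset.univ (fun j => z.2 j) fun j => fderiv ℝ f z (ey j)
  rw [sum_coord_x] at h1
  rw [sum_coord_y] at h2
  rw [gaugePow_eq hα, gradXsq_eq]
  set A := ∑ i, z.1 i * fderiv ℝ f z (ex i)
  set B := ∑ j, z.2 j * fderiv ℝ f z (ey j)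
  set a := ∑ i, fderiv ℝ f z (ex i) ^ 2
  set b := ∑ j, fderiv ℝ f z (ey j) ^ 2
  set w := wt α z
  have ha : 0 ≤ a := Finset.sum_nonneg fun _ _ => sq_nonneg _
  have hb : 0 ≤ b := Finset.sum_nonneg fun _ _ => sq_nonneg _
  have h3 : (2 * A * ((α+1) * B)) ≤ w * ‖z.1‖^2 * b + (α+1)^2*‖z.2‖^2 * a / w := by
    have h4 : |A| ≤ √(‖z.1‖^2 * a) := Real.abs_le_sqrt h1
    have h5 : |B| ≤ √(‖z.2‖^2 * b) := Real.abs_le_sqrt h2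
    have h6 : A * B ≤ √(‖z.1‖^2 * a) * √(‖z.2‖^2 * b) := by
      refine (le_abs_self _).trans ?_
      rw [abs_mul]
      exact mul_le_mul h4 h5 (abs_nonneg _) (Real.sqrt_nonneg _)
    have h7 : √(‖z.1‖^2 * a) * √(‖z.2‖^2 * b) = √(w * ‖z.1‖^2 * b) * √(‖z.2‖^2 * a / w) := by
      rw [← Real.sqrt_mul (by positivity), ← Real.sqrt_mul (by positivity)]
      congr 1
      field_simp
    have h8 := sq_nonneg (√(w * ‖z.1‖^2 * b) - (α+1) * √(‖z.2‖^2 * a / w))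
    have h9 := Real.sq_sqrt (show 0 ≤ w * ‖z.1‖^2 * b by positivity)
    have h10 := Real.sq_sqrt (show 0 ≤ ‖z.2‖^2 * a / w by positivity)
    rw [h7] at h6
    have h11 := mul_le_mul_of_nonneg_left h6 (show 0 ≤ 2 * (α+1) by positivity)
    have h12 : (α+1)^2*‖z.2‖^2 * a / w = (α+1)^2 * (‖z.2‖^2 * a / w) := by ring
    rw [h12]
    nlinarith
  have h4 := mul_le_mul_of_nonneg_left h3 hw.le
  have h5 : w * (w * ‖z.1‖^2 * b + (α+1)^2*‖z.2‖^2 * a / w) =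
      w * w * ‖z.1‖^2 * b + (α+1)^2*‖z.2‖^2 * a := by field_simp
  rw [h5] at h4
  have h6 := mul_le_mul_of_nonneg_left h1 hw.le
  have h7 := mul_le_mul_of_nonneg_left h2 (show 0 ≤ w * (α+1)^2 by positivity)
  nlinarith

lemma abs_wt_mul_fderiv_ey_le (hα : 0 < α) {f : E m n → ℝ} {M : ℝ} {z : E m n}
    (h : ∀ v, ‖z.1‖ * |fderiv ℝ f z v| ≤ M * (‖v.1‖ + ‖z.1‖ * ‖v.2‖)) (j : Fin n) :
    |wt α z * fderiv ℝ f z (ey j)| ≤ M * wt α z := by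
  rw [abs_mul, abs_of_nonneg (wt_nonneg z)]
  by_cases hx : z.1 = 0
  · have : wt α z = 0 := by simp [wt, hx, Real.zero_rpow (by linarith : 2*α ≠ 0)]
    simp [this]
  · have h1 := h (ey j)
    simp only [ey, PiLp.norm_single, norm_one, norm_zero, zero_add, mul_one] at h1
    have h2 : 0 < ‖z.1‖ := norm_pos_iff.2 hx
    rw [mul_comm M] at h1
    have := le_of_mul_le_mul_left h1 h2
    rw [mul_comm]
    exact mul_le_mul_of_nonneg_right this (wt_nonneg z)

theorem integral_cutoff_le (hα : 0 < α) (hm : 0 < m) {f : E m n → ℝ} (hf : IsAdmissible f)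
    {R : ℝ} (hG : IntegrableOn (gradXsq α f) {z | gaugePow α z < R})
    {χ χ' : ℝ → ℝ} (hχ : ∀ p, HasDerivAt χ (χ' p) p) (hχ' : Continuous χ')
    (h0 : ∀ p, R ≤ p → χ p = 0) (hn : ∀ p, 0 ≤ χ p) (h1 : ∀ p, χ p ≤ 1) :
    (m + (α+1)*n + 2*α - 1) * ∫ z, χ (gaugePow α z) * (f z ^ 2 * wt α z) ≤
      (∫ z, -χ' (gaugePow α z) * (2*(α+1) * gaugePow α z * (f z ^ 2 * wt α z))) +
      R * ∫ z in {z | gaugePow α z < R}, gradXsq α f z := by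
  have hfc := hf.continuous
  have hw := continuous_wt (m := m) (n := n) hα
  have hP := continuous_gaugePow (m := m) (n := n) hα
  have hχc : Continuous χ := continuous_iff_continuousAt.2 fun p => (hχ p).continuousAt
  have h0' : ∀ p, R < p → χ' p = 0 := fun p hp => by
    have : χ =ᶠ[nhds p] fun _ => 0 := by
      filter_upwards [lt_mem_nhds hp] with q hq using h0 q hq.le
    exact (hχ p).unique ((hasDerivAt_const p (0:ℝ)).congr_of_eventuallyEq this)
  obtain ⟨M, hM⟩ := hf.bound _ (isCompact_sublevel (m := m) (n := n) hα R)
  set Tx : Fin m → E m n → ℝ := fun i z =>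
    χ' (gaugePow α z) * dGaugePow α z (ex i) * f z ^ 2 * (wt α z * z.1 i)
      + 2 * χ (gaugePow α z) * f z * (wt α z * z.1 i * fderiv ℝ f z (ex i))
      + χ (gaugePow α z) * f z ^ 2 * (wt α z + 2*α * (‖z.1‖ ^ (2*α-2) * z.1 i ^ 2)) with hTx
  set Ty : Fin n → E m n → ℝ := fun j z =>
    χ' (gaugePow α z) * dGaugePow α z (ey j) * f z ^ 2 * (wt α z * z.2 j)
      + 2 * χ (gaugePow α z) * f z * (wt α z * z.2 j * fderiv ℝ f z (ey j))
      + χ (gaugePow α z) * f z ^ 2 * wt α z with hTy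
  have hwx : ∀ z : E m n, z.1 = 0 → wt α z = 0 := fun z hx => by
    simp [wt, hx, Real.zero_rpow (by linarith : 2*α ≠ 0)]
  have hTx0 : ∀ i, Integrable (Tx i) ∧ ∫ z, Tx i z = 0 := by
    intro i
    have hκ := continuous_kappa (m := m) (n := n) hα i
    have hD : Continuous fun z : E m n => dGaugePow α z (ex i) :=
      continuous_dGaugePow_coordVec hα (Sum.inl i)
    have hI : Integrable (Tx i) := by
      refine ((integrable_of_continuous_sublevel hα (R := R) (by fun_prop) fun z hz => ?_).add
        ?_).add (integrable_of_continuous_sublevel hα (R := R) (by fun_prop) fun z hz => ?_)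
      · rw [h0' _ hz]; ring
      · have := integrable_continuous_mul_bounded hα (R := R) (M := M)
          (c := fun z => 2 * χ (gaugePow α z) * f z * wt α z)
          (F := fun z => z.1 i * fderiv ℝ f z (ex i)) (by fun_prop)
          (fun z hz => by rw [h0 _ hz.le]; ring)
          (Measurable.mul (by fun_prop) (measurable_fderiv_apply_const ℝ f _)) fun z hz =>
            abs_mul_fderiv_ex_le (hM z hz) i
        refine this.congr (Filter.Eventually.of_forall fun z => ?_)
        ring
      · rw [h0 _ hz.le]; ring
    refine ⟨hI, integral_lineDeriv_eq_zero
      (V := fun z => χ (gaugePow α z) * f z ^ 2 * (wt α z * z.1 i)) ?_ hI fun z =>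
      hf.hasLineDerivAt (hasLineDerivAt_gaugePow_comp hα (fun p _ => hχ p) z _)
        (hasLineDerivAt_wt_mul hα z i) (fun hx => by simp [hx])⟩
    refine integrable_of_continuous_sublevel hα (R := R) (by fun_prop) fun z hz => ?_
    rw [h0 _ hz.le]; ring
  have hTy0 : ∀ j, Integrable (Ty j) ∧ ∫ z, Ty j z = 0 := by
    intro j
    have hD : Continuous fun z : E m n => dGaugePow α z (ey j) :=
      continuous_dGaugePow_coordVec hα (Sum.inr j)
    have hI : Integrable (Ty j) := by
      refine ((integrable_of_continuous_sublevel hα (R := R) (by fun_prop) fun z hz => ?_).add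
        ?_).add (integrable_of_continuous_sublevel hα (R := R) (by fun_prop) fun z hz => ?_)
      · rw [h0' _ hz]; ring
      · obtain ⟨W, hW⟩ := (isCompact_sublevel (m := m) (n := n) hα R).exists_bound_of_continuousOn
          hw.continuousOn
        have := integrable_continuous_mul_bounded hα (R := R) (M := |M| * W)
          (c := fun z => 2 * χ (gaugePow α z) * f z * z.2 j)
          (F := fun z => wt α z * fderiv ℝ f z (ey j)) (by fun_prop)
          (fun z hz => by rw [h0 _ hz.le]; ring)
          (Measurable.mul (by fun_prop) (measurable_fderiv_apply_const ℝ f _)) fun z hz =>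
            (abs_wt_mul_fderiv_ey_le hα (fun v => (hM z hz v).trans
              (mul_le_mul_of_nonneg_right (le_abs_self M) (by positivity))) j).trans
              (mul_le_mul_of_nonneg_left ((le_abs_self _).trans (hW z hz)) (abs_nonneg _))
        refine this.congr (Filter.Eventually.of_forall fun z => ?_)
        ring
      · rw [h0 _ hz.le]; ring
    refine ⟨hI, integral_lineDeriv_eq_zero
      (V := fun z => χ (gaugePow α z) * f z ^ 2 * (wt α z * z.2 j)) ?_ hI fun z =>
      hf.hasLineDerivAt (hasLineDerivAt_gaugePow_comp hα (fun p _ => hχ p) z _)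
        ?_ (fun hx => by simp [hwx z hx])⟩
    · refine integrable_of_continuous_sublevel hα (R := R) (by fun_prop) fun z hz => ?_
      rw [h0 _ hz.le]; ring
    · have h2 : HasDerivAt (fun t : ℝ => (z + t • (ey j : E m n)).2 j) 1 0 := by
        simpa [ey] using (hasDerivAt_id (0:ℝ)).const_add (z.2 j)
      unfold HasLineDerivAt
      simp only [wt_add_smul_ey]
      simpa using h2.const_mul (wt α z)
  have hsum : ∫ z, (∑ i, Tx i z + (α+1) * ∑ j, Ty j z) = 0 := by
    rw [integral_add (integrable_finsetSum _ fun i _ => (hTx0 i).1)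
      ((integrable_finsetSum _ fun j _ => (hTy0 j).1).const_mul _), integral_const_mul,
      integral_finsetSum _ fun i _ => (hTx0 i).1, integral_finsetSum _ fun j _ => (hTy0 j).1]
    simp [hTx0, hTy0]
  have hI1 : Integrable fun z : E m n => χ (gaugePow α z) * (f z ^ 2 * wt α z) :=
    integrable_of_continuous_sublevel hα (R := R) (by fun_prop) fun z hz => by
      rw [h0 _ hz.le]; ring
  have hI2 : Integrable fun z : E m n =>
      -χ' (gaugePow α z) * (2*(α+1) * gaugePow α z * (f z ^ 2 * wt α z)) :=
    integrable_of_continuous_sublevel hα (R := R) (by fun_prop) fun z hz => by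
      rw [h0' _ hz]; ring
  have hms : MeasurableSet {z : E m n | gaugePow α z < R} := measurableSet_lt hP.measurable
    measurable_const
  have hI3 := hG.integrable_indicator hms
  have hS : Integrable fun z => ∑ i, Tx i z + (α+1) * ∑ j, Ty j z :=
    (integrable_finsetSum _ fun i _ => (hTx0 i).1).add
      ((integrable_finsetSum _ fun j _ => (hTy0 j).1).const_mul _)
  have hSz : ∀ z, ∑ i, Tx i z + (α+1) * ∑ j, Ty j z =
      χ' (gaugePow α z) * (2*(α+1) * gaugePow α z * (f z ^ 2 * wt α z))
      + (m + (α+1)*n + 2*α) * (χ (gaugePow α z) * (f z ^ 2 * wt α z))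
      + χ (gaugePow α z) * (2 * f z * wt α z * (∑ i, z.1 i * fderiv ℝ f z (ex i)
        + (α+1) * ∑ j, z.2 j * fderiv ℝ f z (ey j))) := by
    intro z
    have e1 : ∑ i, Tx i z = (χ' (gaugePow α z) * (2*(α+1)) * wt α z ^ 2 * f z ^ 2) * ‖z.1‖^2
        + (2 * χ (gaugePow α z) * f z * wt α z) * (∑ i, z.1 i * fderiv ℝ f z (ex i))
        + m * (χ (gaugePow α z) * f z ^ 2 * wt α z)
        + (χ (gaugePow α z) * f z ^ 2 * (2*α) * ‖z.1‖ ^ (2*α-2)) * ‖z.1‖ ^ 2 := by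
      rw [← sum_coord_x z, Finset.mul_sum, Finset.mul_sum, Finset.mul_sum,
        show (m:ℝ) * (χ (gaugePow α z) * f z ^ 2 * wt α z) =
          ∑ i : Fin m, (χ (gaugePow α z) * f z ^ 2 * wt α z) by simp,
        ← Finset.sum_add_distrib, ← Finset.sum_add_distrib, ← Finset.sum_add_distrib]
      refine Finset.sum_congr rfl fun i _ => ?_
      simp only [hTx, dGaugePow_ex]
      ring
    have e2 : ∑ j, Ty j z = (χ' (gaugePow α z) * (2*(α+1)^2) * wt α z * f z ^ 2) * ‖z.2‖^2
        + (2 * χ (gaugePow α z) * f z * wt α z) * (∑ j, z.2 j * fderiv ℝ f z (ey j))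
        + n * (χ (gaugePow α z) * f z ^ 2 * wt α z) := by
      rw [← sum_coord_y z, Finset.mul_sum, Finset.mul_sum,
        show (n:ℝ) * (χ (gaugePow α z) * f z ^ 2 * wt α z) =
          ∑ i : Fin n, (χ (gaugePow α z) * f z ^ 2 * wt α z) by simp,
        ← Finset.sum_add_distrib, ← Finset.sum_add_distrib]
      refine Finset.sum_congr rfl fun i _ => ?_
      simp only [hTy, dGaugePow_ey]
      ring
    rw [mul_assoc _ (‖z.1‖ ^ (2*α-2)), norm_rpow_mul_sq_le hα] at e1
    rw [e1, e2, gaugePow_eq hα]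
    ring
  have hI23 : Integrable fun z : E m n =>
      -χ' (gaugePow α z) * (2*(α+1) * gaugePow α z * (f z ^ 2 * wt α z)) +
        R * {z | gaugePow α z < R}.indicator (gradXsq α f) z := hI2.add (hI3.const_mul _)
  have key : ∫ z, (m + (α+1)*n + 2*α - 1) * (χ (gaugePow α z) * (f z ^ 2 * wt α z)) ≤
      ∫ z, ((-χ' (gaugePow α z) * (2*(α+1) * gaugePow α z * (f z ^ 2 * wt α z)) +
        R * {z | gaugePow α z < R}.indicator (gradXsq α f) z) +
        (∑ i, Tx i z + (α+1) * ∑ j, Ty j z)) := by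
    refine integral_mono_ae (hI1.const_mul _) (hI23.add hS) ?_
    filter_upwards [ae_x_ne_zero hm] with z hz
    simp only [hSz]
    have hcs := wt_mul_dilation_derivative_sq_le hα f hz
    set Z := ∑ i, z.1 i * fderiv ℝ f z (ex i) + (α+1) * ∑ j, z.2 j * fderiv ℝ f z (ey j)
    have h2 : -(f z ^ 2 * wt α z) - gaugePow α z * gradXsq α f z ≤ 2 * f z * wt α z * Z := by
      nlinarith [mul_nonneg (wt_nonneg (α := α) z) (sq_nonneg (f z + Z))]
    have h3 := mul_le_mul_of_nonneg_left h2 (hn (gaugePow α z))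
    have h4 : χ (gaugePow α z) * (gaugePow α z * gradXsq α f z) ≤
        R * {z | gaugePow α z < R}.indicator (gradXsq α f) z := by
      by_cases hz' : gaugePow α z < R
      · rw [Set.indicator_of_mem (by exact hz')]
        have hg := gradXsq_nonneg (α := α) f z
        have hp := gaugePow_nonneg (α := α) z
        calc _ ≤ 1 * (gaugePow α z * gradXsq α f z) :=
              mul_le_mul_of_nonneg_right (h1 _) (by positivity)
          _ ≤ _ := by rw [one_mul]; gcongr
      · rw [Set.indicator_of_notMem (by exact hz'), h0 _ (not_lt.1 hz')]
        simp
    nlinarith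
  rw [integral_add hI23 hS, integral_add hI2 (hI3.const_mul _), hsum,
    integral_const_mul, integral_const_mul, integral_indicator hms, add_zero] at key
  exact key

end trace

section level

open Filter Topology
open scoped ENNReal

variable {m n : ℕ} {α : ℝ}

lemma ne_zero_of_gaugePow_pos (hα : 0 < α) {z : E m n} (h : 0 < gaugePow α z) : z ≠ 0 := by
  rintro rfl
  rw [gaugePow_eq hα] at h
  simp at h

lemma isCompact_level (hα : 0 < α) (R : ℝ) : IsCompact {z : E m n | gaugePow α z = R} :=
  (isCompact_sublevel hα R).of_isClosed_subset
    (isClosed_eq (continuous_gaugePow hα) continuous_const) fun _ h => le_of_eq h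

lemma integrableOn_level (hα : 0 < α) (hm : 0 < m) {R : ℝ} (hR : 0 < R) {F : E m n → ℝ}
    (hF : Continuous F) :
    IntegrableOn (fun z => F z / √(gradGaugePowSq α z)) {z | gaugePow α z = R}
      μH[(m + n - 1 : ℝ)] := by
  have hc : ContinuousOn (fun z => F z / √(gradGaugePowSq α z)) {z : E m n | gaugePow α z = R} :=
    hF.continuousOn.div (continuous_gradGaugePowSq hα).sqrt.continuousOn fun z hz =>
      (Real.sqrt_pos.2 (gradGaugePowSq_pos hα (ne_zero_of_gaugePow_pos hα (by
        rw [show gaugePow α z = R from hz]; exact hR)))).ne'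
  obtain ⟨M, hM⟩ := (isCompact_level hα R).exists_bound_of_continuousOn hc
  refine Measure.integrableOn_of_bounded (hausdorffMeasure_level_lt_top hα hR hm).ne
    ((hF.measurable.div (continuous_gradGaugePowSq hα).sqrt.measurable).aestronglyMeasurable)
    (M := M) ?_
  exact (ae_restrict_mem (isCompact_level hα R).measurableSet).mono hM

lemma integral_layer_le (hα : 0 < α) (hm : 0 < m) {R : ℝ} (hR : 0 < R) {F : E m n → ℝ}
    (hF : Continuous F) (hF0 : ∀ z, 0 ≤ F z) {ε : ℝ} (hε : 0 < ε) :
    ∀ᶠ a in 𝓝[<] R, ∀ χ χ' : ℝ → ℝ, (∀ p, HasDerivAt χ (χ' p) p) → Continuous χ' →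
      (∀ p, χ' p ≤ 0) → (∀ p, p ≤ a → χ' p = 0) → (∀ p, R ≤ p → χ' p = 0) →
      (∀ p, 0 ≤ χ p) → (∀ p, χ p ≤ 1) →
      ∫ z, -χ' (gaugePow α z) * (2*(α+1) * gaugePow α z * F z) ≤
        2 * (m + n) * (2 * (α+1) * R) *
          ((∫ z in {z | gaugePow α z = R}, F z / √(gradGaugePowSq α z) ∂μH[(m + n - 1 : ℝ)]) +
            ε * (μH[(m + n - 1 : ℝ)] {z : E m n | gaugePow α z = R}).toReal) := by
  have hP := continuous_gaugePow (m := m) (n := n) hα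
  have hN := continuous_gradGaugePowSq (m := m) (n := n) hα
  set S := {z : E m n | gaugePow α z = R} with hS
  set h : E m n → ℝ := fun z => F z / √(gradGaugePowSq α z) with hh
  have hhm : Measurable h := hF.measurable.div hN.sqrt.measurable
  have hh0 : ∀ z, 0 ≤ h z := fun z => div_nonneg (hF0 z) (Real.sqrt_nonneg _)
  have hS0 : ∀ z ∈ S, z ≠ 0 := fun z hz => ne_zero_of_gaugePow_pos hα (by
    rw [show gaugePow α z = R from hz]; exact hR)
  have hhc : ∀ z : E m n, z ≠ 0 → ContinuousAt h z := fun z hz =>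
    hF.continuousAt.div hN.sqrt.continuousAt (Real.sqrt_pos.2 (gradGaugePowSq_pos hα hz)).ne'
  have hnear : ∀ᶠ p in 𝓝 R, ∀ z ∈ S, h (dil α ((p/R) ^ (1/(2*(α+1)))) z) < h z + ε := by
    refine (isCompact_level hα R).eventually_forall_of_forall_eventually
      (P := fun p z => h (dil α ((p/R) ^ (1/(2*(α+1)))) z) < h z + ε) fun z hz => ?_
    have h1 : ContinuousAt (fun q : ℝ × E m n => dil α ((q.1/R) ^ (1/(2*(α+1)))) q.2) (R, z) := by
      refine (continuous_dil hα).continuousAt.comp (f := fun q : ℝ × E m n =>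
        ((q.1/R) ^ (1/(2*(α+1))), q.2)) ?_
      refine ContinuousAt.prodMk ?_ continuousAt_snd
      exact (continuousAt_fst.div_const R).rpow_const (Or.inl (by simp [hR.ne']))
    have hd : dil α ((R/R) ^ (1/(2*(α+1)))) z = z := by
      rw [div_self hR.ne', Real.one_rpow, dil_one]
    have h2 : ContinuousAt (fun q : ℝ × E m n => h (dil α ((q.1/R) ^ (1/(2*(α+1)))) q.2)) (R, z) :=
      ContinuousAt.comp (g := h) (by simpa only [hd] using hhc z (hS0 z hz)) h1
    have h3 : ContinuousAt (fun q : ℝ × E m n => h q.2 + ε) (R, z) :=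
      (ContinuousAt.comp (g := h) (f := Prod.snd) (x := (R, z)) (hhc z (hS0 z hz))
        continuousAt_snd).add continuousAt_const
    refine h2.eventually_lt h3 ?_
    simp only [hd]
    linarith
  obtain ⟨l, hl, hlR⟩ := (mem_nhds_iff_exists_Ioo_subset.1 hnear)
  have hmem : ∀ᶠ a in 𝓝[<] R, l < a ∧ 0 < a ∧ a < R := by
    filter_upwards [eventually_nhdsWithin_of_eventually_nhds (lt_mem_nhds hlR.1.1),
      eventually_nhdsWithin_of_eventually_nhds (lt_mem_nhds hR), self_mem_nhdsWithin] with a h1 h2 h3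
    exact ⟨h1, h2, h3⟩
  filter_upwards [hmem] with a ⟨hla, ha0, haR⟩ χ χ' hχ hχc hneg hza hzR hχ0 hχ1
  set J := ∫ z in S, h z ∂μH[(m + n - 1 : ℝ)] with hJ
  set M := (μH[(m + n - 1 : ℝ)] S).toReal with hM
  have hJ0 : 0 ≤ J := integral_nonneg hh0
  set G : E m n → ℝ≥0∞ := fun z =>
    ENNReal.ofReal (-χ' (gaugePow α z) * (2*(α+1) * gaugePow α z * F z)) with hG
  have hGm : Measurable G := by
    refine Measurable.ennreal_ofReal ?_
    exact Continuous.measurable (by fun_prop)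
  have hlev : ∀ s, 0 < s → s ≤ R → l < s →
      ∫⁻ z in {z | gaugePow α z = s}, ENNReal.ofReal (h z) ∂μH[(m + n - 1 : ℝ)] ≤
        ENNReal.ofReal (J + ε * M) := by
    intro s hs hsR hls
    have hq : 0 < s / R := div_pos hs hR
    have e1 : s = ((s/R) ^ (1/(2*(α+1)))) ^ (2*(α+1)) * R := by
      rw [← Real.rpow_mul hq.le, one_div_mul_cancel (by positivity), Real.rpow_one]
      field_simp
    have hd : (0:ℝ) ≤ m + n - 1 := by
      have : (1:ℝ) ≤ m := by exact_mod_cast hm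
      have : (0:ℝ) ≤ n := by positivity
      linarith
    have h1 := lintegral_level_le (m := m) (n := n) hα (s := (s/R) ^ (1/(2*(α+1))))
      (Real.rpow_pos_of_pos hq _)
      (Real.rpow_le_one hq.le ((div_le_one hR).2 hsR) (by positivity)) R hd hhm.ennreal_ofReal
    rw [← e1] at h1
    refine h1.trans ?_
    have hSm : MeasurableSet S := (isCompact_level hα R).measurableSet
    calc _ ≤ ∫⁻ z in S, (ENNReal.ofReal (h z) + ENNReal.ofReal ε) ∂μH[(m + n - 1 : ℝ)] := by
          refine setLIntegral_mono (hhm.ennreal_ofReal.add_const _) fun z hz => ?_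
          rw [← ENNReal.ofReal_add (hh0 z) hε.le]
          exact ENNReal.ofReal_le_ofReal (hlR.2 (show s ∈ Set.Ioo _ _ from
            ⟨hls, hsR.trans_lt hlR.1.2⟩) z hz).le
      _ = ENNReal.ofReal (J + ε * M) := by
          rw [lintegral_add_right _ measurable_const, setLIntegral_const,
            ENNReal.ofReal_add hJ0 (by positivity), hJ,
            ofReal_integral_eq_lintegral_ofReal (integrableOn_level hα hm hR hF)
              (ae_of_all _ hh0), ENNReal.ofReal_mul hε.le, hM,
            ENNReal.ofReal_toReal (hausdorffMeasure_level_lt_top hα hR hm).ne]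
  have hpt : ∀ s, ∫⁻ z in {z | gaugePow α z = s}, G z / ENNReal.ofReal √(gradGaugePowSq α z)
      ∂μH[(m + n - 1 : ℝ)] ≤ ENNReal.ofReal (2*(α+1)*R * (J + ε * M)) *
        (Set.Icc a R).indicator (fun s => ENNReal.ofReal (-χ' s)) s := by
    intro s
    have hLm : MeasurableSet {z : E m n | gaugePow α z = s} := (isCompact_level hα s).measurableSet
    by_cases hs : s ∈ Set.Icc a R
    · have hs0 : 0 < s := ha0.trans_le hs.1
      have h0' : 0 ≤ -χ' s := by linarith [hneg s]
      rw [Set.indicator_of_mem hs]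
      calc _ = ∫⁻ z in {z | gaugePow α z = s}, ENNReal.ofReal (-χ' s * (2*(α+1)*s)) *
            ENNReal.ofReal (h z) ∂μH[(m + n - 1 : ℝ)] := by
            refine setLIntegral_congr_fun hLm fun z hz => ?_
            have hz' : gaugePow α z = s := hz
            have hpos := Real.sqrt_pos.2 (gradGaugePowSq_pos hα
              (ne_zero_of_gaugePow_pos hα (by rw [hz']; exact hs0) : z ≠ 0))
            simp only [hG, hh]
            rw [← ENNReal.ofReal_div_of_pos hpos, ← ENNReal.ofReal_mul (by positivity), hz']
            congr 1
            ring
        _ = ENNReal.ofReal (-χ' s * (2*(α+1)*s)) *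
            ∫⁻ z in {z | gaugePow α z = s}, ENNReal.ofReal (h z) ∂μH[(m + n - 1 : ℝ)] :=
            lintegral_const_mul _ hhm.ennreal_ofReal
        _ ≤ ENNReal.ofReal (-χ' s * (2*(α+1)*R)) * ENNReal.ofReal (J + ε * M) := by
            gcongr
            · exact hs.2
            · exact hlev s hs0 hs.2 (hla.trans_le hs.1)
        _ = _ := by
            rw [← ENNReal.ofReal_mul (by positivity), ← ENNReal.ofReal_mul (by positivity)]
            congr 1
            ring
    · have hz : χ' s = 0 := by
        by_cases h1 : s ≤ a
        · exact hza s h1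
        · exact hzR s (by by_contra h2; exact hs ⟨(not_le.1 h1).le, (not_le.1 h2).le⟩)
      rw [Set.indicator_of_notMem hs, mul_zero, nonpos_iff_eq_zero, ← lintegral_zero]
      refine setLIntegral_congr_fun hLm fun z hz' => ?_
      simp only [hG]
      rw [show gaugePow α z = s from hz', hz]
      simp
  have hFTC : ∫⁻ s, (Set.Icc a R).indicator (fun s => ENNReal.ofReal (-χ' s)) s ≤ 1 := by
    rw [lintegral_indicator measurableSet_Icc]
    have hi : IntegrableOn (fun s => -χ' s) (Set.Icc a R) :=
      hχc.neg.continuousOn.integrableOn_compact isCompact_Icc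
    rw [← ofReal_integral_eq_lintegral_ofReal hi
      (ae_of_all _ fun s => by simpa using hneg s), integral_Icc_eq_integral_Ioc,
      ← intervalIntegral.integral_of_le haR.le,
      intervalIntegral.integral_eq_sub_of_hasDerivAt (f := fun s => -χ s)
        (fun s _ => (hχ s).neg) (hχc.neg.intervalIntegrable _ _)]
    rw [← ENNReal.ofReal_one]
    exact ENNReal.ofReal_le_ofReal (by linarith [hχ0 R, hχ1 a])
  have hle := lintegral_le_lintegral_level hα hm hGm
  have h2 : ∫⁻ z, G z ≤ ENNReal.ofReal (2 * (m + n) * (2 * (α+1) * R) * (J + ε * M)) := by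
    calc _ ≤ _ := hle
      _ ≤ 2 * (m + n) * ∫⁻ s, ENNReal.ofReal (2*(α+1)*R * (J + ε * M)) *
        (Set.Icc a R).indicator (fun s => ENNReal.ofReal (-χ' s)) s := by
          gcongr with s; exact hpt s
      _ ≤ 2 * (m + n) * (ENNReal.ofReal (2*(α+1)*R * (J + ε * M)) * 1) := by
          have hmi : Measurable ((Set.Icc a R).indicator fun s => ENNReal.ofReal (-χ' s)) :=
            (hχc.measurable.neg.ennreal_ofReal).indicator measurableSet_Icc
          rw [lintegral_const_mul _ hmi]
          gcongr
      _ = _ := by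
          rw [mul_one, show 2 * (m + n : ℝ) * (2 * (α+1) * R) * (J + ε * M) =
            ((2 * (m + n) : ℕ) : ℝ) * (2 * (α+1) * R * (J + ε * M)) by push_cast; ring,
            ENNReal.ofReal_mul (p := ((2 * (m + n) : ℕ) : ℝ)) (by positivity),
            ENNReal.ofReal_natCast]
          push_cast
          rfl
  have hGn : ∀ z : E m n, 0 ≤ -χ' (gaugePow α z) * (2*(α+1) * gaugePow α z * F z) := fun z =>
    mul_nonneg (by linarith [hneg (gaugePow α z)])
      (mul_nonneg (mul_nonneg (by positivity) (gaugePow_nonneg z)) (hF0 z))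
  rw [integral_eq_lintegral_of_nonneg_ae (ae_of_all _ hGn)
    (Continuous.aestronglyMeasurable (by fun_prop))]
  exact ENNReal.toReal_le_of_le_ofReal (by positivity) h2

/-- Trace inequality: the weighted `L²` norm on a sublevel set of the gauge is controlled by the
one on the bounding level set and the Grushin gradient. -/
theorem trace_inequality (hα : 0 < α) (hm : 0 < m) {f : E m n → ℝ} (hf : IsAdmissible f) {R : ℝ}
    (hR : 0 < R) (hG : IntegrableOn (gradXsq α f) {z | gaugePow α z < R}) :
    (m + (α+1)*n + 2*α - 1) * ∫ z in {z | gaugePow α z < R}, f z ^ 2 * wt α z ≤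
      2 * (m + n) * (2 * (α+1) * R) * (∫ z in {z | gaugePow α z = R},
        f z ^ 2 * wt α z / √(gradGaugePowSq α z) ∂μH[(m + n - 1 : ℝ)]) +
      R * ∫ z in {z | gaugePow α z < R}, gradXsq α f z := by
  have hP := continuous_gaugePow (m := m) (n := n) hα
  have hF : Continuous fun z => f z ^ 2 * wt α z := (hf.continuous.pow 2).mul (continuous_wt hα)
  have hF0 : ∀ z, 0 ≤ f z ^ 2 * wt α z := fun z => mul_nonneg (sq_nonneg _) (wt_nonneg z)
  set s := Real.smoothTransition with hs
  set χ : ℕ → ℝ → ℝ := fun k p => s ((1 - p / R) * (k + 1)) with hχ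
  set χ' : ℕ → ℝ → ℝ := fun k p => deriv s ((1 - p / R) * (k + 1)) * (-(1 / R) * (k + 1)) with hχ'
  have hsd : ∀ x, HasDerivAt s (deriv s x) x := fun x =>
    ((Real.smoothTransition.contDiff (n := 1)).differentiable (by norm_num) x).hasDerivAt
  have hd : ∀ k p, HasDerivAt (χ k) (χ' k p) p := fun k p => by
    have h1 : HasDerivAt (fun p : ℝ => (1 - p / R) * ((k:ℝ) + 1)) (-(1 / R) * (k + 1)) p :=
      (((hasDerivAt_id p).div_const R).const_sub 1).mul_const _
    exact (hsd _).comp p h1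
  have hdc : ∀ k, Continuous (χ' k) := fun k => by
    have h1 : Continuous (deriv s) :=
      (Real.smoothTransition.contDiff (n := 1)).continuous_deriv (by norm_num)
    exact (h1.comp (by fun_prop)).mul continuous_const
  have hsn : ∀ x, 0 ≤ deriv s x := fun x => Real.smoothTransition.monotone.deriv_nonneg
  have hlo : ∀ x, x ≤ 0 → deriv s x = 0 := fun x hx => IsLocalMin.deriv_eq_zero
    (Eventually.of_forall fun y => by
      rw [hs, Real.smoothTransition.zero_of_nonpos hx]; exact Real.smoothTransition.nonneg y)
  have hhi : ∀ x, 1 ≤ x → deriv s x = 0 := fun x hx => IsLocalMax.deriv_eq_zero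
    (Eventually.of_forall fun y => by
      rw [hs, Real.smoothTransition.one_of_one_le hx]; exact Real.smoothTransition.le_one y)
  have hR' : ∀ (k : ℕ) p, R ≤ p → (1 - p / R) * ((k:ℝ) + 1) ≤ 0 := fun k p hp =>
    mul_nonpos_of_nonpos_of_nonneg (by rw [sub_nonpos, one_le_div hR]; exact hp) (by positivity)
  have hχ0 : ∀ k p, 0 ≤ χ k p := fun k p => Real.smoothTransition.nonneg _
  have hχ1 : ∀ k p, χ k p ≤ 1 := fun k p => Real.smoothTransition.le_one _
  have hχR : ∀ k p, R ≤ p → χ k p = 0 := fun k p hp =>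
    Real.smoothTransition.zero_of_nonpos (hR' k p hp)
  have hms : MeasurableSet {z : E m n | gaugePow α z < R} := measurableSet_lt hP.measurable
    measurable_const
  have hFi : IntegrableOn (fun z => f z ^ 2 * wt α z) {z : E m n | gaugePow α z < R} :=
    (hF.continuousOn.integrableOn_compact (isCompact_sublevel hα R)).mono_set fun z hz =>
      (show gaugePow α z < R from hz).le
  have hlim : Tendsto (fun k => ∫ z, χ k (gaugePow α z) * (f z ^ 2 * wt α z)) atTop
      (𝓝 (∫ z in {z | gaugePow α z < R}, f z ^ 2 * wt α z)) := by
    rw [← integral_indicator hms]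
    refine tendsto_integral_of_dominated_convergence
      ({z : E m n | gaugePow α z < R}.indicator fun z => f z ^ 2 * wt α z)
      (fun k => Continuous.aestronglyMeasurable ?_) (hFi.integrable_indicator hms)
      (fun k => ae_of_all _ fun z => ?_) (ae_of_all _ fun z => ?_)
    · exact ((continuous_iff_continuousAt.2 fun p => (hd k p).continuousAt).comp hP).mul hF
    · by_cases hz : gaugePow α z < R
      · rw [Set.indicator_of_mem (by exact hz), Real.norm_of_nonneg (mul_nonneg (hχ0 _ _) (hF0 z))]
        exact mul_le_of_le_one_left (hF0 z) (hχ1 _ _)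
      · rw [Set.indicator_of_notMem (by exact hz), hχR _ _ (not_lt.1 hz)]
        simp
    · by_cases hz : gaugePow α z < R
      · rw [Set.indicator_of_mem (by exact hz)]
        refine tendsto_const_nhds.congr' ?_
        have h1 : 0 < 1 - gaugePow α z / R := by rw [sub_pos, div_lt_one hR]; exact hz
        obtain ⟨K, hK⟩ := exists_nat_gt (1 / (1 - gaugePow α z / R))
        filter_upwards [eventually_ge_atTop K] with k hk
        have h2 : 1 ≤ (1 - gaugePow α z / R) * ((k:ℝ) + 1) := by
          have : (K:ℝ) ≤ k := by exact_mod_cast hk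
          rw [div_lt_iff₀ h1] at hK
          nlinarith
        simp only [hχ, hs, Real.smoothTransition.one_of_one_le h2, one_mul]
      · rw [Set.indicator_of_notMem (by exact hz)]
        simp only [hχR _ _ (not_lt.1 hz), zero_mul]
        exact tendsto_const_nhds
  have hseq : Tendsto (fun k : ℕ => R * (1 - 1 / ((k:ℝ) + 1))) atTop (𝓝[<] R) := by
    refine tendsto_nhdsWithin_iff.2 ⟨?_, Eventually.of_forall fun k => ?_⟩
    · simpa using (tendsto_one_div_add_atTop_nhds_zero_nat (𝕜 := ℝ)).const_sub 1 |>.const_mul R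
    · have : 0 < 1 / ((k:ℝ) + 1) := by positivity
      simp only [Set.mem_Iio]
      nlinarith
  set M := (μH[(m + n - 1 : ℝ)] {z : E m n | gaugePow α z = R}).toReal
  set J := ∫ z in {z | gaugePow α z = R}, f z ^ 2 * wt α z / √(gradGaugePowSq α z)
    ∂μH[(m + n - 1 : ℝ)]
  set c := 2 * (m + n : ℝ) * (2 * (α+1) * R) with hc
  have hε : ∀ ε > 0, (m + (α+1)*n + 2*α - 1) * ∫ z in {z | gaugePow α z < R}, f z ^ 2 * wt α z ≤
      c * (J + ε * M) + R * ∫ z in {z | gaugePow α z < R}, gradXsq α f z := by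
    intro ε hε
    refine le_of_tendsto (hlim.const_mul _) ?_
    filter_upwards [hseq.eventually (integral_layer_le hα hm hR hF hF0 hε)] with k hk
    refine (integral_cutoff_le hα hm hf hG (hd k) (hdc k) (hχR k) (hχ0 k) (hχ1 k)).trans ?_
    gcongr
    refine hk (χ k) (χ' k) (hd k) (hdc k) (fun p => ?_) (fun p hp => ?_) (fun p hp => ?_)
      (hχ0 k) (hχ1 k)
    · refine mul_nonpos_of_nonneg_of_nonpos (hsn _) ?_
      have : 0 < 1 / R * ((k:ℝ) + 1) := by positivity
      linarith
    · simp only [hχ']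
      rw [hhi, zero_mul]
      have h1 : p / R ≤ 1 - 1 / ((k:ℝ) + 1) := by rw [div_le_iff₀ hR]; linarith
      have h2 : 1 / ((k:ℝ) + 1) ≤ 1 - p / R := by linarith
      rwa [div_le_iff₀ (by positivity)] at h2
    · simp only [hχ']
      rw [hlo _ (hR' k p hp), zero_mul]
  have hlim2 : Tendsto (fun ε : ℝ => c * (J + ε * M) +
      R * ∫ z in {z | gaugePow α z < R}, gradXsq α f z) (𝓝[>] 0)
      (𝓝 (c * J + R * ∫ z in {z | gaugePow α z < R}, gradXsq α f z)) := by
    refine Tendsto.mono_left ?_ nhdsWithin_le_nhds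
    have : Continuous fun ε : ℝ => c * (J + ε * M) +
      R * ∫ z in {z | gaugePow α z < R}, gradXsq α f z := by fun_prop
    simpa using this.tendsto 0
  exact ge_of_tendsto hlim2 (eventually_mem_nhdsWithin.mono hε)

end level

section hardy_gradient

open Filter Topology

variable {m n : ℕ} {α : ℝ}

lemma lapX_isAdmissible (hα : 0 < α) {u : E m n → ℝ} (hu : ContDiff ℝ 3 u) :
    IsAdmissible (lapX α u) := by
  have h1 : ∀ v : E m n, ContDiff ℝ 2 fun z => fderiv ℝ u z v := fun v =>
    (hu.fderiv_right (m := 2) (by norm_num)).clm_apply contDiff_const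
  have h2 : ∀ v : E m n, ContDiff ℝ 1 fun z => fderiv ℝ (fun w => fderiv ℝ u w v) z v :=
    fun v => contDiff_fderiv_apply (h1 v) v
  exact isAdmissible_add_wt_mul hα (ContDiff.sum fun i _ => h2 _) (ContDiff.sum fun j _ => h2 _)

lemma normGradRho_eq (hα : 0 < α) {z : E m n} (hz : 0 < gaugePow α z) :
    normGradRho α z = 1/(2*(α+1)) * gaugePow α z ^ (1/(2*(α+1)) - 1) * √(gradGaugePowSq α z) := by
  have hd : HasFDerivAt (rho α) ((1/(2*(α+1)) * gaugePow α z ^ (1/(2*(α+1)) - 1)) • dGaugePow α z) z :=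
    (hasFDerivAt_gaugePow hα z).rpow_const (Or.inl hz.ne')
  have hc : 0 ≤ 1/(2*(α+1)) * gaugePow α z ^ (1/(2*(α+1)) - 1) := by positivity
  unfold normGradRho gradGaugePowSq
  rw [hd.fderiv, Fintype.sum_sum_type]
  simp only [_root_.smul_apply, smul_eq_mul, mul_pow _ (dGaugePow _ _ _), ← Finset.mul_sum, ← mul_add]
  rw [Real.sqrt_mul (by positivity), Real.sqrt_sq hc]
  rfl

lemma level_integrand_eq (hα : 0 < α) {r : ℝ} (hr : 0 < r) (f : E m n → ℝ) {z : E m n}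
    (hz : gaugePow α z = r ^ (2*(α+1))) :
    f z ^ 2 * wt α z / √(gradGaugePowSq α z) =
      (2*(α+1))⁻¹ * r⁻¹ * (f z ^ 2 * psi α z / normGradRho α z) := by
  have hp : 0 < gaugePow α z := by rw [hz]; positivity
  have hpos := Real.sqrt_pos.2 (gradGaugePowSq_pos hα (ne_zero_of_gaugePow_pos hα hp))
  have hrho : rho α z = r := (rho_eq_iff hα hr z).2 hz
  have e : gaugePow α z ^ (1/(2*(α+1)) - 1) = (r ^ (2*α) * r)⁻¹ := by
    rw [hz, ← Real.rpow_mul hr.le, ← Real.rpow_add_one hr.ne', ← Real.rpow_neg hr.le]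
    congr 1
    field_simp
    ring
  rw [normGradRho_eq hα hp, e, psi, hrho, show ‖z.1‖ ^ (2*α) = wt α z from rfl]
  have : 0 < r ^ (2*α) := by positivity
  field_simp

lemma setIntegral_level_eq (hα : 0 < α) {r : ℝ} (hr : 0 < r) (f : E m n → ℝ) :
    ∫ z in {z | gaugePow α z = r ^ (2*(α+1))},
        f z ^ 2 * wt α z / √(gradGaugePowSq α z) ∂μH[(m + n - 1 : ℝ)] =
      (2*(α+1))⁻¹ * r⁻¹ * ∫ z in gsphere (m := m) (n := n) α r,
        f z ^ 2 * psi α z / normGradRho α z ∂μH[(m + n - 1 : ℝ)] := by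
  have hS : gsphere (m := m) (n := n) α r = {z | gaugePow α z = r ^ (2*(α+1))} :=
    Set.ext fun z => rho_eq_iff hα hr z
  rw [hS, ← integral_const_mul]
  exact setIntegral_congr_fun (isCompact_level hα _).measurableSet fun z hz =>
    level_integrand_eq hα hr f hz

lemma gball_eq (hα : 0 < α) {r : ℝ} (hr : 0 < r) :
    gball (m := m) (n := n) α r = {z | gaugePow α z < r ^ (2*(α+1))} :=
  Set.ext fun z => rho_lt_iff hα hr z

lemma setIntegral_sq_mul_wt_le (hα : 0 < α) (hm : 2 < m)
    {f : E m n → ℝ} (hf : IsAdmissible f) {r : ℝ} (hr : 0 < r) :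
    ∫ z in gball α r, f z ^ 2 * wt α z ≤ r ^ (2*(α+1)) *
      (2 * (m + n) * (r⁻¹ * ∫ z in gsphere (m := m) (n := n) α r,
        f z ^ 2 * psi α z / normGradRho α z ∂μH[(m + n - 1 : ℝ)]) +
        ∫ z in gball α r, gradXsq α f z) := by
  have h := trace_inequality hα (by omega) hf (R := r ^ (2*(α+1))) (by positivity)
    (hf.integrableOn_gradXsq hα hm (by positivity))
  rw [setIntegral_level_eq hα hr, ← gball_eq hα hr] at h
  have h0 : 0 ≤ ∫ z in gball α r, f z ^ 2 * wt α z :=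
    integral_nonneg fun z => mul_nonneg (sq_nonneg _) (wt_nonneg z)
  have hc : (1:ℝ) ≤ m + (α+1)*n + 2*α - 1 := by
    have h1 : (2:ℝ) ≤ m := by exact_mod_cast hm.le
    have h2 : 0 ≤ (α+1) * n := by positivity
    linarith
  refine (le_mul_of_one_le_left h0 hc).trans (h.trans (le_of_eq ?_))
  field_simp

lemma gaugePow_rpow_neg_le (hα : 0 < α) {R : ℝ} (hR : 0 < R) {z : E m n} :
    gaugePow α z ^ (-(2/(α+1))) ≤
      8 * (gaugePow α z ^ (-(2/(α+1))) * qcut α R z ^ 3) + 4 * R ^ (-(2/(α+1))) := by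
  have hp := gaugePow_nonneg (α := α) z
  have hk : 0 < 2/(α+1) := by positivity
  have hk2 : 2/(α+1) ≤ 2 := by rw [div_le_iff₀ (by linarith)]; linarith
  have hq := qcut_nonneg (α := α) R z
  rcases le_total (gaugePow α z) (R/2) with h | h
  · have h1 : 1/2 ≤ qcut α R z := by
      refine le_trans ?_ (le_max_right _ _)
      have : gaugePow α z / R ≤ 1/2 := by rw [div_le_iff₀ hR]; linarith
      linarith
    have h2 : (1/2)^3 ≤ qcut α R z ^ 3 := by gcongr
    have h3 : 0 ≤ gaugePow α z ^ (-(2/(α+1))) := by positivity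
    have h4 : 0 ≤ R ^ (-(2/(α+1))) := by positivity
    nlinarith
  · have h1 : gaugePow α z ^ (-(2/(α+1))) ≤ (R/2) ^ (-(2/(α+1))) :=
      Real.rpow_le_rpow_of_nonpos (by positivity) h (by linarith)
    have h2 : (R/2) ^ (-(2/(α+1))) ≤ 4 * R ^ (-(2/(α+1))) := by
      rw [Real.div_rpow hR.le (by norm_num), div_eq_mul_inv, Real.rpow_neg (x := 2) (by norm_num),
        inv_inv, mul_comm]
      gcongr
      calc (2:ℝ) ^ (2/(α+1)) ≤ 2 ^ (2:ℝ) := Real.rpow_le_rpow_of_exponent_le (by norm_num) hk2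
        _ = 4 := by norm_num
    have h3 : 0 ≤ 8 * (gaugePow α z ^ (-(2/(α+1))) * qcut α R z ^ 3) := by positivity
    linarith

lemma gradXsq_div_rho_pow (hα : 0 < α) (u : E m n → ℝ) (z : E m n) :
    gradXsq α u z / rho α z ^ 4 = gaugePow α z ^ (-(2/(α+1))) * gradXsq α u z := by
  have e : rho α z ^ 4 = gaugePow α z ^ (2/(α+1)) := by
    rw [rho_eq, ← Real.rpow_natCast, ← Real.rpow_mul (gaugePow_nonneg z)]
    congr 1
    field_simp
    norm_num
  rw [e, Real.rpow_neg (gaugePow_nonneg z), div_eq_inv_mul]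

theorem hardy_gradient_contDiff (hm : 2 < m) (hα : 0 < α) (hα1 : α ≤ 1)
    (hQ : 6 < (m : ℝ) + (α+1) * n) :
    ∃ C : ℝ, 0 < C ∧ ∀ r : ℝ, 0 < r → ∀ u : E m n → ℝ, ContDiff ℝ 3 u →
      ∫ z in gball (m := m) (n := n) α r, gradXsq α u z / (rho α z)^4
        ≤ C * (r^(-4 : ℤ) * (∫ z in gball (m := m) (n := n) α r, gradXsq α u z)
          + (∫ z in gball (m := m) (n := n) α r, gradXsq α (lapX α u) z)
          + r^(-5 : ℤ) * (∫ z in gsphere (m := m) (n := n) α r,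
              (u z)^2 * psi α z / normGradRho α z ∂μH[(m + n - 1 : ℝ)])
          + r⁻¹ * (∫ z in gsphere (m := m) (n := n) α r,
              (lapX α u z)^2 * psi α z / normGradRho α z ∂μH[(m + n - 1 : ℝ)])) := by
  obtain ⟨K, hK, hrel⟩ := rellich_inequality (m := m) (n := n) hα hα1 (by omega) hQ
  refine ⟨8 * K * (29 + 50 * (m + n)) + 4, by positivity, fun r hr u hu => ?_⟩
  have hR : 0 < r ^ (2*(α+1)) := by positivity
  have hw := lapX_isAdmissible hα hu
  have hua : IsAdmissible u := (hu.of_le (by norm_num)).isAdmissible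
  have hGw := hw.integrableOn_gradXsq hα hm hR
  have hGu := hua.integrableOn_gradXsq hα hm hR
  obtain ⟨hHi, hHle⟩ := hardy_inequality hα hm hw hR hGw
  obtain ⟨hRi, hRle⟩ := hrel _ u hR (hu.of_le (by norm_num)) hHi
  have hTu := setIntegral_sq_mul_wt_le hα hm hua hr
  have hTw := setIntegral_sq_mul_wt_le hα hm hw hr
  have hB := gball_eq (m := m) (n := n) hα hr
  rw [← hB] at hHle hRle hGu
  have hrk : (r ^ (2*(α+1))) ^ (-(2/(α+1))) = r ^ (-4 : ℤ) := by
    rw [← Real.rpow_mul hr.le, ← Real.rpow_intCast]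
    congr 1
    field_simp
    norm_num
  have hmB : MeasurableSet (gball (m := m) (n := n) α r) := by
    rw [hB]
    exact measurableSet_lt (continuous_gaugePow hα).measurable measurable_const
  have hL : ∫ z in gball (m := m) (n := n) α r, gradXsq α u z / (rho α z)^4 ≤
      8 * (∫ z, gaugePow α z ^(-(2/(α+1))) * qcut α (r ^ (2*(α+1))) z ^ 3 * gradXsq α u z) +
        4 * r ^ (-4 : ℤ) * ∫ z in gball (m := m) (n := n) α r, gradXsq α u z := by
    have hpos : ∀ z : E m n, 0 ≤
        gaugePow α z ^(-(2/(α+1))) * qcut α (r ^ (2*(α+1))) z ^ 3 * gradXsq α u z := fun z => by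
      have h1 := gaugePow_nonneg (α := α) z
      have h2 := qcut_nonneg (α := α) (r ^ (2*(α+1))) z
      have h3 := gradXsq_nonneg (α := α) u z
      positivity
    calc _ ≤ ∫ z in gball (m := m) (n := n) α r,
          (8 * (gaugePow α z ^(-(2/(α+1))) * qcut α (r ^ (2*(α+1))) z ^ 3 * gradXsq α u z) +
            4 * r ^ (-4 : ℤ) * gradXsq α u z) := by
          refine integral_mono_of_nonneg (ae_of_all _ fun z => ?_)
            ((hRi.integrableOn.const_mul _).add (hGu.const_mul _)) (ae_of_all _ fun z => ?_)
          · exact div_nonneg (gradXsq_nonneg u z) (by positivity)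
          · simp only
            rw [gradXsq_div_rho_pow hα, ← hrk]
            have h1 := mul_le_mul_of_nonneg_right (gaugePow_rpow_neg_le hα hR (z := z))
              (gradXsq_nonneg (α := α) u z)
            linarith
      _ = 8 * (∫ z in gball (m := m) (n := n) α r,
          gaugePow α z ^(-(2/(α+1))) * qcut α (r ^ (2*(α+1))) z ^ 3 * gradXsq α u z) +
            4 * r ^ (-4 : ℤ) * ∫ z in gball (m := m) (n := n) α r, gradXsq α u z := by
          rw [integral_add (hRi.integrableOn.const_mul _) (hGu.const_mul _), integral_const_mul,
            integral_const_mul]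
      _ ≤ _ := by
          have := setIntegral_le_integral (s := gball α r) hRi (ae_of_all _ hpos)
          linarith
  have hRk1 : (r ^ (2*(α+1))) ^ (-(2/(α+1)) - 1) = r ^ (-4 : ℤ) / r ^ (2*(α+1)) := by
    rw [Real.rpow_sub_one hR.ne', hrk]
  have hr5 : r ^ (-5 : ℤ) = r ^ (-4 : ℤ) * r⁻¹ := by
    rw [← zpow_neg_one, ← zpow_add₀ hr.ne']
    norm_num
  rw [hRk1] at hRle
  rw [hr5]
  have hpsi : ∀ f : E m n → ℝ, 0 ≤ ∫ z in gsphere (m := m) (n := n) α r,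
      f z ^ 2 * psi α z / normGradRho α z ∂μH[(m + n - 1 : ℝ)] := fun f =>
    integral_nonneg fun z => div_nonneg (mul_nonneg (sq_nonneg _)
      (div_nonneg (by positivity) (Real.rpow_nonneg (Real.rpow_nonneg (gaugePow_nonneg z) _) _)))
      (Real.sqrt_nonneg _)
  have hg : ∀ f : E m n → ℝ, 0 ≤ ∫ z in gball (m := m) (n := n) α r, gradXsq α f z := fun f =>
    integral_nonneg fun z => gradXsq_nonneg f z
  have a1 := hpsi u
  have a2 := hpsi (lapX α u)
  have a3 := hg u
  have a4 := hg (lapX α u)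
  set Tu := ∫ z in gsphere (m := m) (n := n) α r,
      u z ^ 2 * psi α z / normGradRho α z ∂μH[(m + n - 1 : ℝ)]
  set Tw := ∫ z in gsphere (m := m) (n := n) α r,
      lapX α u z ^ 2 * psi α z / normGradRho α z ∂μH[(m + n - 1 : ℝ)]
  set Du := ∫ z in gball (m := m) (n := n) α r, gradXsq α u z
  set Dw := ∫ z in gball (m := m) (n := n) α r, gradXsq α (lapX α u) z
  set R := r ^ (2*(α+1))
  set ρ := r ^ (-4 : ℤ)
  have hρ : 0 < ρ := by positivity
  have hri : 0 < r⁻¹ := by positivity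
  set N : ℝ := m + n with hN
  have hN0 : 0 ≤ N := by positivity
  have b1 : ρ / R * ∫ z in gball (m := m) (n := n) α r, u z ^ 2 * wt α z ≤
      ρ * (2 * N * (r⁻¹ * Tu) + Du) := by
    calc _ ≤ ρ / R * (R * (2 * N * (r⁻¹ * Tu) + Du)) := by gcongr
      _ = _ := by field_simp
  have b2 : 12*(α+1)/R * ∫ z in gball (m := m) (n := n) α r, lapX α u z ^ 2 * wt α z ≤
      24 * (2 * N * (r⁻¹ * Tw) + Dw) := by
    calc _ ≤ 12*(α+1)/R * (R * (2 * N * (r⁻¹ * Tw) + Dw)) := by gcongr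
      _ = 12*(α+1) * (2 * N * (r⁻¹ * Tw) + Dw) := by field_simp
      _ ≤ _ := by gcongr; linarith
  have p1 : 0 ≤ r⁻¹ * Tw := by positivity
  have p2 : 0 ≤ ρ * (r⁻¹ * Tu) := by positivity
  have p3 : 0 ≤ ρ * Du := by positivity
  have b3 : (∫ z : E m n, qcut α R z ^ 3 * lapX α u z ^ 2 / ‖z.1‖^2) +
      ρ / R * (∫ z in gball (m := m) (n := n) α r, u z ^ 2 * wt α z) ≤
      (29 + 50 * N) * (ρ * Du + Dw + ρ * r⁻¹ * Tu + r⁻¹ * Tw) := by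
    have c1 := mul_nonneg hN0 p1
    have c2 := mul_nonneg hN0 p2
    have c3 := mul_nonneg hN0 p3
    have c4 := mul_nonneg hN0 a4
    linarith
  have b4 := mul_le_mul_of_nonneg_left b3 hK.le
  calc _ ≤ _ := hL
    _ ≤ 8 * (K * ((29 + 50 * N) * (ρ * Du + Dw + ρ * r⁻¹ * Tu + r⁻¹ * Tw))) + 4 * ρ * Du := by
        linarith
    _ ≤ _ := by linarith

lemma gradXsq_congr {u v : E m n → ℝ} {z : E m n} (h : u =ᶠ[𝓝 z] v) :
    gradXsq α u z = gradXsq α v z := by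
  simp only [gradXsq, h.fderiv_eq]

lemma lapX_eventuallyEq {u v : E m n → ℝ} {z : E m n} (h : u =ᶠ[𝓝 z] v) :
    lapX α u =ᶠ[𝓝 z] lapX α v := by
  have h1 : ∀ e : E m n, ∀ᶠ w in 𝓝 z, fderiv ℝ (fun w => fderiv ℝ u w e) w =
      fderiv ℝ (fun w => fderiv ℝ v w e) w := fun e => by
    filter_upwards [(h.fderiv (𝕜 := ℝ)).eventually_nhds] with w hw
    exact EventuallyEq.fderiv_eq (hw.mono fun w' hw' => by simp only [hw'])
  filter_upwards [eventually_all.2 fun i => h1 (ex i), eventually_all.2 fun j => h1 (ey j)]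
    with w hx hy
  simp only [lapX_eq, hx, hy]

/-- A function smooth near a closed set agrees near that set with a globally smooth function. -/
lemma exists_contDiff_eventuallyEq {V : Type*} [NormedAddCommGroup V] [NormedSpace ℝ V]
    [FiniteDimensional ℝ V] {U S : Set V} (hU : IsOpen U) (hS : IsClosed S) (hSU : S ⊆ U)
    {u : V → ℝ} (hu : ContDiffOn ℝ (⊤ : ℕ∞) u U) :
    ∃ v : V → ℝ, ContDiff ℝ (⊤ : ℕ∞) v ∧ ∀ z ∈ S, u =ᶠ[𝓝 z] v := by
  obtain ⟨η, h0, h1, -⟩ := exists_contMDiffMap_zero_one_nhds_of_isClosed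
    (modelWithCornersSelf ℝ V) (n := ⊤) hU.isClosed_compl hS
    (Set.disjoint_left.2 fun z hz hz' => hz (hSU hz'))
  have hη : ContDiff ℝ (⊤ : ℕ∞) (η : V → ℝ) := η.contMDiff.contDiff
  refine ⟨fun z => η z * u z, contDiff_iff_contDiffAt.2 fun z => ?_, fun z hz => ?_⟩
  · by_cases hz : z ∈ U
    · exact hη.contDiffAt.mul ((hu z hz).contDiffAt (hU.mem_nhds hz))
    · refine (contDiffAt_const (c := (0:ℝ))).congr_of_eventuallyEq ?_
      filter_upwards [(eventually_nhdsSet_iff_forall.1 h0) z hz] with w hw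
      rw [hw, zero_mul]
  · filter_upwards [(eventually_nhdsSet_iff_forall.1 h1) z hz] with w hw
    rw [hw, one_mul]

end hardy_gradient

/-- local Hardy inequality for the Grushin gradient with fourth-order
weight: there exists `C = C(m,n,α)` such that for all `r > 0` and all smooth `u`,
`∫_{B_r} |∇_X u|²/ρ⁴ ≤ C ( r⁻⁴∫|∇_X u|² + ∫|∇_X(Δ_X u)|² + r⁻⁵∫_{∂B_r} u²ψ/|∇ρ|
+ r⁻¹∫_{∂B_r} (Δ_X u)²ψ/|∇ρ| )`. -/
theorem local_hardy_gradient {m n : ℕ} (hm : 2 < m) (hn : 1 ≤ n) (α : ℝ)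
    (hα : 0 < α) (hα1 : α ≤ 1) (hQ : 6 < (m : ℝ) + (α+1) * n) :
    ∃ C : ℝ, 0 < C ∧ ∀ r : ℝ, 0 < r → ∀ u : E m n → ℝ,
      (∃ U : Set (E m n), IsOpen U ∧ {z | rho α z ≤ r} ⊆ U ∧ ContDiffOn ℝ (⊤ : ℕ∞) u U) →
      ∫ z in gball (m := m) (n := n) α r, gradXsq α u z / (rho α z)^4
        ≤ C * (r^(-4 : ℤ) * (∫ z in gball (m := m) (n := n) α r, gradXsq α u z)
          + (∫ z in gball (m := m) (n := n) α r, gradXsq α (lapX α u) z)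
          + r^(-5 : ℤ) * (∫ z in gsphere (m := m) (n := n) α r,
              (u z)^2 * psi α z / normGradRho α z ∂μH[(m + n - 1 : ℝ)])
          + r⁻¹ * (∫ z in gsphere (m := m) (n := n) α r,
              (lapX α u z)^2 * psi α z / normGradRho α z ∂μH[(m + n - 1 : ℝ)])) := by
  obtain ⟨C, hC, h⟩ := hardy_gradient_contDiff (m := m) (n := n) hm hα hα1 hQ
  refine ⟨C, hC, fun r hr u ⟨U, hU, hsub, hu⟩ => ?_⟩
  have hset : {z : E m n | rho α z ≤ r} = {z | gaugePow α z ≤ r ^ (2*(α+1))} :=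
    Set.ext fun z => rho_le_iff hα hr z
  obtain ⟨v, hv, huv⟩ := exists_contDiff_eventuallyEq hU
    (hset ▸ (isCompact_sublevel hα _).isClosed) hsub hu
  have hmB : MeasurableSet (gball (m := m) (n := n) α r) := by
    rw [gball_eq hα hr]
    exact measurableSet_lt (continuous_gaugePow hα).measurable measurable_const
  have hmS : MeasurableSet (gsphere (m := m) (n := n) α r) := by
    rw [show gsphere (m := m) (n := n) α r = {z | gaugePow α z = r ^ (2*(α+1))} from
      Set.ext fun z => rho_eq_iff hα hr z]
    exact (isCompact_level hα _).measurableSet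
  have hBz : ∀ z ∈ gball (m := m) (n := n) α r, u =ᶠ[nhds z] v := fun z hz =>
    huv z (le_of_lt (show rho α z < r from hz))
  have hSz : ∀ z ∈ gsphere (m := m) (n := n) α r, u =ᶠ[nhds z] v := fun z hz =>
    huv z (le_of_eq (show rho α z = r from hz))
  have h := h r hr v (contDiff_infty.1 hv 3)
  have e1 : Set.EqOn (gradXsq α u) (gradXsq α v) (gball α r) := fun z hz => gradXsq_congr (hBz z hz)
  have e2 : Set.EqOn (gradXsq α (lapX α u)) (gradXsq α (lapX α v)) (gball α r) := fun z hz =>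
    gradXsq_congr (lapX_eventuallyEq (hBz z hz))
  have e3 : Set.EqOn u v (gsphere α r) := fun z hz => (hSz z hz).eq_of_nhds
  have e4 : Set.EqOn (lapX α u) (lapX α v) (gsphere α r) := fun z hz =>
    (lapX_eventuallyEq (hSz z hz)).eq_of_nhds
  rwa [setIntegral_congr_fun (f := fun z => gradXsq α u z / rho α z ^ 4)
      (g := fun z => gradXsq α v z / rho α z ^ 4) hmB fun z hz => by simp only [e1 hz],
    setIntegral_congr_fun hmB e1, setIntegral_congr_fun hmB e2,
    setIntegral_congr_fun (f := fun z => u z ^ 2 * psi α z / normGradRho α z)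
      (g := fun z => v z ^ 2 * psi α z / normGradRho α z) hmS fun z hz => by simp only [e3 hz],
    setIntegral_congr_fun (f := fun z => lapX α u z ^ 2 * psi α z / normGradRho α z)
      (g := fun z => lapX α v z ^ 2 * psi α z / normGradRho α z) hmS
      fun z hz => by simp only [e4 hz]]
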